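/- Let D ⊂ ℂ^n be a bounded strongly pseudoconvex domain: there is a C² function ρ defined on an open neighborhood of the closure of D with D = {ρ < 0}, ∂D = {ρ = 0}, the gradient of ρ nonvanishing on ∂D, and such that at every boundary point p ∈ ∂D the Levi form ∑_{j,k} (∂²ρ/∂z_j∂z̄_k)(p) w_j conj(w_k) is strictly positive for every nonzero w ∈ ℂ^n satisfying ∑_j (∂ρ/∂z_j)(p) w_j = 0. Then there exists a positive integer m, depending only on D, such that every automorphism f of D whose fixed point set is discrete in D has a finite fixed point set of cardinality at most m. -/

import Mathlib

open Set Metric Filter Topology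

noncomputable section

/-- `ℂ^n` with the Euclidean norm. -/
abbrev CSpace (n : ℕ) := EuclideanSpace ℂ (Fin n)

/-- `f` is an automorphism of the set `D`: a holomorphic bijection of `D` onto
itself with a holomorphic inverse. -/
def AutOn {n : ℕ} (D : Set (CSpace n)) (f : CSpace n → CSpace n) : Prop :=
  DifferentiableOn ℂ f D ∧ Set.BijOn f D D ∧
  ∃ g : CSpace n → CSpace n, DifferentiableOn ℂ g D ∧ Set.BijOn g D D ∧
    (∀ z ∈ D, g (f z) = z) ∧ (∀ z ∈ D, f (g z) = z)

/-- The fixed point set of `f` in `D`. -/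
def FixOn {n : ℕ} (D : Set (CSpace n)) (f : CSpace n → CSpace n) : Set (CSpace n) :=
  {z ∈ D | f z = z}

/-- Every point of `S` is isolated in `S`. -/
def DiscreteIn {n : ℕ} (S : Set (CSpace n)) : Prop :=
  ∀ z ∈ S, ∃ ε > 0, ∀ w ∈ S, w ≠ z → ε ≤ dist w z

/-- `f` extends holomorphically beyond the boundary of `D`. -/
def ExtendsHolo {n : ℕ} (D : Set (CSpace n)) (f : CSpace n → CSpace n) : Prop :=
  ∃ U : Set (CSpace n), IsOpen U ∧ closure D ⊆ U ∧
    ∃ F : CSpace n → CSpace n, DifferentiableOn ℂ F U ∧ Set.EqOn F f D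

/-- `H` is a compact subgroup of the automorphism group of `D`. -/
def IsCompactAutGroup {n : ℕ} (D : Set (CSpace n))
    (H : Set (CSpace n → CSpace n)) : Prop :=
  (∀ f ∈ H, AutOn D f) ∧
  (∃ e ∈ H, ∀ z ∈ D, e z = z) ∧
  (∀ f ∈ H, ∀ g ∈ H, ∃ h ∈ H, ∀ z ∈ D, h z = f (g z)) ∧
  (∀ f ∈ H, ∃ g ∈ H, (∀ z ∈ D, g (f z) = z) ∧ (∀ z ∈ D, f (g z) = z)) ∧
  (∀ u : ℕ → (CSpace n → CSpace n), (∀ k, u k ∈ H) →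
    ∃ φ : ℕ → ℕ, StrictMono φ ∧ ∃ f ∈ H, ∀ K : Set (CSpace n), K ⊆ D → IsCompact K →
      TendstoUniformlyOn (fun k => u (φ k)) f Filter.atTop K)

/-- The `j`-th standard basis vector of `ℂ^n`. -/
def basisVec {n : ℕ} (j : Fin n) : CSpace n := EuclideanSpace.single j 1

/-- The Wirtinger derivative `∂ρ/∂z_j` at `p`, where `∂/∂z_j = (1/2)(∂/∂x_j - i ∂/∂y_j)`. -/
def wirtingerDz {n : ℕ} (ρ : CSpace n → ℝ) (p : CSpace n) (j : Fin n) : ℂ :=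
  (1 / 2 : ℂ) * (((fderiv ℝ ρ p (basisVec j) : ℝ) : ℂ)
    - Complex.I * ((fderiv ℝ ρ p (Complex.I • basisVec j) : ℝ) : ℂ))

/-- The real second directional derivative of `ρ` at `p` along `u` and `v`. -/
def secondDeriv {n : ℕ} (ρ : CSpace n → ℝ) (p : CSpace n) (u v : CSpace n) : ℝ :=
  fderiv ℝ (fderiv ℝ ρ) p u v

/-- The mixed Wirtinger second derivative `∂²ρ/∂z_j∂z̄_k` at `p`, expressed in terms of
real second directional derivatives. -/
def wirtingerDzDzbar {n : ℕ} (ρ : CSpace n → ℝ) (p : CSpace n) (j k : Fin n) : ℂ :=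
  (1 / 4 : ℂ) *
    (((secondDeriv ρ p (basisVec j) (basisVec k)
        + secondDeriv ρ p (Complex.I • basisVec j) (Complex.I • basisVec k) : ℝ) : ℂ)
      + Complex.I * ((secondDeriv ρ p (basisVec j) (Complex.I • basisVec k)
        - secondDeriv ρ p (Complex.I • basisVec j) (basisVec k) : ℝ) : ℂ))

/-- The Levi form of `ρ` at `p` applied to `w ∈ ℂ^n`:
`∑_{j,k} (∂²ρ/∂z_j∂z̄_k)(p) w_j conj (w_k)`. -/
def leviForm {n : ℕ} (ρ : CSpace n → ℝ) (p : CSpace n) (w : Fin n → ℂ) : ℂ :=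
  ∑ j, ∑ k, wirtingerDzDzbar ρ p j k * w j * (starRingEnd ℂ) (w k)

/-- `ρ` is a `C²` defining function for `D` on the open neighborhood `V` of the closure
of `D`, strictly plurisubharmonic along complex tangent directions at every boundary
point; i.e. `D` is bounded strongly pseudoconvex. -/
def StronglyPseudoconvexDefiningFn {n : ℕ} (D V : Set (CSpace n))
    (ρ : CSpace n → ℝ) : Prop :=
  IsOpen V ∧ closure D ⊆ V ∧ ContDiffOn ℝ 2 ρ V ∧
    D = {z ∈ V | ρ z < 0} ∧ frontier D = {z ∈ V | ρ z = 0} ∧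
    (∀ z ∈ frontier D, fderiv ℝ ρ z ≠ 0) ∧
    ∀ p ∈ frontier D, ∀ w : Fin n → ℂ, w ≠ 0 →
      (∑ j, wirtingerDz ρ p j * w j) = 0 → 0 < (leviForm ρ p w).re

section Limits

section Ultralimit

variable {ι E F : Type*} [NormedAddCommGroup E] [NormedSpace ℂ E]
  [NormedAddCommGroup F] [NormedSpace ℂ F]

/-- A bounded family in a proper space converges along every ultrafilter. -/
theorem Ultrafilter.exists_tendsto_of_norm_le {G : Type*} [NormedAddCommGroup G] [ProperSpace G]
    (𝒰 : Ultrafilter ι) {u : ι → G} {C : ℝ} (hu : ∀ᶠ k in 𝒰, ‖u k‖ ≤ C) :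
    ∃ a, Tendsto u 𝒰 (𝓝 a) := by
  obtain ⟨a, -, ha⟩ := (isCompact_closedBall (0 : G) C).ultrafilter_le_nhds (𝒰.map u)
    (by
      rw [le_principal_iff]
      exact hu.mono fun k hk => by simpa using hk)
  exact ⟨a, ha⟩

theorem norm_sub_le_of_differentiableOn_ball {f : E → F} {z x : E} {r C : ℝ}
    (hd : DifferentiableOn ℂ f (ball z r)) (hC : ∀ x ∈ ball z r, ‖f x‖ ≤ C) (hx : x ∈ ball z r) :
    ‖f x - f z‖ ≤ 2 * C / r * ‖x - z‖ := by
  have hr : 0 < r := nonempty_ball.1 ⟨x, hx⟩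
  have := Complex.dist_le_div_mul_dist_of_mapsTo_ball (R₂ := 2 * C) hd
    (fun y hy => by
      rw [mem_closedBall, dist_eq_norm]
      linarith [norm_sub_le (f y) (f z), hC y hy, hC z (mem_ball_self hr)]) hx
  simpa [dist_eq_norm] using this

theorem norm_fderiv_le_of_differentiableOn_ball {f : E → F} {z : E} {r C : ℝ} (hr : 0 < r)
    (hd : DifferentiableOn ℂ f (ball z r)) (hC : ∀ x ∈ ball z r, ‖f x‖ ≤ C) :
    ‖fderiv ℂ f z‖ ≤ 2 * C / r :=
  Complex.norm_fderiv_le_div_of_mapsTo_ball (R₂ := 2 * C) hd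
    (fun y hy => by
      rw [mem_closedBall, dist_eq_norm]
      linarith [norm_sub_le (f y) (f z), hC y hy, hC z (mem_ball_self hr)]) hr

theorem norm_sub_sub_fderiv_le_of_differentiableOn_ball {f : E → F} {z x : E} {r C : ℝ}
    (hd : DifferentiableOn ℂ f (ball z r)) (hC : ∀ x ∈ ball z r, ‖f x‖ ≤ C) (hx : x ∈ ball z r) :
    ‖f x - f z - fderiv ℂ f z (x - z)‖ ≤ 4 * C * (‖x - z‖ / r) ^ 2 := by
  have hr : 0 < r := nonempty_ball.1 ⟨x, hx⟩
  set D := fderiv ℂ f z with hD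
  have hDn : ‖D‖ ≤ 2 * C / r := norm_fderiv_le_of_differentiableOn_ball hr hd hC
  have hdz : HasFDerivAt f D z :=
    (hd.differentiableAt (ball_mem_nhds z hr)).hasFDerivAt
  set h : E → F := fun y => f y - D (y - z) with hh
  have hz : h z = f z := by simp [hh]
  have := Complex.dist_le_mul_div_pow_of_mapsTo_ball_of_isLittleO (f := h) (c := z) (z := x)
    (R₁ := r) (R₂ := 4 * C) (n := 1) (by fun_prop)
    (fun y hy => by
      rw [mem_closedBall, dist_eq_norm, hz]
      have h1 : ‖D (y - z)‖ ≤ 2 * C := by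
        refine (D.le_opNorm _).trans ?_
        have hy' : ‖y - z‖ ≤ r := by simpa [dist_eq_norm] using (mem_ball.1 hy).le
        have hC0 : 0 ≤ 2 * C / r := (norm_nonneg _).trans hDn
        calc ‖D‖ * ‖y - z‖ ≤ 2 * C / r * r := by gcongr
          _ = 2 * C := by field_simp
      have h2 : h y - f z = f y - f z - D (y - z) := by simp only [hh]; abel
      rw [h2]
      linarith [norm_sub_le (f y - f z) (D (y - z)), norm_sub_le (f y) (f z), hC y hy,
        hC z (mem_ball_self hr)])
    (by
      rw [hz]
      have := hdz.isLittleO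
      simp only [pow_one]
      refine (this.norm_right).congr_left fun y => ?_
      simp only [hh]; abel) hx
  rw [dist_eq_norm, dist_eq_norm, hz] at this
  have h3 : h x - f z = f x - f z - D (x - z) := by simp only [hh]; abel
  rwa [h3] at this

variable [FiniteDimensional ℂ E] [FiniteDimensional ℂ F]

/-- Montel's theorem along an ultrafilter: a locally bounded family of holomorphic maps converges
continuously, together with its derivatives, to a holomorphic map. -/
theorem Ultrafilter.exists_holomorphic_limit (𝒰 : Ultrafilter ι) (f : ι → E → F) (Ω : Set E)
    (hf : ∀ z ∈ Ω, ∃ r > 0, ∃ C, ∀ᶠ k in 𝒰, DifferentiableOn ℂ (f k) (ball z r) ∧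
      ∀ x ∈ ball z r, ‖f k x‖ ≤ C) :
    ∃ g : E → F, DifferentiableOn ℂ g Ω ∧
      (∀ z ∈ Ω, ∀ x : ι → E, Tendsto x 𝒰 (𝓝 z) → Tendsto (fun k => f k (x k)) 𝒰 (𝓝 (g z))) ∧
      ∀ z ∈ Ω, Tendsto (fun k => fderiv ℂ (f k) z) 𝒰 (𝓝 (fderiv ℂ g z)) := by
  have : ProperSpace F := FiniteDimensional.proper ℂ F
  have : ProperSpace (E →L[ℂ] F) := FiniteDimensional.proper ℂ _
  let g : E → F := fun z => limUnder (𝒰 : Filter ι) (fun k => f k z)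
  have hg : ∀ z r C, (∀ᶠ k in 𝒰, DifferentiableOn ℂ (f k) (ball z r) ∧
      ∀ x ∈ ball z r, ‖f k x‖ ≤ C) → ∀ x ∈ ball z r, Tendsto (fun k => f k x) 𝒰 (𝓝 (g x)) := by
    intro z r C h x hx
    obtain ⟨a, ha⟩ := 𝒰.exists_tendsto_of_norm_le (u := fun k => f k x) (C := C)
      (h.mono fun k hk => hk.2 x hx)
    exact tendsto_nhds_limUnder ⟨a, ha⟩
  have key : ∀ z ∈ Ω, ∃ A : E →L[ℂ] F, HasFDerivAt g A z ∧
      Tendsto (fun k => fderiv ℂ (f k) z) 𝒰 (𝓝 A) := by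
    intro z hz
    obtain ⟨r, hr, C, h⟩ := hf z hz
    obtain ⟨A, hA⟩ := 𝒰.exists_tendsto_of_norm_le (u := fun k => fderiv ℂ (f k) z)
      (h.mono fun k hk => norm_fderiv_le_of_differentiableOn_ball hr hk.1 hk.2)
    refine ⟨A, ?_, hA⟩
    have hle : ∀ x ∈ ball z r, ‖g x - g z - A (x - z)‖ ≤ 4 * C * (‖x - z‖ / r) ^ 2 := by
      intro x hx
      have h1 := hg z r C h x hx
      have h2 := hg z r C h z (mem_ball_self hr)
      have h3 : Tendsto (fun k => fderiv ℂ (f k) z (x - z)) 𝒰 (𝓝 (A (x - z))) :=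
        ((ContinuousLinearMap.apply ℂ F (x - z)).continuous.tendsto A).comp hA
      exact le_of_tendsto ((h1.sub h2).sub h3).norm
        (h.mono fun k hk => norm_sub_sub_fderiv_le_of_differentiableOn_ball hk.1 hk.2 hx)
    rw [hasFDerivAt_iff_isLittleO]
    have hO : (fun x => g x - g z - A (x - z)) =O[𝓝 z] fun x => ‖x - z‖ ^ 2 := by
      refine Asymptotics.IsBigO.of_bound (4 * C / r ^ 2) ?_
      filter_upwards [ball_mem_nhds z hr] with x hx
      refine (hle x hx).trans_eq ?_
      simp only [norm_pow, norm_norm]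
      field_simp
    refine hO.trans_isLittleO ?_
    rw [Asymptotics.isLittleO_iff]
    intro c hc
    filter_upwards [ball_mem_nhds z hc] with x hx
    rw [norm_pow, norm_norm, sq]
    have : ‖x - z‖ ≤ c := by simpa [dist_eq_norm] using (mem_ball.1 hx).le
    gcongr
  refine ⟨g, fun z hz => ?_, fun z hz x hx => ?_, fun z hz => ?_⟩
  · obtain ⟨A, hA, -⟩ := key z hz
    exact hA.differentiableAt.differentiableWithinAt
  · obtain ⟨r, hr, C, h⟩ := hf z hz
    have h1 := hg z r C h z (mem_ball_self hr)
    have h2 : Tendsto (fun k => f k (x k) - f k z) 𝒰 (𝓝 0) := by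
      have h3 : Tendsto (fun k => 2 * C / r * ‖x k - z‖) 𝒰 (𝓝 0) := by
        have := ((hx.sub_const z).norm).const_mul (2 * C / r)
        simpa using this
      refine squeeze_zero_norm' ?_ h3
      filter_upwards [h, hx.eventually (ball_mem_nhds z hr)] with k hk hxk
      exact norm_sub_le_of_differentiableOn_ball hk.1 hk.2 hxk
    simpa using h2.add h1
  · obtain ⟨A, hA, hA'⟩ := key z hz
    rwa [hA.fderiv]

end Ultralimit

/-- Continuous convergence along an ultrafilter is uniform on compact sets, in the form needed to
trap images of compact sets. -/
theorem Ultrafilter.eventually_mapsTo_of_isCompact {ι X Y : Type*} [TopologicalSpace X]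
    [TopologicalSpace Y] (𝒰 : Ultrafilter ι) {f : ι → X → Y} {g : X → Y} {K : Set X} (hK : IsCompact K)
    (h : ∀ z ∈ K, ∀ x : ι → X, Tendsto x 𝒰 (𝓝 z) → Tendsto (fun k => f k (x k)) 𝒰 (𝓝 (g z)))
    {O : Set Y} (hO : IsOpen O) (hgO : ∀ z ∈ K, g z ∈ O) : ∀ᶠ k in 𝒰, MapsTo (f k) K O := by
  by_contra hcon
  rw [← Ultrafilter.eventually_not] at hcon
  have hne : ∃ z, z ∈ K := by
    by_contra! hK0
    obtain ⟨k, hk⟩ := hcon.exists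
    exact hk fun z hz => absurd hz (hK0 z)
  obtain ⟨z₀, hz₀⟩ := hne
  have hch : ∀ k, ∃ x ∈ K, (¬ MapsTo (f k) K O → f k x ∉ O) := by
    intro k
    by_cases hm : MapsTo (f k) K O
    · exact ⟨z₀, hz₀, fun h => absurd hm h⟩
    · simp only [MapsTo, not_forall] at hm
      obtain ⟨x, hx, hxO⟩ := hm
      exact ⟨x, hx, fun _ => hxO⟩
  choose x hxK hx using hch
  obtain ⟨z, hz, hxz⟩ := hK.ultrafilter_le_nhds (𝒰.map x)
    (by rw [le_principal_iff]; exact Filter.mem_map.2 (Filter.univ_mem' hxK))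
  have := (h z hz x hxz).eventually (hO.mem_nhds (hgO z hz))
  obtain ⟨k, hk1, hk2⟩ := (this.and hcon).exists
  exact hx k hk2 hk1

end Limits

section Automorphisms

variable {n : ℕ}

theorem AutOn.comp {D : Set (CSpace n)} {f₁ f₂ : CSpace n → CSpace n} (h₁ : AutOn D f₁)
    (h₂ : AutOn D f₂) : AutOn D (f₁ ∘ f₂) := by
  obtain ⟨hd₁, hb₁, g₁, hgd₁, hgb₁, hgf₁, hfg₁⟩ := h₁
  obtain ⟨hd₂, hb₂, g₂, hgd₂, hgb₂, hgf₂, hfg₂⟩ := h₂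
  refine ⟨hd₁.comp hd₂ hb₂.mapsTo, hb₁.comp hb₂, g₂ ∘ g₁, hgd₂.comp hgd₁ hgb₁.mapsTo,
    hgb₂.comp hgb₁, fun z hz => ?_, fun z hz => ?_⟩
  · simp [hgf₁ _ (hb₂.mapsTo hz), hgf₂ z hz]
  · simp [hfg₂ _ (hgb₁.mapsTo hz), hfg₁ z hz]

theorem autOn_id (D : Set (CSpace n)) : AutOn D id :=
  ⟨differentiableOn_id, bijOn_id D, id, differentiableOn_id, bijOn_id D, fun _ _ => rfl,
    fun _ _ => rfl⟩

theorem AutOn.iterate {D : Set (CSpace n)} {f : CSpace n → CSpace n} (h : AutOn D f) (k : ℕ) :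
    AutOn D f^[k] := by
  induction k with
  | zero => exact autOn_id D
  | succ k ih => exact ih.comp h

theorem AutOn.mapsTo {D : Set (CSpace n)} {f : CSpace n → CSpace n} (h : AutOn D f) :
    MapsTo f D D := h.2.1.mapsTo

theorem AutOn.exists_inverse {D : Set (CSpace n)} {f : CSpace n → CSpace n} (h : AutOn D f) :
    ∃ g, AutOn D g ∧ (∀ z ∈ D, g (f z) = z) ∧ ∀ z ∈ D, f (g z) = z := by
  obtain ⟨hd, hb, g, hgd, hgb, hgf, hfg⟩ := h
  exact ⟨g, ⟨hgd, hgb, f, hd, hb, hfg, hgf⟩, hgf, hfg⟩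

/-- The derivative at a fixed point of an automorphism of a bounded domain is power bounded. -/
theorem AutOn.norm_fderiv_pow_le {D : Set (CSpace n)} {f : CSpace n → CSpace n} {p : CSpace n}
    {R d : ℝ} (hD : IsOpen D) (hR : D ⊆ closedBall 0 R) (hd : 0 < d) (hpd : ball p d ⊆ D)
    (hf : AutOn D f) (hp : f p = p) (k : ℕ) : ‖fderiv ℂ f p ^ k‖ ≤ 2 * R / d := by
  have hpD : p ∈ D := hpd (mem_ball_self hd)
  have h1 : HasFDerivAt f (fderiv ℂ f p) p :=
    (hf.1.differentiableAt (hD.mem_nhds hpD)).hasFDerivAt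
  rw [← (h1.iterate hp k).fderiv]
  exact norm_fderiv_le_of_differentiableOn_ball hd ((hf.iterate k).1.mono hpd)
    fun x hx => by simpa using hR ((hf.iterate k).mapsTo (hpd hx))

theorem AutOn.exists_fderiv_inverse {D : Set (CSpace n)} {f : CSpace n → CSpace n} {p : CSpace n}
    {R d : ℝ} (hD : IsOpen D) (hR : D ⊆ closedBall 0 R) (hd : 0 < d) (hpd : ball p d ⊆ D)
    (hf : AutOn D f) (hp : f p = p) :
    ∃ B : CSpace n →L[ℂ] CSpace n, B * fderiv ℂ f p = 1 ∧ fderiv ℂ f p * B = 1 ∧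
      ∀ k : ℕ, ‖B ^ k‖ ≤ 2 * R / d := by
  have hpD : p ∈ D := hpd (mem_ball_self hd)
  obtain ⟨g, hg, hgf, hfg⟩ := hf.exists_inverse
  have hgp : g p = p := by simpa [hp] using hgf p hpD
  have h1 : HasFDerivAt f (fderiv ℂ f p) p :=
    (hf.1.differentiableAt (hD.mem_nhds hpD)).hasFDerivAt
  have h2 : HasFDerivAt g (fderiv ℂ g p) p :=
    (hg.1.differentiableAt (hD.mem_nhds hpD)).hasFDerivAt
  refine ⟨fderiv ℂ g p, ?_, ?_, hg.norm_fderiv_pow_le hD hR hd hpd hgp⟩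
  · have h3 : HasFDerivAt (g ∘ f) ((fderiv ℂ g p).comp (fderiv ℂ f p)) p :=
      HasFDerivAt.comp p (by rwa [hp]) h1
    have h4 : (g ∘ f) =ᶠ[𝓝 p] id := by
      filter_upwards [hD.mem_nhds hpD] with z hz using hgf z hz
    exact (h3.congr_of_eventuallyEq h4.symm).unique (hasFDerivAt_id p)
  · have h3 : HasFDerivAt (f ∘ g) ((fderiv ℂ f p).comp (fderiv ℂ g p)) p :=
      HasFDerivAt.comp p (by rwa [hgp]) h2
    have h4 : (f ∘ g) =ᶠ[𝓝 p] id := by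
      filter_upwards [hD.mem_nhds hpD] with z hz using hfg z hz
    exact (h3.congr_of_eventuallyEq h4.symm).unique (hasFDerivAt_id p)

theorem norm_average_le {E : Type*} [NormedAddCommGroup E] [NormedSpace ℂ E] {a : ℕ → E} {C : ℝ}
    (h : ∀ k, ‖a k‖ ≤ C) (N : ℕ) :
    ‖((N + 1 : ℕ) : ℂ)⁻¹ • ∑ k ∈ Finset.range (N + 1), a k‖ ≤ C := by
  rw [norm_smul, norm_inv, Complex.norm_natCast]
  have : ‖∑ k ∈ Finset.range (N + 1), a k‖ ≤ (N + 1 : ℕ) * C := by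
    refine (norm_sum_le_of_le _ fun k _ => h k).trans_eq ?_
    simp
  rw [inv_mul_le_iff₀ (by positivity)]
  exact this

theorem tendsto_inv_smul_of_norm_le {E : Type*} [NormedAddCommGroup E] [NormedSpace ℂ E]
    {a : ℕ → E} {C : ℝ} (h : ∀ k, ‖a k‖ ≤ C) :
    Tendsto (fun N : ℕ => ((N + 1 : ℕ) : ℂ)⁻¹ • a N) atTop (𝓝 0) := by
  have h1 : Tendsto (fun N : ℕ => ((N + 1 : ℕ) : ℝ)⁻¹ * C) atTop (𝓝 0) := by
    have : Tendsto (fun N : ℕ => ((N + 1 : ℕ) : ℝ)⁻¹) atTop (𝓝 0) :=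
      tendsto_inv_atTop_zero.comp (tendsto_natCast_atTop_atTop.comp (tendsto_add_atTop_nat 1))
    simpa using this.mul_const C
  refine squeeze_zero_norm (fun N => ?_) h1
  rw [norm_smul, norm_inv, Complex.norm_natCast]
  gcongr
  exact h N

/-- An automorphism of a bounded domain fixing a point is linearised by a holomorphic map
tangent to the identity. -/
theorem AutOn.exists_linearization {D : Set (CSpace n)} {f : CSpace n → CSpace n} {p : CSpace n}
    {R d : ℝ} (hD : IsOpen D) (hR : D ⊆ closedBall 0 R) (hd : 0 < d) (hpd : ball p d ⊆ D)
    (hf : AutOn D f) (hp : f p = p) :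
    ∃ Φ : CSpace n → CSpace n, DifferentiableOn ℂ Φ D ∧
      (∀ z ∈ D, ‖Φ z‖ ≤ 2 * R / d * (2 * R)) ∧ Φ p = 0 ∧ fderiv ℂ Φ p = 1 ∧
      ∀ z ∈ D, Φ (f z) = fderiv ℂ f p (Φ z) := by
  have hpD : p ∈ D := hpd (mem_ball_self hd)
  obtain ⟨B, hBA, hAB, hB⟩ := hf.exists_fderiv_inverse hD hR hd hpd hp
  set A := fderiv ℂ f p with hA
  let ψ : ℕ → CSpace n → CSpace n := fun k z => (B ^ k) (f^[k] z - p)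
  let φ : ℕ → CSpace n → CSpace n := fun N z =>
    ((N + 1 : ℕ) : ℂ)⁻¹ • ∑ k ∈ Finset.range (N + 1), ψ k z
  have hR' : ∀ z ∈ D, ‖z‖ ≤ R := fun z hz => by simpa using hR hz
  have hψ : ∀ z ∈ D, ∀ k, ‖ψ k z‖ ≤ 2 * R / d * (2 * R) := by
    intro z hz k
    refine ((B ^ k).le_opNorm _).trans ?_
    have h1 : ‖f^[k] z - p‖ ≤ 2 * R := by
      linarith [norm_sub_le (f^[k] z) p, hR' _ ((hf.iterate k).mapsTo hz), hR' p hpD]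
    have h0 := (norm_nonneg _).trans (hB k)
    gcongr
    exact hB k
  have hφ : ∀ z ∈ D, ∀ N, ‖φ N z‖ ≤ 2 * R / d * (2 * R) := fun z hz N =>
    norm_average_le (hψ z hz) N
  have hψd : ∀ k, DifferentiableOn ℂ (ψ k) D := fun k =>
    (B ^ k).differentiable.comp_differentiableOn ((hf.iterate k).1.sub_const p)
  have hφd : ∀ N, DifferentiableOn ℂ (φ N) D := fun N =>
    (DifferentiableOn.fun_sum fun k _ => hψd k).fun_const_smul _
  have hBk : ∀ k : ℕ, B ^ k * A ^ k = 1 := fun k => by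
    have hc : Commute B A := hBA.trans hAB.symm
    rw [← hc.mul_pow, hBA, one_pow]
  have hfp : HasFDerivAt f A p := (hf.1.differentiableAt (hD.mem_nhds hpD)).hasFDerivAt
  have hψp : ∀ k, HasFDerivAt (ψ k) (1 : CSpace n →L[ℂ] CSpace n) p := fun k => by
    have h1 : HasFDerivAt (fun z => f^[k] z - p) (A ^ k) p := (hfp.iterate hp k).sub_const p
    have h2 : HasFDerivAt (ψ k) ((B ^ k).comp (A ^ k)) p := (B ^ k).hasFDerivAt.comp p h1
    have h3 : (B ^ k).comp (A ^ k) = 1 := hBk k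
    rwa [h3] at h2
  have hφp : ∀ N, fderiv ℂ (φ N) p = 1 := fun N => by
    have h1 : HasFDerivAt (φ N) (((N + 1 : ℕ) : ℂ)⁻¹ •
        ∑ _k ∈ Finset.range (N + 1), (1 : CSpace n →L[ℂ] CSpace n)) p :=
      (HasFDerivAt.fun_sum (u := Finset.range (N + 1)) fun k _ => hψp k).const_smul
        (((N + 1 : ℕ) : ℂ)⁻¹)
    rw [h1.fderiv]
    have h0 : ((N + 1 : ℕ) : ℂ) ≠ 0 := Nat.cast_ne_zero.2 (Nat.succ_ne_zero N)
    rw [Finset.sum_const, Finset.card_range, ← Nat.cast_smul_eq_nsmul ℂ, smul_smul,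
      inv_mul_cancel₀ h0, one_smul]
  obtain ⟨Φ, hΦd, hΦ, hΦ'⟩ := (hyperfilter ℕ).exists_holomorphic_limit φ D (fun z hz => by
    obtain ⟨r, hr, hrD⟩ := Metric.isOpen_iff.1 hD z hz
    exact ⟨r, hr, _, Filter.Eventually.of_forall fun N =>
      ⟨(hφd N).mono hrD, fun x hx => hφ x (hrD hx) N⟩⟩)
  have hpt : ∀ z ∈ D, Tendsto (fun N => φ N z) (hyperfilter ℕ) (𝓝 (Φ z)) := fun z hz =>
    hΦ z hz _ tendsto_const_nhds
  refine ⟨Φ, hΦd, fun z hz => ?_, ?_, ?_, fun z hz => ?_⟩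
  · exact le_of_tendsto (hpt z hz).norm (Filter.Eventually.of_forall (hφ z hz))
  · refine tendsto_nhds_unique (hpt p hpD) ?_
    have : ∀ N, φ N p = 0 := fun N => by
      simp [φ, ψ, Function.iterate_fixed hp]
    simp [this]
  · have := hΦ' p hpD
    simp only [hφp] at this
    exact tendsto_nhds_unique this tendsto_const_nhds
  · have h1 : ∀ N, φ N (f z) = A (φ N z) +
        (A (((N + 1 : ℕ) : ℂ)⁻¹ • ψ (N + 1) z) - A (((N + 1 : ℕ) : ℂ)⁻¹ • ψ 0 z)) := by
      intro N
      have h2 : ∀ k, ψ k (f z) = A (ψ (k + 1) z) := by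
        intro k
        have h3 : A * B ^ (k + 1) = B ^ k := by rw [pow_succ', ← mul_assoc, hAB, one_mul]
        simp only [ψ, Function.iterate_succ_apply]
        rw [← h3]; rfl
      simp only [φ, h2, ← map_sum, ← map_smul, ← map_sub, ← map_add]
      rw [← smul_sub, ← smul_add]
      congr 2
      have h4 := Finset.sum_range_succ' (fun k => ψ k z) (N + 1)
      rw [Finset.sum_range_succ] at h4
      rw [← add_sub_assoc, h4, add_sub_cancel_right]
    have h2 : Tendsto (fun N => φ N (f z)) (hyperfilter ℕ) (𝓝 (A (Φ z) + (A 0 - A 0))) := by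
      simp only [h1]
      refine ((A.continuous.tendsto _).comp (hpt z hz)).add
        (((A.continuous.tendsto _).comp ?_).sub ((A.continuous.tendsto _).comp ?_))
      · exact (tendsto_inv_smul_of_norm_le fun k => hψ z hz (k + 1)).mono_left
          Nat.hyperfilter_le_atTop
      · exact (tendsto_inv_smul_of_norm_le (a := fun _ => ψ 0 z) fun _ => hψ z hz 0).mono_left
          Nat.hyperfilter_le_atTop
    simpa using tendsto_nhds_unique (hpt _ (hf.mapsTo hz)) h2

/-- A holomorphic map tangent to the identity is close to the identity on a ball of controlled
size. -/
theorem approximatesLinearOn_of_fderiv_eq_one {Φ : CSpace n → CSpace n} {p : CSpace n}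
    {d C t : ℝ} (hd : DifferentiableOn ℂ Φ (ball p d)) (hC : ∀ z ∈ ball p d, ‖Φ z‖ ≤ C)
    (h1 : fderiv ℂ Φ p = 1) (ht : 0 < t) (htd : 3 * t ≤ d) {c : NNReal}
    (hc : 36 * C * t / d ^ 2 ≤ c) :
    ApproximatesLinearOn Φ (1 : CSpace n →L[ℂ] CSpace n) (ball p t) c := by
  have hd0 : 0 < d := by linarith
  have hC0 : 0 ≤ C := (norm_nonneg _).trans (hC p (mem_ball_self hd0))
  rw [ApproximatesLinearOn.approximatesLinearOn_iff_lipschitzOnWith]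
  refine LipschitzOnWith.of_dist_le_mul fun y hy x hx => ?_
  rw [mem_ball, dist_eq_norm] at hx hy
  have hb : ∀ w ∈ ball x (2 * t), ‖w - p‖ ≤ 3 * t := fun w hw => by
    rw [mem_ball, dist_eq_norm] at hw
    have : w - p = (w - x) + (x - p) := by abel
    rw [this]
    linarith [norm_add_le (w - x) (x - p)]
  have hbd : ball x (2 * t) ⊆ ball p d := fun w hw => by
    rw [mem_ball, dist_eq_norm] at hw ⊢
    have : w - p = (w - x) + (x - p) := by abel
    rw [this]
    linarith [norm_add_le (w - x) (x - p)]
  have hΞ : ∀ w ∈ ball x (2 * t), ‖Φ w - Φ p - (w - p)‖ ≤ 36 * C * t ^ 2 / d ^ 2 := by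
    intro w hw
    have := norm_sub_sub_fderiv_le_of_differentiableOn_ball hd hC (hbd hw)
    rw [h1] at this
    refine this.trans ?_
    have h3 := hb w hw
    calc 4 * C * (‖w - p‖ / d) ^ 2 ≤ 4 * C * (3 * t / d) ^ 2 := by gcongr
      _ = 36 * C * t ^ 2 / d ^ 2 := by ring
  have hyx : y ∈ ball x (2 * t) := by
    rw [mem_ball, dist_eq_norm]
    have : y - x = (y - p) - (x - p) := by abel
    rw [this]
    linarith [norm_sub_le (y - p) (x - p)]
  have := norm_sub_le_of_differentiableOn_ball (f := fun w => Φ w - Φ p - (w - p))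
    (((hd.mono hbd).sub_const _).sub (differentiableOn_id.sub_const p)) hΞ hyx
  rw [dist_eq_norm, dist_eq_norm]
  have h4 : (Φ - ⇑(1 : CSpace n →L[ℂ] CSpace n)) y - (Φ - ⇑(1 : CSpace n →L[ℂ] CSpace n)) x
      = Φ y - Φ p - (y - p) - (Φ x - Φ p - (x - p)) := by
    simp only [Pi.sub_apply, one_apply_eq_self]; abel
  rw [h4]
  refine this.trans ?_
  have h5 : 2 * (36 * C * t ^ 2 / d ^ 2) / (2 * t) = 36 * C * t / d ^ 2 := by
    field_simp
  rw [h5]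
  gcongr

theorem ApproximatesLinearOn.injOn_of_one {Φ : CSpace n → CSpace n} {s : Set (CSpace n)}
    (h : ApproximatesLinearOn Φ (1 : CSpace n →L[ℂ] CSpace n) s (1 / 2)) : InjOn Φ s := by
  intro x hx y hy hxy
  have h1 := h x hx y hy
  rw [hxy, sub_self, zero_sub, norm_neg, one_apply_eq_self] at h1
  have h2 : ((1 / 2 : NNReal) : ℝ) = 1 / 2 := by simp
  rw [h2] at h1
  have h3 : ‖x - y‖ ≤ 0 := by linarith
  exact sub_eq_zero.1 (norm_le_zero_iff.1 h3)

/-- If the derivative at a fixed point has a nonzero fixed vector, the fixed point is not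
isolated. -/
theorem AutOn.eq_zero_of_fderiv_apply_eq {D : Set (CSpace n)} {f : CSpace n → CSpace n}
    {p : CSpace n} (hD : IsOpen D) (hb : Bornology.IsBounded D) (hf : AutOn D f)
    (hfix : DiscreteIn (FixOn D f)) (hp : p ∈ FixOn D f) {v : CSpace n}
    (hv : fderiv ℂ f p v = v) : v = 0 := by
  by_contra hv0
  obtain ⟨R, hR⟩ := hb.subset_closedBall 0
  obtain ⟨hpD, hfp⟩ := hp
  obtain ⟨d, hd, hpd⟩ := Metric.isOpen_iff.1 hD p hpD
  obtain ⟨Φ, hΦd, hΦC, hΦp, hΦ1, hΦf⟩ := hf.exists_linearization hD hR hd hpd hfp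
  set C := 2 * R / d * (2 * R) with hC
  have hC0 : 0 ≤ C := (norm_nonneg _).trans (hΦC p hpD)
  have happ : ∀ c : NNReal, 0 < c → ∃ t > 0, t ≤ d / 3 ∧
      ApproximatesLinearOn Φ (1 : CSpace n →L[ℂ] CSpace n) (ball p t) c := by
    intro c hc
    have hc' : (0 : ℝ) < c := hc
    refine ⟨min (d / 3) (c * d ^ 2 / (36 * (C + 1))), by positivity, min_le_left _ _, ?_⟩
    refine approximatesLinearOn_of_fderiv_eq_one (hΦd.mono hpd) (fun z hz => hΦC z (hpd hz)) hΦ1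
      (by positivity) (by linarith [min_le_left (d / 3) (c * d ^ 2 / (36 * (C + 1)))]) ?_
    calc 36 * C * min (d / 3) (c * d ^ 2 / (36 * (C + 1))) / d ^ 2
        ≤ 36 * C * (c * d ^ 2 / (36 * (C + 1))) / d ^ 2 := by
          gcongr; exact min_le_right _ _
      _ = c * (C / (C + 1)) := by field_simp
      _ ≤ c * 1 := by
          gcongr
          rw [div_le_one (by linarith)]; linarith
      _ = c := mul_one _
  have hstrict : HasStrictFDerivAt Φ
      ((ContinuousLinearEquiv.refl ℂ (CSpace n) : CSpace n ≃L[ℂ] CSpace n) :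
        CSpace n →L[ℂ] CSpace n) p := by
    rw [hasStrictFDerivAt_iff_isLittleO, Asymptotics.isLittleO_iff]
    intro c hc
    obtain ⟨t, ht, -, hlin⟩ := happ ⟨c, hc.le⟩ hc
    have h1 : ball p t ×ˢ ball p t ∈ 𝓝 (p, p) := prod_mem_nhds (ball_mem_nhds p ht)
      (ball_mem_nhds p ht)
    filter_upwards [h1] with x hx
    exact hlin x.1 hx.1 x.2 hx.2
  obtain ⟨t, ht, htd, hlin⟩ := happ (1 / 2) (by norm_num)
  have hinj : InjOn Φ (ball p t) := hlin.injOn_of_one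
  obtain ⟨ε, hε, hiso⟩ := hfix p ⟨hpD, hfp⟩
  have hfc : ContinuousAt f p := (hf.1.differentiableAt (hD.mem_nhds hpD)).continuousAt
  have hU : ∀ᶠ x in 𝓝 p, x ∈ D ∧ x ∈ ball p t ∧ f x ∈ ball p t ∧ dist x p < ε := by
    filter_upwards [hD.mem_nhds hpD, ball_mem_nhds p ht,
      hfc.eventually (by rw [hfp]; exact ball_mem_nhds p ht), ball_mem_nhds p hε] with x h1 h2 h3 h4
    exact ⟨h1, h2, h3, h4⟩
  have hmap := hstrict.map_nhds_eq_of_equiv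
  rw [hΦp] at hmap
  have hev : ∀ᶠ y in 𝓝 (0 : CSpace n), ∃ x, (x ∈ D ∧ x ∈ ball p t ∧ f x ∈ ball p t ∧
      dist x p < ε) ∧ Φ x = y := by
    rw [← hmap]
    exact Filter.eventually_map.2 (hU.mono fun x hx => ⟨x, hx, rfl⟩)
  have hlim : Tendsto (fun s : ℂ => s • v) (𝓝[≠] 0) (𝓝 0) := by
    have : Tendsto (fun s : ℂ => s • v) (𝓝 0) (𝓝 ((0 : ℂ) • v)) :=
      (continuous_id.smul continuous_const).tendsto 0
    rw [zero_smul] at this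
    exact this.mono_left nhdsWithin_le_nhds
  obtain ⟨s, ⟨x, ⟨hxD, hxt, hfxt, hxε⟩, hx⟩, hs⟩ :=
    ((hlim.eventually hev).and self_mem_nhdsWithin).exists
  have hfx : f x = x := by
    refine hinj hfxt hxt ?_
    rw [hΦf x hxD, hx, map_smul, hv]
  have hxp : x ≠ p := by
    rintro rfl
    rw [hΦp] at hx
    exact smul_ne_zero hs hv0 hx.symm
  exact absurd (hiso x ⟨hxD, hfx⟩ hxp) (not_le.2 hxε)

/-- Two isolated fixed points of an automorphism cannot be too close to each other. -/
theorem AutOn.exists_separation {D : Set (CSpace n)} (hD : IsOpen D)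
    (hb : Bornology.IsBounded D) {d : ℝ} (hd : 0 < d) :
    ∃ t > 0, ∀ f, AutOn D f → DiscreteIn (FixOn D f) → ∀ p ∈ FixOn D f, ball p d ⊆ D →
      ∀ q ∈ FixOn D f, dist q p < t → q = p := by
  obtain ⟨R', hR'⟩ := hb.subset_closedBall 0
  set R := max R' 0
  have hR : D ⊆ closedBall 0 R := hR'.trans (closedBall_subset_closedBall (le_max_left _ _))
  have hR0 : 0 ≤ R := le_max_right _ _
  set C := 2 * R / d * (2 * R) with hC
  have hC0 : 0 ≤ C := by positivity
  refine ⟨min (d / 3) (d ^ 2 / (72 * (C + 1))), by positivity, fun f hf hfix p hp hpd q hq hqp => ?_⟩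
  obtain ⟨Φ, hΦd, hΦC, hΦp, hΦ1, hΦf⟩ := hf.exists_linearization hD hR hd hpd hp.2
  have hlin : ApproximatesLinearOn Φ (1 : CSpace n →L[ℂ] CSpace n)
      (ball p (min (d / 3) (d ^ 2 / (72 * (C + 1))))) (1 / 2) := by
    refine approximatesLinearOn_of_fderiv_eq_one (hΦd.mono hpd) (fun z hz => hΦC z (hpd hz)) hΦ1
      (by positivity) (by linarith [min_le_left (d / 3) (d ^ 2 / (72 * (C + 1)))]) ?_
    calc 36 * C * min (d / 3) (d ^ 2 / (72 * (C + 1))) / d ^ 2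
        ≤ 36 * C * (d ^ 2 / (72 * (C + 1))) / d ^ 2 := by
          gcongr; exact min_le_right _ _
      _ = 1 / 2 * (C / (C + 1)) := by field_simp; ring
      _ ≤ 1 / 2 * 1 := by
          gcongr
          rw [div_le_one (by linarith)]; linarith
      _ = _ := by simp
  have hinj : InjOn Φ (ball p (min (d / 3) (d ^ 2 / (72 * (C + 1))))) := hlin.injOn_of_one
  have h1 : Φ q = 0 := by
    refine hf.eq_zero_of_fderiv_apply_eq hD hb hfix hp ?_
    rw [← hΦf q hq.1, hq.2]
  refine hinj hqp (mem_ball_self (by positivity)) ?_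
  rw [h1, hΦp]

end Automorphisms

section LeviForm

variable {n : ℕ}

/-- The complex-linear map whose real part is the real differential. -/
def cgrad (ρ : CSpace n → ℝ) (a : CSpace n) : CSpace n →L[ℂ] ℂ :=
  StrongDual.extendRCLikeₗᵢ (𝕜 := ℂ) (fderiv ℝ ρ a)

theorem cgrad_apply (ρ : CSpace n → ℝ) (a v : CSpace n) :
    cgrad ρ a v = fderiv ℝ ρ a v - Complex.I * fderiv ℝ ρ a (Complex.I • v) :=
  StrongDual.extendRCLike_apply (𝕜 := ℂ) (fderiv ℝ ρ a) v

theorem re_cgrad (ρ : CSpace n → ℝ) (a v : CSpace n) : (cgrad ρ a v).re = fderiv ℝ ρ a v := by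
  simp [cgrad_apply]

theorem sum_smul_basisVec (v : CSpace n) : ∑ j, v j • (basisVec j : CSpace n) = v := by
  ext k
  simp [basisVec, Pi.single_apply]

/-- Expansion of a real-linear map on a complex multiple. -/
theorem map_complex_smul {F : Type*} [NormedAddCommGroup F] [NormedSpace ℝ F]
    (T : CSpace n →L[ℝ] F) (c : ℂ) (v : CSpace n) :
    T (c • v) = c.re • T v + c.im • T (Complex.I • v) := by
  have h : c • v = c.re • v + c.im • (Complex.I • v) := by
    conv_lhs => rw [← Complex.re_add_im c, add_smul, mul_smul]
    rfl
  rw [h, map_add, map_smul, map_smul]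

theorem I_smul_I_smul (v : CSpace n) : Complex.I • Complex.I • v = -v := by
  rw [smul_smul, Complex.I_mul_I, neg_smul, one_smul]

/-- The sesquilinear part of a real bilinear form. -/
def sesqPart (S : CSpace n →L[ℝ] CSpace n →L[ℝ] ℝ) :
    CSpace n →ₗ[ℂ] CSpace n →ₛₗ[starRingEnd ℂ] ℂ :=
  LinearMap.mk₂'ₛₗ (RingHom.id ℂ) (starRingEnd ℂ)
    (fun u v => ((S u v + S (Complex.I • u) (Complex.I • v) : ℝ) : ℂ)
      + Complex.I * ((S u (Complex.I • v) - S (Complex.I • u) v : ℝ) : ℂ))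
    (fun u u' v => by simp only [smul_add, map_add, add_apply]; push_cast; ring)
    (fun c u v => by
      rw [smul_comm Complex.I c u, map_complex_smul S c u, map_complex_smul S c (Complex.I • u),
        I_smul_I_smul]
      apply Complex.ext <;> simp <;> ring)
    (fun u v v' => by simp only [smul_add, map_add]; push_cast; ring)
    (fun c u v => by
      rw [smul_comm Complex.I c v]
      simp only [map_complex_smul _ c, I_smul_I_smul]
      apply Complex.ext <;> simp <;> ring)

theorem sesqPart_apply (S : CSpace n →L[ℝ] CSpace n →L[ℝ] ℝ) (u v : CSpace n) :
    sesqPart S u v = ((S u v + S (Complex.I • u) (Complex.I • v) : ℝ) : ℂ)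
      + Complex.I * ((S u (Complex.I • v) - S (Complex.I • u) v : ℝ) : ℂ) := rfl

/-- The complex bilinear part of a real bilinear form. -/
def bilinPart (S : CSpace n →L[ℝ] CSpace n →L[ℝ] ℝ) : CSpace n →L[ℂ] CSpace n →L[ℂ] ℂ :=
  LinearMap.mkContinuous₂ (LinearMap.mk₂ ℂ
    (fun u v => (4 : ℂ)⁻¹ * (((S u v - S (Complex.I • u) (Complex.I • v) : ℝ) : ℂ)
      - Complex.I * ((S u (Complex.I • v) + S (Complex.I • u) v : ℝ) : ℂ)))
    (fun u u' v => by simp only [smul_add, map_add, add_apply]; push_cast; ring)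
    (fun c u v => by
      rw [smul_comm Complex.I c u, map_complex_smul S c u, map_complex_smul S c (Complex.I • u),
        I_smul_I_smul]
      apply Complex.ext <;> simp <;> ring)
    (fun u v v' => by simp only [smul_add, map_add]; push_cast; ring)
    (fun c u v => by
      rw [smul_comm Complex.I c v]
      simp only [map_complex_smul _ c, I_smul_I_smul]
      apply Complex.ext <;> simp <;> ring)) ‖S‖
    (fun u v => by
      have h : ∀ u' v' : CSpace n, ‖u'‖ = ‖u‖ → ‖v'‖ = ‖v‖ → ‖((S u' v' : ℝ) : ℂ)‖ ≤ ‖S‖ * ‖u‖ * ‖v‖ :=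
        fun u' v' hu hv => by
          rw [Complex.norm_real, ← hu, ← hv]; exact S.le_opNorm₂ u' v'
      have hI : ∀ w : CSpace n, ‖Complex.I • w‖ = ‖w‖ := fun w => by simp [norm_smul]
      simp only [LinearMap.mk₂_apply]
      push_cast
      rw [norm_mul, norm_inv]
      have h4 : ‖(4 : ℂ)‖ = 4 := by simp
      rw [h4, inv_mul_le_iff₀ (by norm_num)]
      refine (norm_sub_le _ _).trans ?_
      rw [norm_mul, Complex.norm_I, one_mul]
      linarith [norm_sub_le ((S u v : ℝ) : ℂ) (S (Complex.I • u) (Complex.I • v) : ℝ),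
        norm_add_le ((S u (Complex.I • v) : ℝ) : ℂ) (S (Complex.I • u) v : ℝ),
        h u v rfl rfl, h _ _ (hI u) (hI v), h _ _ rfl (hI v), h _ _ (hI u) rfl])

theorem re_bilinPart (S : CSpace n →L[ℝ] CSpace n →L[ℝ] ℝ) (v : CSpace n) :
    (bilinPart S v v).re = 4⁻¹ * (S v v - S (Complex.I • v) (Complex.I • v)) := by
  have : bilinPart S v v = (4 : ℂ)⁻¹ * (((S v v - S (Complex.I • v) (Complex.I • v) : ℝ) : ℂ)
      - Complex.I * ((S v (Complex.I • v) + S (Complex.I • v) v : ℝ) : ℂ)) := rfl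
  rw [this]
  simp

/-- The Levi form of `ρ` in real notation. -/
def levi (ρ : CSpace n → ℝ) (b v : CSpace n) : ℝ :=
  4⁻¹ * (fderiv ℝ (fderiv ℝ ρ) b v v +
    fderiv ℝ (fderiv ℝ ρ) b (Complex.I • v) (Complex.I • v))

theorem re_leviForm (ρ : CSpace n → ℝ) (b v : CSpace n) :
    (leviForm ρ b v).re = levi ρ b v := by
  have h : leviForm ρ b v = (4 : ℂ)⁻¹ * sesqPart (fderiv ℝ (fderiv ℝ ρ) b) v v := by
    conv_rhs => rw [← sum_smul_basisVec v]
    simp only [map_sum, LinearMap.sum_apply, map_smul, LinearMap.smul_apply, map_smulₛₗ]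
    rw [leviForm, Finset.sum_comm, Finset.mul_sum]
    refine Finset.sum_congr rfl fun j _ => ?_
    rw [Finset.smul_sum, Finset.mul_sum]
    refine Finset.sum_congr rfl fun k _ => ?_
    rw [sesqPart_apply]
    simp only [wirtingerDzDzbar, secondDeriv, smul_eq_mul]
    push_cast
    ring
  rw [h, sesqPart_apply, levi]
  simp

theorem sum_wirtingerDz (ρ : CSpace n → ℝ) (b v : CSpace n) :
    ∑ j, wirtingerDz ρ b j * v j = 2⁻¹ * cgrad ρ b v := by
  conv_rhs => rw [← sum_smul_basisVec v]
  rw [map_sum, Finset.mul_sum]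
  refine Finset.sum_congr rfl fun j _ => ?_
  rw [map_smul, cgrad_apply, wirtingerDz, smul_eq_mul]
  ring

theorem half_secondDeriv (ρ : CSpace n → ℝ) (b v : CSpace n) :
    2⁻¹ * fderiv ℝ (fderiv ℝ ρ) b v v =
      (bilinPart (fderiv ℝ (fderiv ℝ ρ) b) v v).re + levi ρ b v := by
  rw [re_bilinPart, levi]; ring

end LeviForm

section Defining

variable {n : ℕ}

/-- A `C²` defining function of `D` which is strictly plurisubharmonic on a neighbourhood `W` of
the boundary. -/
structure PshDefining (D V W : Set (CSpace n)) (ρ : CSpace n → ℝ) : Prop where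
  isOpen : IsOpen V
  closure_subset : closure D ⊆ V
  contDiffOn : ContDiffOn ℝ 2 ρ V
  mem_iff : ∀ z ∈ V, z ∈ D ↔ ρ z < 0
  mem_frontier_iff : ∀ z ∈ V, z ∈ frontier D ↔ ρ z = 0
  fderiv_ne : ∀ z ∈ frontier D, fderiv ℝ ρ z ≠ 0
  isOpen' : IsOpen W
  subset : W ⊆ V
  frontier_subset : frontier D ⊆ W
  levi_pos : ∀ b ∈ W, ∀ v, v ≠ 0 → 0 < levi ρ b v

theorem IsCompact.exists_add_mul_pos {X : Type*} [TopologicalSpace X] {K : Set X}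
    (hK : IsCompact K) {a b : X → ℝ} (ha : ContinuousOn a K) (hb : ContinuousOn b K)
    (hb0 : ∀ x ∈ K, 0 ≤ b x) (hab : ∀ x ∈ K, b x = 0 → 0 < a x) :
    ∃ C > 0, ∀ x ∈ K, 0 < a x + C * b x := by
  by_contra! hcon
  choose! x hxK hx using fun k : ℕ => hcon (k + 1) (by positivity)
  obtain ⟨y, hy, hxy⟩ := hK.ultrafilter_le_nhds ((hyperfilter ℕ).map x)
    (by rw [le_principal_iff]; exact Filter.mem_map.2 (Filter.univ_mem' hxK))
  have hxy' : Tendsto x (hyperfilter ℕ) (𝓝[K] y) :=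
    tendsto_nhdsWithin_iff.2 ⟨hxy, Filter.Eventually.of_forall hxK⟩
  have h1 : Tendsto (fun k => a (x k)) (hyperfilter ℕ) (𝓝 (a y)) := (ha y hy).tendsto.comp hxy'
  have h2 : Tendsto (fun k => b (x k)) (hyperfilter ℕ) (𝓝 (b y)) := (hb y hy).tendsto.comp hxy'
  have h3 : Tendsto (fun k : ℕ => ((k : ℝ) + 1)⁻¹) (hyperfilter ℕ) (𝓝 0) :=
    ((tendsto_inv_atTop_zero.comp (tendsto_atTop_add_const_right _ 1
      tendsto_natCast_atTop_atTop))).mono_left Nat.hyperfilter_le_atTop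
  have h4 : b y ≤ 0 := by
    have h5 : Tendsto (fun k : ℕ => ((k : ℝ) + 1)⁻¹ * a (x k) + b (x k)) (hyperfilter ℕ)
        (𝓝 (0 * a y + b y)) := (h3.mul h1).add h2
    rw [zero_mul, zero_add] at h5
    refine le_of_tendsto h5 (Filter.Eventually.of_forall fun k => ?_)
    have h6 : (0 : ℝ) < (k : ℝ) + 1 := by positivity
    have h7 : ((k : ℝ) + 1)⁻¹ * a (x k) + b (x k)
        = ((k : ℝ) + 1)⁻¹ * (a (x k) + ((k : ℝ) + 1) * b (x k)) := by field_simp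
    rw [h7]
    exact mul_nonpos_of_nonneg_of_nonpos (by positivity) (hx k)
  have h5 : a y ≤ 0 := le_of_tendsto h1 (Filter.Eventually.of_forall fun k => by
    have := hx k
    have h6 : 0 ≤ ((k : ℝ) + 1) * b (x k) := mul_nonneg (by positivity) (hb0 _ (hxK k))
    linarith)
  exact absurd (hab y hy (le_antisymm h4 (hb0 y hy))) (not_lt.2 h5)

theorem levi_smul (ρ : CSpace n → ℝ) (b v : CSpace n) (t : ℝ) :
    levi ρ b (t • v) = t ^ 2 * levi ρ b v := by
  simp only [levi, smul_comm Complex.I t v, map_smul, smul_apply, smul_eq_mul]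
  ring

section C2

variable {V : Set (CSpace n)} {ρ : CSpace n → ℝ}

theorem ContDiffOn.hasStrictFDerivAt_fderiv_of_two (hV : IsOpen V) (hρ : ContDiffOn ℝ 2 ρ V)
    {p : CSpace n} (hp : p ∈ V) :
    HasStrictFDerivAt (fderiv ℝ ρ) (fderiv ℝ (fderiv ℝ ρ) p) p :=
  (((hρ.contDiffAt (hV.mem_nhds hp)).fderiv_right (m := 1) (by norm_num))).hasStrictFDerivAt
    (by norm_num)

theorem ContDiffOn.continuousOn_fderiv_fderiv (hV : IsOpen V) (hρ : ContDiffOn ℝ 2 ρ V) :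
    ContinuousOn (fderiv ℝ (fderiv ℝ ρ)) V :=
  ((hρ.fderiv_of_isOpen hV (m := 1) (by norm_num)).continuousOn_fderiv_of_isOpen hV (by norm_num))

theorem ContDiffOn.continuousOn_levi (hV : IsOpen V) (hρ : ContDiffOn ℝ 2 ρ V) :
    ContinuousOn (fun x : CSpace n × CSpace n => levi ρ x.1 x.2) (V ×ˢ univ) := by
  have h1 : ContinuousOn (fun x : CSpace n × CSpace n => fderiv ℝ (fderiv ℝ ρ) x.1) (V ×ˢ univ) :=
    (hρ.continuousOn_fderiv_fderiv hV).comp continuousOn_fst fun x hx => hx.1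
  have h2 : ContinuousOn (fun x : CSpace n × CSpace n => Complex.I • x.2) (V ×ˢ univ) := by
    fun_prop
  exact (((h1.clm_apply continuousOn_snd).clm_apply continuousOn_snd).add
    ((h1.clm_apply h2).clm_apply h2)).const_mul _

/-- The Levi form of `exp (C ρ) - 1`. -/
theorem levi_exp (hV : IsOpen V) (hρ : ContDiffOn ℝ 2 ρ V) (C : ℝ) {b : CSpace n} (hb : b ∈ V)
    (v : CSpace n) : levi (fun z => Real.exp (C * ρ z) - 1) b v = C * Real.exp (C * ρ b) *
      (levi ρ b v + C * (4⁻¹ * ((fderiv ℝ ρ b v) ^ 2 + (fderiv ℝ ρ b (Complex.I • v)) ^ 2))) := by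
  have h1 : ∀ z ∈ V, HasFDerivAt (fun z => Real.exp (C * ρ z) - 1)
      ((Real.exp (C * ρ z) * C) • fderiv ℝ ρ z) z := fun z hz => by
    have h2 : HasFDerivAt ρ (fderiv ℝ ρ z) z :=
      ((hρ.contDiffAt (hV.mem_nhds hz)).differentiableAt (by norm_num)).hasFDerivAt
    have := (((h2.const_mul C)).exp).sub_const 1
    rwa [smul_smul] at this
  have h2 : fderiv ℝ (fun z => Real.exp (C * ρ z) - 1) =ᶠ[𝓝 b]
      fun z => (Real.exp (C * ρ z) * C) • fderiv ℝ ρ z := by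
    filter_upwards [hV.mem_nhds hb] with z hz using (h1 z hz).fderiv
  have h3 : HasFDerivAt ρ (fderiv ℝ ρ b) b :=
    ((hρ.contDiffAt (hV.mem_nhds hb)).differentiableAt (by norm_num)).hasFDerivAt
  have h4 := (hρ.hasStrictFDerivAt_fderiv_of_two hV hb).hasFDerivAt
  have h5 := (((h3.const_mul C).exp).mul_const C).smul h4
  have h6 : fderiv ℝ (fderiv ℝ (fun z => Real.exp (C * ρ z) - 1)) b = _ :=
    (h5.congr_of_eventuallyEq h2).fderiv
  simp only [levi, h6]
  simp
  ring

/-- Uniform second order Taylor expansion. -/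
theorem ContDiffOn.exists_taylor (hV : IsOpen V) (hρ : ContDiffOn ℝ 2 ρ V) {p : CSpace n}
    (hp : p ∈ V) {ε : ℝ} (hε : 0 < ε) : ∃ r > 0, ball p r ⊆ V ∧ ∀ a ∈ ball p r, ∀ z ∈ ball p r,
      |ρ z - ρ a - fderiv ℝ ρ a (z - a) - 2⁻¹ * fderiv ℝ (fderiv ℝ ρ) p (z - a) (z - a)| ≤
        ε * ‖z - a‖ ^ 2 := by
  set S := fderiv ℝ (fderiv ℝ ρ) p with hS
  have h1 := (hρ.hasStrictFDerivAt_fderiv_of_two hV hp).isLittleO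
  rw [Asymptotics.isLittleO_iff] at h1
  have h2 := h1 hε
  rw [nhds_prod_eq, (Metric.nhds_basis_ball.prod_self).eventually_iff] at h2
  obtain ⟨r₁, hr₁, h2⟩ := h2
  obtain ⟨r₂, hr₂, hV₂⟩ := Metric.isOpen_iff.1 hV p hp
  refine ⟨min r₁ r₂, lt_min hr₁ hr₂, (ball_subset_ball (min_le_right _ _)).trans hV₂,
    fun a ha z hz => ?_⟩
  set v := z - a with hv
  have hseg : ∀ t ∈ Icc (0 : ℝ) 1, a + t • v ∈ ball p (min r₁ r₂) := fun t ht => by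
    have := (convex_ball p (min r₁ r₂)).add_smul_sub_mem ha hz ht
    rwa [← hv] at this
  let g : ℝ → ℝ := fun t => ρ (a + t • v) - ρ a - t * fderiv ℝ ρ a v - 2⁻¹ * t ^ 2 * S v v
  let g' : ℝ → ℝ := fun t => fderiv ℝ ρ (a + t • v) v - fderiv ℝ ρ a v - t * S v v
  have hg : ∀ t ∈ Icc (0 : ℝ) 1, HasDerivWithinAt g (g' t) (Icc 0 1) t := fun t ht => by
    have hm : a + t • v ∈ V := hV₂ (ball_subset_ball (min_le_right _ _) (hseg t ht))
    have h3 : HasFDerivAt ρ (fderiv ℝ ρ (a + t • v)) (a + t • v) :=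
      ((hρ.contDiffAt (hV.mem_nhds hm)).differentiableAt (by norm_num)).hasFDerivAt
    have h4 : HasDerivAt (fun t : ℝ => a + t • v) v t := by
      simpa using ((hasDerivAt_id t).smul_const v).const_add a
    have h5 : HasDerivAt (fun t : ℝ => ρ (a + t • v)) (fderiv ℝ ρ (a + t • v) v) t :=
      h3.comp_hasDerivAt t h4
    have h6 : HasDerivAt (fun t : ℝ => t * fderiv ℝ ρ a v) (fderiv ℝ ρ a v) t := by
      simpa using (hasDerivAt_id t).mul_const (fderiv ℝ ρ a v)
    have h7 : HasDerivAt (fun t : ℝ => 2⁻¹ * t ^ 2 * S v v) (t * S v v) t := by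
      refine (((hasDerivAt_pow 2 t).const_mul (2⁻¹ : ℝ)).mul_const (S v v)).congr_deriv ?_
      push_cast
      ring
    exact (((h5.sub_const _).sub h6).sub h7).hasDerivWithinAt
  have hb : ∀ t ∈ Icc (0 : ℝ) 1, ‖g' t‖ ≤ ε * ‖v‖ ^ 2 := fun t ht => by
    have h3 : ‖fderiv ℝ ρ (a + t • v) - fderiv ℝ ρ a - S (a + t • v - a)‖ ≤
        ε * ‖a + t • v - a‖ := h2 (x := (a + t • v, a))
      ⟨ball_subset_ball (min_le_left _ _) (hseg t ht), ball_subset_ball (min_le_left _ _) ha⟩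
    rw [add_sub_cancel_left] at h3
    have h4 : g' t = (fderiv ℝ ρ (a + t • v) - fderiv ℝ ρ a - S (t • v)) v := by
      simp only [g', map_smul, sub_apply, smul_apply, smul_eq_mul]
    rw [h4]
    refine (ContinuousLinearMap.le_opNorm _ _).trans ?_
    have h5 : ‖t • v‖ ≤ ‖v‖ := by
      rw [norm_smul, Real.norm_eq_abs, abs_of_nonneg ht.1]
      exact mul_le_of_le_one_left (norm_nonneg _) ht.2
    calc _ ≤ ε * ‖t • v‖ * ‖v‖ := by gcongr
      _ ≤ ε * ‖v‖ * ‖v‖ := by gcongr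
      _ = _ := by ring
  have := Convex.norm_image_sub_le_of_norm_hasDerivWithin_le hg hb (convex_Icc 0 1)
    (left_mem_Icc.2 zero_le_one) (right_mem_Icc.2 zero_le_one)
  have hza : a + v = z := by rw [hv]; abel
  simpa [g, hza] using this

end C2

theorem StronglyPseudoconvexDefiningFn.exists_pshDefining {D V : Set (CSpace n)}
    {ρ : CSpace n → ℝ} (h : StronglyPseudoconvexDefiningFn D V ρ) (hD : Bornology.IsBounded D) :
    ∃ W, ∃ σ, PshDefining D V W σ := by
  obtain ⟨hV, hDV, hρ, hDρ, hfρ, hdρ, hlevi⟩ := h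
  have hfV : frontier D ⊆ V := frontier_subset_closure.trans hDV
  have hfK : IsCompact (frontier D) := by
    have := hD.isCompact_closure
    exact this.of_isClosed_subset isClosed_frontier frontier_subset_closure
  have hsph : IsCompact (sphere (0 : CSpace n) 1) := isCompact_sphere 0 1
  set K := frontier D ×ˢ sphere (0 : CSpace n) 1 with hKdef
  have hK : IsCompact K := hfK.prod hsph
  have hKV : K ⊆ V ×ˢ univ := fun x hx => ⟨hfV hx.1, mem_univ _⟩
  have hd : ContinuousOn (fun x : CSpace n × CSpace n => fderiv ℝ ρ x.1) K :=
    (hρ.continuousOn_fderiv_of_isOpen hV (by norm_num)).comp continuousOn_fst fun x hx => (hKV hx).1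
  obtain ⟨C, hC, hpos⟩ := hK.exists_add_mul_pos (a := fun x => levi ρ x.1 x.2)
    (b := fun x => 4⁻¹ * ((fderiv ℝ ρ x.1 x.2) ^ 2 + (fderiv ℝ ρ x.1 (Complex.I • x.2)) ^ 2))
    ((hρ.continuousOn_levi hV).mono hKV)
    ((((hd.clm_apply continuousOn_snd).pow 2).add
      ((hd.clm_apply (by fun_prop)).pow 2)).const_mul _)
    (fun x _ => by positivity)
    (fun x hx h0 => by
      have hx2 : x.2 ≠ 0 := by
        have := hx.2
        rw [mem_sphere_zero_iff_norm] at this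
        rw [← norm_ne_zero_iff, this]; norm_num
      have h1 : fderiv ℝ ρ x.1 x.2 = 0 := by nlinarith [sq_nonneg (fderiv ℝ ρ x.1 (Complex.I • x.2))]
      have h2 : fderiv ℝ ρ x.1 (Complex.I • x.2) = 0 := by
        nlinarith [sq_nonneg (fderiv ℝ ρ x.1 x.2)]
      have h3 := hlevi x.1 hx.1 x.2 (fun h => hx2 (by ext j; simp [h]))
        (by rw [sum_wirtingerDz, cgrad_apply, h1, h2]; simp)
      rwa [re_leviForm] at h3)
  set σ : CSpace n → ℝ := fun z => Real.exp (C * ρ z) - 1 with hσdef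
  have hσ : ContDiffOn ℝ 2 σ V := ((contDiffOn_const.mul hρ).exp).sub contDiffOn_const
  have hσf : ∀ b ∈ frontier D, ∀ v ∈ sphere (0 : CSpace n) 1, 0 < levi σ b v := fun b hb v hv => by
    rw [levi_exp hV hρ C (hfV hb)]
    exact mul_pos (by positivity) (hpos (b, v) ⟨hb, hv⟩)
  refine ⟨interior {b ∈ V | ∀ v ∈ sphere (0 : CSpace n) 1, 0 < levi σ b v}, σ, hV, hDV, hσ,
    fun z hz => ?_, fun z hz => ?_, fun z hz => ?_, isOpen_interior,
    interior_subset.trans fun b hb => hb.1, fun b hb => ?_, fun b hb v hv => ?_⟩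
  · have h1 : z ∈ D ↔ z ∈ V ∧ ρ z < 0 := by rw [hDρ]; rfl
    rw [h1]
    simp only [hσdef, hz, true_and, sub_neg, Real.exp_lt_one_iff]
    constructor
    · intro h; nlinarith
    · intro h; by_contra hc; push Not at hc
      nlinarith [mul_nonneg hC.le hc]
  · have h1 : z ∈ frontier D ↔ z ∈ V ∧ ρ z = 0 := by rw [hfρ]; rfl
    rw [h1]
    simp [hσdef, hz, sub_eq_zero, hC.ne']
  · have h2 : HasFDerivAt ρ (fderiv ℝ ρ z) z :=
      ((hρ.contDiffAt (hV.mem_nhds (hfV hz))).differentiableAt (by norm_num)).hasFDerivAt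
    have h3 : HasFDerivAt σ _ z := (((h2.const_mul C)).exp).sub_const 1
    rw [h3.fderiv]
    exact smul_ne_zero (Real.exp_pos _).ne' (smul_ne_zero hC.ne' (hdρ z hz))
  · rw [mem_interior_iff_mem_nhds]
    refine inter_mem (hV.mem_nhds (hfV hb)) ?_
    refine hsph.eventually_forall_of_forall_eventually fun v hv => ?_
    have h1 : ContinuousAt (fun x : CSpace n × CSpace n => levi σ x.1 x.2) (b, v) :=
      (hσ.continuousOn_levi hV).continuousAt
        ((hV.prod isOpen_univ).mem_nhds ⟨hfV hb, mem_univ _⟩)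
    exact h1.eventually (lt_mem_nhds (hσf b hb v hv))
  · have h1 := (interior_subset hb).2 (‖v‖⁻¹ • v) (by
      rw [mem_sphere_zero_iff_norm, norm_smul, norm_inv, norm_norm,
        inv_mul_cancel₀ (norm_ne_zero_iff.2 hv)])
    rw [levi_smul] at h1
    exact (mul_pos_iff_of_pos_left (by positivity)).1 h1

end Defining

section Boundary

variable {n : ℕ} {D V W : Set (CSpace n)} {ρ : CSpace n → ℝ}

namespace PshDefining

theorem exists_levi_ge (h : PshDefining D V W ρ) {b : CSpace n} (hb : b ∈ W) :
    ∃ m > 0, ∀ v, m * ‖v‖ ^ 2 ≤ levi ρ b v := by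
  have hc : Continuous fun v => levi ρ b v := by
    have h1 : ContinuousOn (fun v => levi ρ b v) univ :=
      (h.contDiffOn.continuousOn_levi h.isOpen).comp (f := fun v => (b, v)) (by fun_prop)
        fun v _ => ⟨h.subset hb, mem_univ _⟩
    exact continuousOn_univ.1 h1
  have hl0 : levi ρ b 0 = 0 := by simp [levi]
  rcases (sphere (0 : CSpace n) 1).eq_empty_or_nonempty with he | hne
  · refine ⟨1, one_pos, fun v => ?_⟩
    have hv : v = 0 := by
      by_contra hv
      have : ‖v‖⁻¹ • v ∈ sphere (0 : CSpace n) 1 := by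
        rw [mem_sphere_zero_iff_norm, norm_smul, norm_inv, norm_norm,
          inv_mul_cancel₀ (norm_ne_zero_iff.2 hv)]
      rw [he] at this
      exact this
    rw [hv, hl0]; simp
  · obtain ⟨w, hw, hmin⟩ := (isCompact_sphere (0 : CSpace n) 1).exists_isMinOn hne hc.continuousOn
    rw [mem_sphere_zero_iff_norm] at hw
    refine ⟨levi ρ b w, h.levi_pos b hb w (by rw [← norm_ne_zero_iff, hw]; norm_num), fun v => ?_⟩
    by_cases hv : v = 0
    · rw [hv, hl0]; simp
    · have h1 : levi ρ b w ≤ levi ρ b (‖v‖⁻¹ • v) := hmin (by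
        rw [mem_sphere_zero_iff_norm, norm_smul, norm_inv, norm_norm,
          inv_mul_cancel₀ (norm_ne_zero_iff.2 hv)])
      rw [levi_smul] at h1
      have h2 : 0 < ‖v‖ := norm_pos_iff.2 hv
      calc levi ρ b w * ‖v‖ ^ 2 ≤ ‖v‖⁻¹ ^ 2 * levi ρ b v * ‖v‖ ^ 2 := by gcongr
        _ = levi ρ b v := by field_simp

/-- A strictly plurisubharmonic function admits local strict pluriharmonic supports from below. -/
theorem exists_support (h : PshDefining D V W ρ) {b : CSpace n} (hb : b ∈ W) :
    ∃ q : CSpace n → ℂ, Differentiable ℂ q ∧ q b = 0 ∧ ∃ c > 0, ∃ r > 0,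
      ∀ z ∈ ball b r, ρ b + (q z).re + c * ‖z - b‖ ^ 2 ≤ ρ z := by
  obtain ⟨m, hm, hlevi⟩ := h.exists_levi_ge hb
  obtain ⟨r, hr, -, hT⟩ := h.contDiffOn.exists_taylor h.isOpen (h.subset hb) (half_pos hm)
  refine ⟨fun z => cgrad ρ b (z - b) + bilinPart (fderiv ℝ (fderiv ℝ ρ) b) (z - b) (z - b),
    ?_, by simp, m / 2, half_pos hm, r, hr, fun z hz => ?_⟩
  · have h1 : Differentiable ℂ fun z : CSpace n => z - b := by fun_prop
    exact ((cgrad ρ b).differentiable.comp h1).add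
      (((bilinPart (fderiv ℝ (fderiv ℝ ρ) b)).differentiable.comp h1).clm_apply h1)
  · have h1 := (abs_le.1 (hT b (mem_ball_self hr) z hz)).1
    rw [half_secondDeriv] at h1
    have h2 := hlevi (z - b)
    rw [Complex.add_re, re_cgrad]
    linarith

/-- Local maximum principle for `ρ ∘ G - Re q` with `G`, `q` holomorphic. -/
theorem eventually_eq {E : Type*} [NormedAddCommGroup E] [NormedSpace ℂ E]
    (h : PshDefining D V W ρ) {G : E → CSpace n} {x₀ : E}
    (hG : ∀ᶠ x in 𝓝 x₀, DifferentiableAt ℂ G x) (hb : G x₀ ∈ W) {q : E → ℂ}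
    (hq : ∀ᶠ x in 𝓝 x₀, DifferentiableAt ℂ q x) (hq₀ : q x₀ = 0)
    (hle : ∀ᶠ x in 𝓝 x₀, ρ (G x) ≤ ρ (G x₀) + (q x).re) : ∀ᶠ x in 𝓝 x₀, G x = G x₀ := by
  obtain ⟨s, hs, hs0, c, hc, r, hr, hsup⟩ := h.exists_support hb
  have hre : ∀ᶠ x in 𝓝 x₀, (s (G x) - q x).re + c * ‖G x - G x₀‖ ^ 2 ≤ 0 := by
    filter_upwards [hle, hG.self_of_nhds.continuousAt.eventually (ball_mem_nhds _ hr)] with x h1 h2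
    have := hsup _ h2
    rw [Complex.sub_re]
    linarith
  let F : E → ℂ := fun x => Complex.exp (s (G x) - q x)
  have hF : ∀ x, ‖F x‖ = Real.exp (s (G x) - q x).re := fun x => Complex.norm_exp _
  have hF0 : ‖F x₀‖ = 1 := by rw [hF, hs0, hq₀]; simp
  have hmax : IsLocalMax (norm ∘ F) x₀ := by
    filter_upwards [hre] with x hx
    simp only [Function.comp_apply]
    rw [hF0, hF, Real.exp_le_one_iff]
    nlinarith [mul_nonneg hc.le (sq_nonneg ‖G x - G x₀‖)]
  have hd : ∀ᶠ x in 𝓝 x₀, DifferentiableAt ℂ F x := by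
    filter_upwards [hG, hq] with x h1 h2
    exact ((hs.differentiableAt.comp x h1).sub h2).cexp
  filter_upwards [Complex.norm_eventually_eq_of_isLocalMax hd hmax, hre] with x h1 h2
  rw [hF0, hF, Real.exp_eq_one_iff] at h1
  rw [h1, zero_add] at h2
  have h3 : ‖G x - G x₀‖ ^ 2 ≤ 0 := nonpos_of_mul_nonpos_right h2 hc
  have h4 : ‖G x - G x₀‖ = 0 := by
    have := le_antisymm h3 (sq_nonneg _)
    exact pow_eq_zero_iff (two_ne_zero) |>.1 this
  exact sub_eq_zero.1 (norm_eq_zero.1 h4)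

theorem le_of_mem_closure (h : PshDefining D V W ρ) {z : CSpace n} (hz : z ∈ closure D) :
    ρ z ≤ 0 := by
  have hzV := h.closure_subset hz
  by_cases hzD : z ∈ D
  · exact ((h.mem_iff z hzV).1 hzD).le
  · have : z ∈ frontier D := ⟨hz, fun hi => hzD (interior_subset hi)⟩
    exact ((h.mem_frontier_iff z hzV).1 this).le

/-- A holomorphic map into the closure of the domain touching the boundary is constant. -/
theorem eqOn_of_mem_frontier {E : Type*} [NormedAddCommGroup E] [NormedSpace ℂ E]
    (h : PshDefining D V W ρ) {Ω : Set E} (hΩ : IsOpen Ω) (hΩc : IsPreconnected Ω)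
    {G : E → CSpace n} (hG : DifferentiableOn ℂ G Ω) (hGD : ∀ x ∈ Ω, G x ∈ closure D) {x₀ : E}
    (hx₀ : x₀ ∈ Ω) (hp : G x₀ ∈ frontier D) : ∀ x ∈ Ω, G x = G x₀ := by
  have hV : ∀ x ∈ frontier D, x ∈ V := fun x hx => h.subset (h.frontier_subset hx)
  have h1 : IsOpen {x ∈ Ω | G x = G x₀} := by
    rw [isOpen_iff_mem_nhds]
    rintro x ⟨hx, hGx⟩
    have h2 : ∀ᶠ y in 𝓝 x, G y = G x := h.eventually_eq (q := fun _ => 0)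
      (hG.eventually_differentiableAt (hΩ.mem_nhds hx))
      (h.frontier_subset (hGx ▸ hp)) (Filter.Eventually.of_forall fun _ => by fun_prop) rfl (by
        filter_upwards [hΩ.mem_nhds hx] with y hy
        rw [hGx, (h.mem_frontier_iff _ (hV _ hp)).1 hp]
        simpa using h.le_of_mem_closure (hGD y hy))
    filter_upwards [h2, hΩ.mem_nhds hx] with y h3 h4
    exact ⟨h4, h3.trans hGx⟩
  have h2 : IsOpen (Ω ∩ G ⁻¹' {G x₀}ᶜ) :=
    hG.continuousOn.isOpen_inter_preimage hΩ isOpen_compl_singleton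
  have h3 := hΩc.subset_left_of_subset_union h1 h2
    (Set.disjoint_left.2 fun x hx hx' => hx'.2 hx.2)
    (fun x hx => by
      by_cases hxG : G x = G x₀
      · exact Or.inl ⟨hx, hxG⟩
      · exact Or.inr ⟨hx, hxG⟩) ⟨x₀, hx₀, hx₀, rfl⟩
  exact fun x hx => (h3 hx).2

theorem exists_collar (h : PshDefining D V W ρ) (hDb : Bornology.IsBounded D) :
    ∃ η > 0, ∀ b ∈ D, -η < ρ b → b ∈ W := by
  have hK : IsCompact (closure D \ W) := hDb.isCompact_closure.diff h.isOpen'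
  have hneg : ∀ b ∈ closure D \ W, ρ b < 0 := fun b hb => by
    have hbV := h.closure_subset hb.1
    refine lt_of_le_of_ne (h.le_of_mem_closure hb.1) fun h0 => hb.2 ?_
    exact h.frontier_subset ((h.mem_frontier_iff b hbV).2 h0)
  rcases (closure D \ W).eq_empty_or_nonempty with he | hne
  · refine ⟨1, one_pos, fun b hb _ => ?_⟩
    by_contra hbW
    have : b ∈ closure D \ W := ⟨subset_closure hb, hbW⟩
    rw [he] at this; exact this
  · obtain ⟨x, hx, hmax⟩ := hK.exists_isMaxOn hne
      (h.contDiffOn.continuousOn.mono fun b hb => h.closure_subset hb.1)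
    refine ⟨-ρ x, neg_pos.2 (hneg x hx), fun b hb hlt => ?_⟩
    by_contra hbW
    have : ρ b ≤ ρ x := hmax (⟨subset_closure hb, hbW⟩ : b ∈ closure D \ W)
    linarith

end PshDefining

end Boundary

section Hopf

variable {n : ℕ} {D V W : Set (CSpace n)} {ρ : CSpace n → ℝ}

theorem ContDiffOn.continuousAt_cgrad (hV : IsOpen V) (hρ : ContDiffOn ℝ 2 ρ V) {p : CSpace n}
    (hp : p ∈ V) : ContinuousAt (cgrad ρ) p :=
  (StrongDual.extendRCLikeₗᵢ (𝕜 := ℂ)).continuous.continuousAt.comp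
    (hρ.hasStrictFDerivAt_fderiv_of_two hV hp).continuousAt

namespace PshDefining

theorem le_neg_log_of_disc (h : PshDefining D V W ρ) {η c R : ℝ}
    (hη : ∀ b ∈ D, -η < ρ b → b ∈ W) (hc : 0 < c) (hcη : c * Real.log 4 ≤ η) (hR1 : 1 ≤ R)
    (hR2 : R ≤ 2) {G : ℂ → CSpace n} {O : Set ℂ} (hO : IsOpen O) (hRO : closedBall 0 R ⊆ O)
    (hG : DifferentiableOn ℂ G O) (hGD : ∀ ξ ∈ closedBall (0 : ℂ) R, G ξ ∈ D)
    (hinj : InjOn G (closedBall 0 R)) (hin : ∀ ξ : ℂ, ‖ξ‖ ≤ 1 / 2 → ρ (G ξ) ≤ -η) :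
    ρ (G 1) ≤ -(c * Real.log R) := by
  set A : Set ℂ := closedBall 0 R \ ball 0 (1 / 2) with hA
  have hAK : IsCompact A := (isCompact_closedBall 0 R).diff isOpen_ball
  have h1A : (1 : ℂ) ∈ A := by simp [hA, hR1]; norm_num
  have hA0 : ∀ ξ ∈ A, 1 / 2 ≤ ‖ξ‖ ∧ ‖ξ‖ ≤ R := fun ξ hξ => by
    simpa [hA, and_comm] using hξ
  let v : ℂ → ℝ := fun ξ => ρ (G ξ) - c * (Real.log ‖ξ‖ - Real.log R)
  have hv : ContinuousOn v A := by
    refine ContinuousOn.sub ?_ (continuousOn_const.mul (ContinuousOn.sub ?_ continuousOn_const))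
    · exact h.contDiffOn.continuousOn.comp (hG.continuousOn.mono (sdiff_subset.trans hRO))
        fun ξ hξ => h.closure_subset (subset_closure (hGD ξ hξ.1))
    · exact continuousOn_id.norm.log fun ξ hξ => by
        have := (hA0 ξ hξ).1
        simp only [id]
        linarith
  obtain ⟨ξ₀, hξ₀, hmax⟩ := hAK.exists_isMaxOn ⟨1, h1A⟩ hv
  obtain ⟨hlo, hhi⟩ := hA0 ξ₀ hξ₀
  have hGV : ∀ ξ ∈ closedBall (0 : ℂ) R, ρ (G ξ) < 0 := fun ξ hξ =>
    (h.mem_iff _ (h.closure_subset (subset_closure (hGD ξ hξ)))).1 (hGD ξ hξ)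
  have hlog4 : Real.log R - Real.log ‖ξ₀‖ ≤ Real.log 4 := by
    rw [← Real.log_div (by linarith) (by linarith)]
    refine Real.log_le_log (div_pos (by linarith) (by linarith)) ?_
    rw [div_le_iff₀ (by linarith)]
    linarith
  have hsmall : ρ (G ξ₀) ≤ -η → v ξ₀ ≤ 0 := fun hle => by
    have : c * (Real.log R - Real.log ‖ξ₀‖) ≤ c * Real.log 4 := by gcongr
    simp only [v]
    linarith
  have hv0 : v ξ₀ ≤ 0 := by
    by_cases hη0 : ρ (G ξ₀) ≤ -η
    · exact hsmall hη0
    push Not at hη0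
    rcases hlo.eq_or_lt with heq | hlo'
    · exact hsmall (hin ξ₀ heq.symm.le)
    rcases hhi.eq_or_lt with heq | hhi'
    · have := hGV ξ₀ hξ₀.1
      simp only [v, heq, sub_self, mul_zero, sub_zero]
      exact this.le
    exfalso
    have hξne : ξ₀ ≠ 0 := norm_pos_iff.1 (by linarith)
    have hnear : ∀ᶠ ξ in 𝓝 ξ₀, 1 / 2 < ‖ξ‖ ∧ ‖ξ‖ < R :=
      (continuous_norm.continuousAt.eventually (lt_mem_nhds hlo')).and
        (continuous_norm.continuousAt.eventually (gt_mem_nhds hhi'))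
    have hO' : ∀ᶠ ξ in 𝓝 ξ₀, DifferentiableAt ℂ G ξ :=
      hG.eventually_differentiableAt (hO.mem_nhds (hRO hξ₀.1))
    have hq : ∀ᶠ ξ in 𝓝 ξ₀, DifferentiableAt ℂ (fun ξ => (c : ℂ) * Complex.log (ξ / ξ₀)) ξ := by
      have h1 : ContinuousAt (fun ξ : ℂ => ξ / ξ₀) ξ₀ := by fun_prop
      have h2 : ∀ᶠ ξ in 𝓝 ξ₀, ξ / ξ₀ ∈ Complex.slitPlane :=
        h1.eventually (Complex.isOpen_slitPlane.mem_nhds (by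
          show ξ₀ / ξ₀ ∈ Complex.slitPlane
          rw [div_self hξne]; exact Complex.one_mem_slitPlane))
      filter_upwards [h2] with ξ hξ
      have h3 : DifferentiableAt ℂ (fun ξ : ℂ => ξ / ξ₀) ξ := by fun_prop
      exact (h3.clog hξ).const_mul _
    have hconst := h.eventually_eq hO' (hη _ (hGD ξ₀ hξ₀.1) hη0) hq (by simp [div_self hξne]) (by
      filter_upwards [hnear] with ξ hξ
      have h1 : v ξ ≤ v ξ₀ := hmax (show ξ ∈ A by simp [hA, hξ.2.le]; linarith [hξ.1.le])
      simp only [v] at h1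
      rw [Complex.re_ofReal_mul, Complex.log_re, norm_div,
        Real.log_div (by linarith [hξ.1]) (by linarith)]
      linarith)
    have h2 : ∀ᶠ ξ in 𝓝[≠] ξ₀, (G ξ = G ξ₀ ∧ 1 / 2 < ‖ξ‖ ∧ ‖ξ‖ < R) ∧ ξ ∈ ({ξ₀}ᶜ : Set ℂ) :=
      ((hconst.and hnear).filter_mono nhdsWithin_le_nhds).and self_mem_nhdsWithin
    obtain ⟨ξ, ⟨h3, -, h4⟩, h5⟩ := h2.exists
    exact h5 (hinj (by simpa using h4.le) hξ₀.1 h3)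
  have h1 : v 1 ≤ v ξ₀ := hmax h1A
  have h2 : v 1 = ρ (G 1) + c * Real.log R := by simp [v]
  linarith

theorem exists_cgrad_eq_one (h : PshDefining D V W ρ) {p : CSpace n} (hp : p ∈ frontier D) :
    ∃ N, cgrad ρ p N = 1 := by
  have h1 : cgrad ρ p ≠ 0 := fun h0 => h.fderiv_ne p hp (by
    ext v
    rw [← re_cgrad, h0]; simp)
  obtain ⟨v, hv⟩ : ∃ v, cgrad ρ p v ≠ 0 := by
    by_contra! hc
    exact h1 (by ext v; simp [hc v])
  exact ⟨(cgrad ρ p v)⁻¹ • v, by rw [map_smul, smul_eq_mul, inv_mul_cancel₀ hv]⟩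

set_option maxHeartbeats 1000000 in
/-- Uniform Hopf lemma for automorphisms, when orbits of compact sets stay compactly inside. -/
theorem exists_hopf (h : PshDefining D V W ρ) (hDo : IsOpen D) (hDb : Bornology.IsBounded D)
    (hcpt : ∀ K ⊆ D, IsCompact K → ∃ η > 0, ∀ g, AutOn D g → ∀ z ∈ K, ρ (g z) ≤ -η)
    {p : CSpace n} (hp : p ∈ frontier D) :
    ∃ r > 0, ∃ c > 0, ∀ g, AutOn D g → ∀ z ∈ D ∩ ball p r, c * -ρ z ≤ -ρ (g z) := by
  have hpV : p ∈ V := h.subset (h.frontier_subset hp)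
  obtain ⟨N, hN⟩ := h.exists_cgrad_eq_one hp
  obtain ⟨r₀, hr₀, hr₀V, hT⟩ := h.contDiffOn.exists_taylor h.isOpen hpV one_pos
  set S := fderiv ℝ (fderiv ℝ ρ) p with hS
  set M := (1 + 2⁻¹ * ‖S‖) * (2 * ‖N‖) ^ 2 + 1 with hM
  have hM0 : 0 < M := by positivity
  set τ := min (1 / 4) (min (1 / (4 * M)) (r₀ / (16 * (‖N‖ + 1)))) with hτ
  have hτ0 : 0 < τ := by positivity
  have hτ1 : τ ≤ 1 / 4 := min_le_left _ _
  have hτ2 : M * τ ≤ 1 / 4 := by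
    have : τ ≤ 1 / (4 * M) := (min_le_right _ _).trans (min_le_left _ _)
    calc M * τ ≤ M * (1 / (4 * M)) := by gcongr
      _ = 1 / 4 := by field_simp
  have hτ3 : τ * (3 * (2 * ‖N‖)) < r₀ / 2 := by
    have : τ ≤ r₀ / (16 * (‖N‖ + 1)) := (min_le_right _ _).trans (min_le_right _ _)
    have h1 : τ * (16 * (‖N‖ + 1)) ≤ r₀ := by rwa [le_div_iff₀ (by positivity)] at this
    nlinarith [norm_nonneg N]
  obtain ⟨η₀, hη₀, hcol⟩ := h.exists_collar hDb
  obtain ⟨η₁, hη₁, hK⟩ := hcpt {w ∈ closure D | ρ w ≤ -(τ / 4)}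
    (fun w hw => (h.mem_iff w (h.closure_subset hw.1)).2 (by linarith [hw.2]))
    (by
      have : IsClosed {w ∈ closure D | ρ w ≤ -(τ / 4)} :=
        (h.contDiffOn.continuousOn.mono h.closure_subset).preimage_isClosed_of_isClosed
          isClosed_closure (isClosed_Iic (a := -(τ / 4)))
      exact hDb.isCompact_closure.of_isClosed_subset this fun w hw => hw.1)
  set η := min η₀ η₁ with hη
  have hη0 : 0 < η := lt_min hη₀ hη₁
  have hl4 : 0 < Real.log 4 := Real.log_pos (by norm_num)
  set c := η / Real.log 4 with hc
  have hc0 : 0 < c := by positivity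
  have hnear : ∀ᶠ z in 𝓝 p, 1 / 2 < ‖cgrad ρ z N‖ ∧ -1 < ρ z ∧ z ∈ ball p (r₀ / 2) := by
    have h1 : ContinuousAt (fun z => ‖cgrad ρ z N‖) p :=
      ((h.contDiffOn.continuousAt_cgrad h.isOpen hpV).clm_apply continuousAt_const).norm
    have h2 : ContinuousAt ρ p := h.contDiffOn.continuousOn.continuousAt (h.isOpen.mem_nhds hpV)
    refine (h1.eventually (lt_mem_nhds ?_)).and ((h2.eventually (lt_mem_nhds ?_)).and
      (ball_mem_nhds p (half_pos hr₀)))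
    · show 1 / 2 < ‖cgrad ρ p N‖
      rw [hN]; norm_num
    · rw [(h.mem_frontier_iff p hpV).1 hp]; norm_num
  obtain ⟨r, hr, hr'⟩ := Metric.eventually_nhds_iff_ball.1 hnear
  refine ⟨r, hr, c / 2, half_pos hc0, fun g hg z hz => ?_⟩
  obtain ⟨hzN, hz1, hzr⟩ := hr' z hz.2
  set δ := -ρ z with hδ
  have hzV : z ∈ V := h.closure_subset (subset_closure hz.1)
  have hδ0 : 0 < δ := neg_pos.2 ((h.mem_iff z hzV).1 hz.1)
  have hδ1 : δ < 1 := by linarith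
  have hz0 : cgrad ρ z N ≠ 0 := norm_pos_iff.1 (by linarith)
  set N' := (cgrad ρ z N)⁻¹ • N with hN'
  have hN'n : ‖N'‖ ≤ 2 * ‖N‖ := by
    rw [hN', norm_smul, norm_inv]
    have : ‖cgrad ρ z N‖⁻¹ ≤ 2 := by
      rw [inv_le_comm₀ (by linarith) (by norm_num)]; linarith
    gcongr
  have hN'1 : cgrad ρ z N' = 1 := by rw [hN', map_smul, smul_eq_mul, inv_mul_cancel₀ hz0]
  clear_value N' c η M
  let γ : ℂ → CSpace n := fun ξ => z + ((τ : ℂ) * (ξ - 1)) • N'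
  have hγd : Differentiable ℂ γ := by fun_prop
  have hγz : ∀ ξ, γ ξ - z = ((τ : ℂ) * (ξ - 1)) • N' := fun ξ => by simp [γ]
  have hγn : ∀ ξ, ‖γ ξ - z‖ ≤ τ * ‖ξ - 1‖ * (2 * ‖N‖) := fun ξ => by
    rw [hγz, norm_smul, norm_mul, Complex.norm_real, Real.norm_of_nonneg hτ0.le]
    gcongr
  have hzr₀ : z ∈ ball p r₀ := ball_subset_ball (by linarith) hzr
  have hγr : ∀ ξ, ‖ξ‖ ≤ 1 + δ → γ ξ ∈ ball p r₀ := fun ξ hξ => by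
    rw [mem_ball, dist_eq_norm] at hzr ⊢
    have h1 : ‖ξ - 1‖ ≤ 3 := by
      have := norm_sub_le ξ 1
      rw [norm_one] at this; linarith
    have h2 : γ ξ - p = (γ ξ - z) + (z - p) := by abel
    rw [h2]
    have h3 : τ * ‖ξ - 1‖ * (2 * ‖N‖) ≤ τ * (3 * (2 * ‖N‖)) := by
      rw [mul_assoc]; gcongr
    linarith [norm_add_le (γ ξ - z) (z - p), hγn ξ]
  have hest : ∀ ξ : ℂ, ‖ξ‖ ≤ 1 + δ → ρ (γ ξ) ≤ -δ - τ * (1 - ξ.re) +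
      τ / 4 * (‖ξ‖ ^ 2 - 1 + 2 * (1 - ξ.re)) := fun ξ hξ => by
    have h1 := (abs_le.1 (hT z hzr₀ (γ ξ) (hγr ξ hξ))).2
    have h2 : fderiv ℝ ρ z (γ ξ - z) = -(τ * (1 - ξ.re)) := by
      rw [← re_cgrad, hγz, map_smul, hN'1]
      simp
      ring
    have h3 : S (γ ξ - z) (γ ξ - z) ≤ ‖S‖ * ‖γ ξ - z‖ ^ 2 := by
      refine (le_abs_self _).trans ((S.le_opNorm₂ _ _).trans_eq (by ring))
    have h4 : ‖ξ - 1‖ ^ 2 = ‖ξ‖ ^ 2 - 1 + 2 * (1 - ξ.re) := by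
      rw [← Complex.normSq_eq_norm_sq, ← Complex.normSq_eq_norm_sq, Complex.normSq_apply,
        Complex.normSq_apply]
      simp
      ring
    have h5 : (1 + 2⁻¹ * ‖S‖) * ‖γ ξ - z‖ ^ 2 ≤ τ / 4 * ‖ξ - 1‖ ^ 2 := by
      calc (1 + 2⁻¹ * ‖S‖) * ‖γ ξ - z‖ ^ 2
          ≤ (1 + 2⁻¹ * ‖S‖) * (τ * ‖ξ - 1‖ * (2 * ‖N‖)) ^ 2 := by gcongr; exact hγn ξ
        _ = ((1 + 2⁻¹ * ‖S‖) * (2 * ‖N‖) ^ 2) * τ * (τ * ‖ξ - 1‖ ^ 2) := by ring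
        _ ≤ M * τ * (τ * ‖ξ - 1‖ ^ 2) := by gcongr; linarith
        _ ≤ 1 / 4 * (τ * ‖ξ - 1‖ ^ 2) := by gcongr
        _ = _ := by ring
    rw [h4] at h5
    rw [h2] at h1
    linarith
  have hγD : ∀ ξ : ℂ, ‖ξ‖ ≤ 1 + δ → γ ξ ∈ D := fun ξ hξ => by
    refine (h.mem_iff _ (hr₀V (hγr ξ hξ))).2 ((hest ξ hξ).trans_lt ?_)
    have h1 : ξ.re ≤ 1 + δ := (Complex.re_le_norm ξ).trans hξ
    have h2 : ‖ξ‖ ^ 2 ≤ (1 + δ) ^ 2 := by gcongr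
    have h3 : τ / 4 * (‖ξ‖ ^ 2 - 1 + 2 * (1 - ξ.re)) ≤
        τ / 4 * ((1 + δ) ^ 2 - 1 + 2 * (1 - ξ.re)) := by gcongr
    have h4 : 0 ≤ τ * (δ + (1 - ξ.re)) := mul_nonneg hτ0.le (by linarith)
    have h5 : τ * δ ≤ 1 / 4 * δ := by gcongr
    have h6 : τ * δ * δ ≤ τ * δ * 1 := by gcongr
    nlinarith
  have hγc : ∀ ξ : ℂ, ‖ξ‖ ≤ 1 / 2 → ρ (γ ξ) ≤ -(τ / 4) := fun ξ hξ => by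
    refine (hest ξ (by linarith)).trans ?_
    have h1 : ξ.re ≤ 1 / 2 := (Complex.re_le_norm ξ).trans hξ
    have h2 : ‖ξ‖ ^ 2 ≤ (1 / 2) ^ 2 := by gcongr
    have h3 : τ / 4 * (‖ξ‖ ^ 2 - 1 + 2 * (1 - ξ.re)) ≤
        τ / 4 * ((1 / 2) ^ 2 - 1 + 2 * (1 - ξ.re)) := by gcongr
    have h4 : 0 ≤ τ * (1 / 2 - ξ.re) := mul_nonneg hτ0.le (by linarith)
    nlinarith
  have hfin := h.le_neg_log_of_disc (G := g ∘ γ) (η := η) (c := c) (R := 1 + δ)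
    (fun b hb hlt => hcol b hb (by linarith [min_le_left η₀ η₁])) hc0
    (by rw [hc, div_mul_cancel₀ _ hl4.ne']) (by linarith) (by linarith)
    (hDo.preimage hγd.continuous) (fun ξ hξ => hγD ξ (by simpa using hξ))
    (hg.1.comp hγd.differentiableOn fun ξ hξ => hξ)
    (fun ξ hξ => hg.mapsTo (hγD ξ (by simpa using hξ)))
    (fun ξ hξ ξ' hξ' heq => by
      have h1 := hg.2.1.injOn (hγD ξ (by simpa using hξ)) (hγD ξ' (by simpa using hξ')) heq
      have h2 : cgrad ρ z (γ ξ - z) = cgrad ρ z (γ ξ' - z) := by rw [h1]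
      rw [hγz, hγz, map_smul, map_smul, hN'1, smul_eq_mul, smul_eq_mul, mul_one, mul_one] at h2
      have h3 := mul_left_cancel₀ (Complex.ofReal_ne_zero.2 hτ0.ne') h2
      simpa using h3)
    (fun ξ hξ => by
      refine (hK g hg (γ ξ) ⟨subset_closure (hγD ξ (by linarith)), hγc ξ hξ⟩).trans ?_
      linarith [min_le_right η₀ η₁])
  have hγ1 : (g ∘ γ) 1 = g z := by simp [γ]
  rw [hγ1] at hfin
  have hlog : δ / 2 ≤ Real.log (1 + δ) := by
    refine le_trans ?_ (Real.le_log_one_add_of_nonneg hδ0.le)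
    rw [div_le_div_iff₀ (by norm_num) (by linarith)]
    nlinarith
  have : c * (δ / 2) ≤ c * Real.log (1 + δ) := by gcongr
  linarith

end PshDefining

end Hopf

section Frame

variable {n : ℕ} {D V W : Set (CSpace n)} {ρ : CSpace n → ℝ}

open scoped InnerProductSpace ComplexConjugate

/-- A positive definite Hermitian form is the pull-back of the standard one. -/
theorem exists_inner_map_eq (B : CSpace n →ₗ[ℂ] CSpace n →ₛₗ[starRingEnd ℂ] ℂ)
    (hsymm : ∀ u v, conj (B u v) = B v u) (hpos : ∀ v ≠ 0, 0 < (B v v).re) :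
    ∃ M : CSpace n ≃L[ℂ] CSpace n, ∀ u v, ⟪M v, M u⟫_ℂ = B u v := by
  let A₀ : CSpace n →ₗ[ℂ] CSpace n := ∑ j, (B.flip (basisVec j)).smulRight (basisVec j)
  let A : CSpace n →L[ℂ] CSpace n := LinearMap.toContinuousLinearMap A₀
  have hA : ∀ u v, ⟪v, A u⟫_ℂ = B u v := fun u v => by
    have h1 : A u = ∑ j, B u (basisVec j) • (basisVec j : CSpace n) := by
      simp [A, A₀]
    conv_rhs => rw [← sum_smul_basisVec v]
    rw [h1, inner_sum, map_sum]
    refine Finset.sum_congr rfl fun j _ => ?_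
    rw [inner_smul_right, map_smulₛₗ]
    simp [basisVec, EuclideanSpace.inner_single_right, mul_comm]
  have hApos : A.IsPositive := by
    refine (ContinuousLinearMap.isPositive_iff A).2 ⟨fun u v => ?_, fun v => ?_⟩
    · show ⟪A u, v⟫_ℂ = ⟪u, A v⟫_ℂ
      rw [← inner_conj_symm, hA, hA, hsymm]
    · rw [← inner_conj_symm, hA, hsymm]
      by_cases hv : v = 0
      · simp [hv]
      · have h1 : B v v = ((B v v).re : ℂ) := (Complex.conj_eq_iff_real.1 (hsymm v v)).elim
          fun r hr => by rw [hr]; simp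
        rw [h1]
        exact_mod_cast (hpos v hv).le
  have hA0 : 0 ≤ A := (ContinuousLinearMap.nonneg_iff_isPositive A).2 hApos
  let Q := CFC.sqrt A
  have hQ : Q * Q = A := CFC.sqrt_mul_sqrt_self A hA0
  have hQs : ∀ u v, ⟪Q v, Q u⟫_ℂ = B u v := fun u v => by
    have : Q.IsPositive := (ContinuousLinearMap.nonneg_iff_isPositive Q).1 (CFC.sqrt_nonneg A)
    rw [← hA, ← hQ, mul_apply_eq_comp]
    exact this.isSymmetric v (Q u)
  have hker : ∀ v, Q v = 0 → v = 0 := fun v hv => by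
    by_contra h0
    have := hpos v h0
    rw [← hQs, hv] at this
    simp at this
  have hinj : Function.Injective Q.toLinearMap := (injective_iff_map_eq_zero _).2 hker
  exact ⟨(LinearEquiv.ofInjectiveEndo Q.toLinearMap hinj).toContinuousLinearEquiv, fun u v => hQs u v⟩

namespace PshDefining

/-- A basis of `ℂ^n` adapted to a boundary point. -/
theorem exists_frame (h : PshDefining D V W ρ) {p : CSpace n} (hp : p ∈ frontier D) :
    ∃ (N : CSpace n) (M : CSpace n ≃L[ℂ] CSpace n), cgrad ρ p N = 1 ∧
      (∀ v, ⟪M N, M v⟫_ℂ = cgrad ρ p v) ∧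
      ∀ y, cgrad ρ p y = 0 → ‖M y‖ ^ 2 = levi ρ p y := by
  have hpV : p ∈ V := h.subset (h.frontier_subset hp)
  obtain ⟨N, hN⟩ := h.exists_cgrad_eq_one hp
  set S := fderiv ℝ (fderiv ℝ ρ) p with hS
  have hsymm : ∀ u v, S u v = S v u :=
    (h.contDiffOn.contDiffAt (h.isOpen.mem_nhds hpV)).isSymmSndFDerivAt (by simp)
  let pr : CSpace n →ₗ[ℂ] CSpace n :=
    LinearMap.id - (cgrad ρ p).toLinearMap.smulRight N
  have hpr : ∀ v, pr v = v - cgrad ρ p v • N := fun v => by simp [pr]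
  let B : CSpace n →ₗ[ℂ] CSpace n →ₛₗ[starRingEnd ℂ] ℂ :=
    LinearMap.mk₂'ₛₗ (RingHom.id ℂ) (starRingEnd ℂ)
      (fun u v => cgrad ρ p u * conj (cgrad ρ p v) + (4 : ℂ)⁻¹ * sesqPart S (pr u) (pr v))
      (fun u u' v => by simp only [map_add, LinearMap.add_apply]; ring)
      (fun c u v => by simp only [map_smul, LinearMap.smul_apply, smul_eq_mul, RingHom.id_apply]; ring)
      (fun u v v' => by simp only [map_add]; ring)
      (fun c u v => by
        simp only [map_smul, map_smulₛₗ, smul_eq_mul, map_mul]; ring)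
  have hB : ∀ u v, B u v = cgrad ρ p u * conj (cgrad ρ p v) +
      (4 : ℂ)⁻¹ * sesqPart S (pr u) (pr v) := fun u v => rfl
  have hdiag : ∀ y, (sesqPart S y y) = 4 * (levi ρ p y : ℝ) := fun y => by
    rw [sesqPart_apply, levi, ← hS, hsymm (Complex.I • y) y]
    push_cast
    ring
  obtain ⟨M, hM⟩ := exists_inner_map_eq B
    (fun u v => by
      rw [hB, hB, sesqPart_apply, sesqPart_apply]
      simp only [map_add, map_mul, Complex.conj_conj, Complex.conj_ofReal, Complex.conj_I, map_inv₀,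
        map_ofNat]
      rw [hsymm (pr u) (pr v), hsymm (Complex.I • pr u) (pr v),
        hsymm (pr u) (Complex.I • pr v), hsymm (Complex.I • pr u) (Complex.I • pr v)]
      push_cast
      ring)
    (fun v hv => by
      rw [hB, hdiag, Complex.mul_conj]
      have h1 : (((Complex.normSq (cgrad ρ p v) : ℝ) : ℂ) + (4 : ℂ)⁻¹ * (4 * (levi ρ p (pr v) : ℝ))) =
          ((Complex.normSq (cgrad ρ p v) + levi ρ p (pr v) : ℝ) : ℂ) := by push_cast; ring
      rw [h1, Complex.ofReal_re]
      by_cases h0 : pr v = 0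
      · have h2 : cgrad ρ p v ≠ 0 := fun h3 => hv (by
          rw [hpr, h3, zero_smul, sub_zero] at h0; exact h0)
        have := Complex.normSq_pos.2 h2
        rw [h0]
        simpa [levi] using this
      · exact add_pos_of_nonneg_of_pos (Complex.normSq_nonneg _)
          (h.levi_pos p (h.frontier_subset hp) _ h0))
  refine ⟨N, M, hN, fun v => ?_, fun y hy => ?_⟩
  · rw [hM, hB, hN]
    have : pr N = 0 := by rw [hpr, hN]; simp
    rw [this]
    simp
  · have h1 : pr y = y := by rw [hpr, hy]; simp
    rw [← inner_self_eq_norm_sq (𝕜 := ℂ), hM, hB, hy, h1, hdiag]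
    simp

end PshDefining

end Frame

section NormalForm

variable {n : ℕ} {D V W : Set (CSpace n)} {ρ : CSpace n → ℝ}

namespace PshDefining

set_option maxHeartbeats 1000000 in
/-- Second order normal form of the defining function, uniformly in the base point. -/
theorem exists_normal_form (h : PshDefining D V W ρ) {p : CSpace n} (hp : p ∈ frontier D)
    {N : CSpace n} {M : CSpace n ≃L[ℂ] CSpace n} (hN : cgrad ρ p N = 1)
    (hM : ∀ y, cgrad ρ p y = 0 → ‖M y‖ ^ 2 = levi ρ p y) {ε : ℝ} (hε : 0 < ε) :
    ∃ r > 0, ball p r ⊆ V ∧ ∀ a ∈ ball p r, ∀ z ∈ ball p r, ∀ y,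
      y = z - a - cgrad ρ p (z - a) • N →
      |ρ z - ρ a - (cgrad ρ a (z - a) + bilinPart (fderiv ℝ (fderiv ℝ ρ) p) y y).re - ‖M y‖ ^ 2| ≤
        ε * (‖cgrad ρ a (z - a) + bilinPart (fderiv ℝ (fderiv ℝ ρ) p) y y‖ + ‖M y‖ ^ 2) := by
  have hpV : p ∈ V := h.subset (h.frontier_subset hp)
  set S := fderiv ℝ (fderiv ℝ ρ) p with hS
  set ℓ := cgrad ρ p with hℓ
  obtain ⟨m, hm0, hm⟩ : ∃ m > 0, ∀ y, ‖y‖ ≤ m * ‖M y‖ :=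
    ⟨‖(M.symm : CSpace n →L[ℂ] CSpace n)‖ + 1, by positivity, fun y => by
      have h1 := (M.symm : CSpace n →L[ℂ] CSpace n).le_opNorm (M y)
      rw [ContinuousLinearEquiv.coe_coe, M.symm_apply_apply] at h1
      nlinarith [norm_nonneg (M y)]⟩
  obtain ⟨b, hb⟩ : ∃ b, b = ‖bilinPart S‖ := ⟨_, rfl⟩
  obtain ⟨C, hC⟩ : ∃ C, C = 1 + ‖ℓ‖ * ‖N‖ := ⟨_, rfl⟩
  obtain ⟨Q, hQ⟩ : ∃ Q, Q = 2 * C + 2 * b * C + 2 := ⟨_, rfl⟩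
  obtain ⟨Q', hQ'⟩ : ∃ Q', Q' = 2 * ‖ℓ‖ * (1 + b) + 2 * Q := ⟨_, rfl⟩
  obtain ⟨P, hP⟩ : ∃ P, P = 2 * ‖N‖ ^ 2 * Q' + ‖S‖ * ‖N‖ * Q + 2⁻¹ * ‖S‖ * ‖N‖ ^ 2 * Q' := ⟨_, rfl⟩
  have hb0 : 0 ≤ b := by rw [hb]; positivity
  have hC0 : 0 < C := by rw [hC]; positivity
  have hQ0 : 0 ≤ Q := by rw [hQ]; positivity
  have hQ'0 : 0 ≤ Q' := by rw [hQ']; positivity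
  have hP0 : 0 ≤ P := by rw [hP]; positivity
  obtain ⟨ε₁, hε₁, hε₁1, hε₁m⟩ : ∃ ε₁ > 0, ε₁ ≤ 1 ∧ 2 * ε₁ * m ^ 2 ≤ ε / 2 := by
    refine ⟨min 1 (ε / (4 * m ^ 2)), by positivity, min_le_left _ _, ?_⟩
    calc 2 * min 1 (ε / (4 * m ^ 2)) * m ^ 2 ≤ 2 * (ε / (4 * m ^ 2)) * m ^ 2 := by
          gcongr; exact min_le_right _ _
      _ = ε / 2 := by field_simp; ring
  obtain ⟨θ, hθ, hθ1, hθN, hθP, hθm⟩ : ∃ θ > 0, θ ≤ 1 ∧ θ * ‖N‖ ≤ 1 / 2 ∧ θ * P ≤ ε ∧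
      θ * P * m ^ 2 ≤ ε / 2 := by
    refine ⟨min 1 (min (1 / (2 * (‖N‖ + 1))) (min (ε / (P + 1)) (ε / (2 * (P * m ^ 2 + 1))))),
      by positivity, min_le_left _ _, ?_, ?_, ?_⟩
    · refine (mul_le_mul_of_nonneg_right ((min_le_right _ _).trans (min_le_left _ _))
        (norm_nonneg N)).trans ?_
      rw [div_mul_eq_mul_div, div_le_div_iff₀ (by positivity) (by norm_num)]
      linarith
    · refine (mul_le_mul_of_nonneg_right ((min_le_right _ _).trans ((min_le_right _ _).trans
        (min_le_left _ _))) hP0).trans ?_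
      rw [div_mul_eq_mul_div, div_le_iff₀ (by positivity)]
      nlinarith
    · rw [mul_assoc]
      refine (mul_le_mul_of_nonneg_right ((min_le_right _ _).trans ((min_le_right _ _).trans
        (min_le_right _ _))) (by positivity)).trans ?_
      rw [div_mul_eq_mul_div, div_le_div_iff₀ (by positivity) (by norm_num)]
      nlinarith
  obtain ⟨r₁, hr₁, hr₁V, hT⟩ := h.contDiffOn.exists_taylor h.isOpen hpV hε₁
  obtain ⟨r₂, hr₂, hκ⟩ := Metric.continuousAt_iff.1
    (h.contDiffOn.continuousAt_cgrad h.isOpen hpV) θ hθ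
  refine ⟨min r₁ (min r₂ (θ / 2)), by positivity,
    (ball_subset_ball (min_le_left _ _)).trans hr₁V, fun a ha z hz y hy => ?_⟩
  have hlin : ‖z - a‖ ≤ θ := by
    have h1 : ball p (min r₁ (min r₂ (θ / 2))) ⊆ ball p (θ / 2) :=
      ball_subset_ball ((min_le_right _ _).trans (min_le_right _ _))
    have h2 := mem_ball.1 (h1 ha)
    have h3 := mem_ball.1 (h1 hz)
    rw [← dist_eq_norm]
    linarith [dist_triangle_right z a p]
  have htay := hT a (ball_subset_ball (min_le_left _ _) ha) z (ball_subset_ball (min_le_left _ _) hz)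
  have hκa : ‖cgrad ρ a - ℓ‖ ≤ θ := by
    rw [← dist_eq_norm]
    exact (hκ (mem_ball.1 (ball_subset_ball ((min_le_right _ _).trans (min_le_left _ _)) ha))).le
  obtain ⟨v, hv⟩ : ∃ v, v = z - a := ⟨_, rfl⟩
  rw [← hv] at hy hlin htay ⊢
  have hℓy : ℓ y = 0 := by rw [hy, map_sub, map_smul, hN]; simp
  have hvy : v = y + ℓ v • N := by rw [hy]; abel
  rw [← hS] at htay
  set u := cgrad ρ a v + bilinPart S y y with hu
  obtain ⟨s, hs⟩ : ∃ s, s = ‖ℓ v‖ := ⟨_, rfl⟩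
  obtain ⟨t, ht⟩ : ∃ t, t = ‖y‖ := ⟨_, rfl⟩
  have hs0 : 0 ≤ s := by rw [hs]; positivity
  have ht0 : 0 ≤ t := by rw [ht]; positivity
  have hU0 := norm_nonneg u
  have hvn : ‖v‖ ≤ t + s * ‖N‖ := by
    calc ‖v‖ = ‖y + ℓ v • N‖ := by rw [← hvy]
      _ ≤ ‖y‖ + ‖ℓ v • N‖ := norm_add_le _ _
      _ = _ := by rw [norm_smul, hs, ht]
  have hsv : s ≤ ‖ℓ‖ * ‖v‖ := by rw [hs]; exact ℓ.le_opNorm v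
  have htv : t ≤ C * ‖v‖ := by
    calc t = ‖v - ℓ v • N‖ := by rw [ht, hy]
      _ ≤ ‖v‖ + s * ‖N‖ := by rw [hs, ← norm_smul]; exact norm_sub_le _ _
      _ ≤ ‖v‖ + ‖ℓ‖ * ‖v‖ * ‖N‖ := by gcongr
      _ = _ := by rw [hC]; ring
  have hsu : s ≤ 2 * ‖u‖ + 2 * b * t ^ 2 + 2 * θ * t := by
    have h1 : ℓ v = u - bilinPart S y y - (cgrad ρ a - ℓ) v := by
      rw [hu, sub_apply]; ring
    have h2 : ‖bilinPart S y y‖ ≤ b * t ^ 2 := by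
      rw [hb, ht]
      exact ((bilinPart S).le_opNorm₂ y y).trans_eq (by ring)
    have h3 : ‖(cgrad ρ a - ℓ) v‖ ≤ θ * (t + s * ‖N‖) :=
      ((cgrad ρ a - ℓ).le_opNorm v).trans (by gcongr)
    have h4 : s ≤ ‖u‖ + ‖bilinPart S y y‖ + ‖(cgrad ρ a - ℓ) v‖ := by
      rw [hs, h1]
      exact (norm_sub_le _ _).trans (by gcongr; exact norm_sub_le _ _)
    have h5 : θ * ‖N‖ * s ≤ 1 / 2 * s := by gcongr
    have h6 : θ * (t + s * ‖N‖) = θ * t + θ * ‖N‖ * s := by ring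
    linarith
  have htθ : t ≤ C * θ := htv.trans (by gcongr)
  have hst : s * t ≤ θ * Q * (‖u‖ + t ^ 2) := by
    calc s * t ≤ (2 * ‖u‖ + 2 * b * t ^ 2 + 2 * θ * t) * t := by gcongr
      _ = (2 * ‖u‖ + 2 * b * t ^ 2) * t + 2 * θ * t ^ 2 := by ring
      _ ≤ (2 * ‖u‖ + 2 * b * t ^ 2) * (C * θ) + 2 * θ * t ^ 2 := by gcongr
      _ = θ * (2 * C * ‖u‖ + (2 * b * C + 2) * t ^ 2) := by ring
      _ ≤ θ * (Q * ‖u‖ + Q * t ^ 2) := by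
        gcongr
        · rw [hQ]; nlinarith [mul_nonneg hb0 hC0.le]
        · rw [hQ]; linarith
      _ = _ := by ring
  have hss : s ^ 2 ≤ θ * Q' * (‖u‖ + t ^ 2) := by
    calc s ^ 2 = s * s := by ring
      _ ≤ s * (2 * ‖u‖ + 2 * b * t ^ 2 + 2 * θ * t) := by gcongr
      _ = s * (2 * ‖u‖ + 2 * b * t ^ 2) + 2 * θ * (s * t) := by ring
      _ ≤ (‖ℓ‖ * θ) * (2 * ‖u‖ + 2 * b * t ^ 2) + 2 * θ * (1 * Q * (‖u‖ + t ^ 2)) := by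
        have h1 : s ≤ ‖ℓ‖ * θ := hsv.trans (by gcongr)
        have h2 : s * t ≤ 1 * Q * (‖u‖ + t ^ 2) := hst.trans (by gcongr)
        exact add_le_add (mul_le_mul_of_nonneg_right h1 (by positivity))
          (mul_le_mul_of_nonneg_left h2 (by positivity))
      _ ≤ (‖ℓ‖ * θ) * (2 * (1 + b) * ‖u‖ + 2 * (1 + b) * t ^ 2) +
          2 * θ * (1 * Q * (‖u‖ + t ^ 2)) := by
        gcongr
        · linarith
        · linarith
      _ = _ := by rw [hQ']; ring
  have hR : |2⁻¹ * S v v - 2⁻¹ * S y y| ≤ ‖S‖ * ‖N‖ * (s * t) + 2⁻¹ * ‖S‖ * ‖N‖ ^ 2 * s ^ 2 := by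
    have h1 : 2⁻¹ * S v v - 2⁻¹ * S y y =
        2⁻¹ * (S (ℓ v • N) y + S y (ℓ v • N) + S (ℓ v • N) (ℓ v • N)) := by
      conv_lhs => rw [hvy]
      simp only [map_add, add_apply]
      ring
    have h2 : ∀ x x', |S x x'| ≤ ‖S‖ * ‖x‖ * ‖x'‖ := fun x x' => S.le_opNorm₂ x x'
    have h3 := h2 (ℓ v • N) y
    have h4 := h2 y (ℓ v • N)
    have h5 := h2 (ℓ v • N) (ℓ v • N)
    rw [norm_smul, ← hs] at h3 h4 h5
    rw [← ht] at h3 h4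
    rw [h1, abs_mul, abs_of_pos (by norm_num : (0 : ℝ) < 2⁻¹)]
    have h6 := (abs_add_le (S (ℓ v • N) y + S y (ℓ v • N)) (S (ℓ v • N) (ℓ v • N))).trans
      (add_le_add_left (abs_add_le (S (ℓ v • N) y) (S y (ℓ v • N))) _)
    have h7 : ‖S‖ * (s * ‖N‖) * t = ‖S‖ * ‖N‖ * (s * t) := by ring
    have h8 : ‖S‖ * t * (s * ‖N‖) = ‖S‖ * ‖N‖ * (s * t) := by ring
    have h9 : ‖S‖ * (s * ‖N‖) * (s * ‖N‖) = ‖S‖ * ‖N‖ ^ 2 * s ^ 2 := by ring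
    linarith
  have hy2 : 2⁻¹ * S y y = (bilinPart S y y).re + ‖M y‖ ^ 2 := by
    rw [hM y hℓy, hS]; exact half_secondDeriv ρ p y
  have htm : t ^ 2 ≤ m ^ 2 * ‖M y‖ ^ 2 := by
    rw [← mul_pow, ht]; gcongr; exact hm y
  have hv2 : ‖v‖ ^ 2 ≤ 2 * t ^ 2 + 2 * ‖N‖ ^ 2 * s ^ 2 := by
    calc ‖v‖ ^ 2 ≤ (t + s * ‖N‖) ^ 2 := by gcongr
      _ ≤ _ := by nlinarith [sq_nonneg (t - s * ‖N‖)]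
  have hmain : |ρ z - ρ a - u.re - ‖M y‖ ^ 2| ≤ ε₁ * ‖v‖ ^ 2 + |2⁻¹ * S v v - 2⁻¹ * S y y| := by
    have h1 : ρ z - ρ a - u.re - ‖M y‖ ^ 2 = (ρ z - ρ a - fderiv ℝ ρ a v - 2⁻¹ * S v v) +
        (2⁻¹ * S v v - 2⁻¹ * S y y) := by
      rw [hy2, hu, Complex.add_re, re_cgrad]; ring
    rw [h1]
    exact (abs_add_le _ _).trans (by gcongr)
  refine hmain.trans ?_
  calc ε₁ * ‖v‖ ^ 2 + |2⁻¹ * S v v - 2⁻¹ * S y y|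
      ≤ ε₁ * (2 * t ^ 2 + 2 * ‖N‖ ^ 2 * s ^ 2) +
        (‖S‖ * ‖N‖ * (s * t) + 2⁻¹ * ‖S‖ * ‖N‖ ^ 2 * s ^ 2) := by gcongr
    _ = 2 * ε₁ * t ^ 2 + ε₁ * (2 * ‖N‖ ^ 2 * s ^ 2) +
        (‖S‖ * ‖N‖ * (s * t) + 2⁻¹ * ‖S‖ * ‖N‖ ^ 2 * s ^ 2) := by ring
    _ ≤ 2 * ε₁ * t ^ 2 + 1 * (2 * ‖N‖ ^ 2 * (θ * Q' * (‖u‖ + t ^ 2))) +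
        (‖S‖ * ‖N‖ * (θ * Q * (‖u‖ + t ^ 2)) + 2⁻¹ * ‖S‖ * ‖N‖ ^ 2 * (θ * Q' * (‖u‖ + t ^ 2))) := by
      have h1 := mul_le_mul_of_nonneg_left hss (by positivity : 0 ≤ 2 * ‖N‖ ^ 2)
      have h2 := mul_le_mul_of_nonneg_left hst (by positivity : 0 ≤ ‖S‖ * ‖N‖)
      have h3 := mul_le_mul_of_nonneg_left hss (by positivity : 0 ≤ 2⁻¹ * ‖S‖ * ‖N‖ ^ 2)
      have h4 := mul_le_mul_of_nonneg_right hε₁1 (by positivity : 0 ≤ 2 * ‖N‖ ^ 2 * s ^ 2)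
      linarith
    _ = 2 * ε₁ * t ^ 2 + θ * P * ‖u‖ + θ * P * t ^ 2 := by rw [hP]; ring
    _ ≤ 2 * ε₁ * (m ^ 2 * ‖M y‖ ^ 2) + ε * ‖u‖ + θ * P * (m ^ 2 * ‖M y‖ ^ 2) := by gcongr
    _ = (2 * ε₁ * m ^ 2) * ‖M y‖ ^ 2 + ε * ‖u‖ + (θ * P * m ^ 2) * ‖M y‖ ^ 2 := by ring
    _ ≤ (ε / 2) * ‖M y‖ ^ 2 + ε * ‖u‖ + (ε / 2) * ‖M y‖ ^ 2 := by gcongr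
    _ = _ := by ring

end PshDefining

end NormalForm

section Ball

open scoped InnerProductSpace

section Cayley

variable {F : Type*} [NormedAddCommGroup F] [InnerProductSpace ℂ F]

/-- The Cayley transform from the Siegel domain `re w + ‖ω‖ ^ 2 < 1` to the unit ball. -/
def cayley (e : F) (w : ℂ) (ω : F) : F := (2 - w)⁻¹ • (w • e + (2 : ℂ) • ω)

theorem inner_cayley {e ω : F} (he : ‖e‖ = 1) (hω : ⟪e, ω⟫_ℂ = 0) (w : ℂ) :
    ⟪e, cayley e w ω⟫_ℂ = (2 - w)⁻¹ * w := by
  simp [cayley, hω, inner_self_eq_norm_sq_to_K, he]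

theorem norm_two_sub_sq (w : ℂ) : ‖2 - w‖ ^ 2 = 4 - 4 * w.re + ‖w‖ ^ 2 := by
  rw [← Complex.normSq_eq_norm_sq, ← Complex.normSq_eq_norm_sq, Complex.normSq_apply,
    Complex.normSq_apply]
  simp
  ring

theorem one_sub_norm_cayley_sq {e ω : F} (he : ‖e‖ = 1) (hω : ⟪e, ω⟫_ℂ = 0) {w : ℂ} (hw : w ≠ 2) :
    ‖2 - w‖ ^ 2 * (1 - ‖cayley e w ω‖ ^ 2) = 4 * (1 - w.re - ‖ω‖ ^ 2) := by
  have h0 : ‖2 - w‖ ≠ 0 := norm_ne_zero_iff.2 (sub_ne_zero.2 hw.symm)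
  have h1 : ‖w • e + (2 : ℂ) • ω‖ ^ 2 = ‖w‖ ^ 2 + 4 * ‖ω‖ ^ 2 := by
    have h2 := norm_add_sq_eq_norm_sq_add_norm_sq_of_inner_eq_zero (𝕜 := ℂ) (w • e) ((2 : ℂ) • ω)
      (by rw [inner_smul_left, inner_smul_right, hω]; simp)
    rw [sq, h2, norm_smul, norm_smul, he, Complex.norm_ofNat]
    ring
  have h2 : ‖2 - w‖ ^ 2 * ‖cayley e w ω‖ ^ 2 = ‖w‖ ^ 2 + 4 * ‖ω‖ ^ 2 := by
    rw [cayley, norm_smul, norm_inv, mul_pow, h1, inv_pow, mul_inv_cancel_left₀ (pow_ne_zero 2 h0)]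
  rw [mul_sub, mul_one, h2, norm_two_sub_sq]
  ring

theorem norm_cayley_sq_le {e ω : F} (he : ‖e‖ = 1) (hω : ⟪e, ω⟫_ℂ = 0) {w : ℂ} {ε : ℝ} (hε : 0 ≤ ε)
    (hε' : ε ≤ 1 / 8) (h : w.re + ‖ω‖ ^ 2 ≤ 1 + ε * (‖w‖ + ‖ω‖ ^ 2)) :
    w ≠ 2 ∧ ‖cayley e w ω‖ ^ 2 ≤ 1 + 120 * ε := by
  have h1 : 2 - w.re ≤ ‖2 - w‖ := by simpa using Complex.re_le_norm (2 - w)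
  have h2 : ‖w‖ ≤ ‖2 - w‖ + 2 := by
    have := norm_sub_le (2 : ℂ) (2 - w)
    simp only [sub_sub_cancel, Complex.norm_ofNat] at this
    linarith
  have h3 : ε * ‖w‖ ≤ 1 / 8 * ‖w‖ := by gcongr
  have h4 : ε * ‖ω‖ ^ 2 ≤ 1 / 8 * ‖ω‖ ^ 2 := by gcongr
  have hd : 1 / 2 ≤ ‖2 - w‖ := by nlinarith [sq_nonneg ‖ω‖]
  have hw2 : w ≠ 2 := by
    rintro rfl
    norm_num at hd
  refine ⟨hw2, ?_⟩
  have h5 : ‖2 - w‖ ≤ 2 * ‖2 - w‖ ^ 2 := by nlinarith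
  have h6 : ‖w‖ ≤ 10 * ‖2 - w‖ ^ 2 := by nlinarith
  have h7 : -w.re ≤ ‖w‖ := (neg_le_abs _).trans (Complex.abs_re_le_norm w)
  have h8 : ‖ω‖ ^ 2 ≤ 20 * ‖2 - w‖ ^ 2 := by nlinarith
  have h9 : ε * (‖w‖ + ‖ω‖ ^ 2) ≤ ε * (10 * ‖2 - w‖ ^ 2 + 20 * ‖2 - w‖ ^ 2) := by gcongr
  have h10 := one_sub_norm_cayley_sq he hω hw2
  have h11 : ‖2 - w‖ ^ 2 * ‖cayley e w ω‖ ^ 2 ≤ ‖2 - w‖ ^ 2 * (1 + 120 * ε) := by nlinarith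
  exact le_of_mul_le_mul_left h11 (by positivity)

theorem cayley_inv {e x : F} {x₁ : ℂ} (h1 : 1 + x₁ ≠ 0) :
    2 * x₁ / (1 + x₁) ≠ 2 ∧
      cayley e (2 * x₁ / (1 + x₁)) ((1 + x₁)⁻¹ • (x - x₁ • e)) = x := by
  have h2 : 2 - 2 * x₁ / (1 + x₁) = 2 / (1 + x₁) := by field_simp; ring
  refine ⟨fun h3 => ?_, ?_⟩
  · rw [h3, sub_self] at h2
    exact div_ne_zero two_ne_zero h1 h2.symm
  · rw [cayley, h2, smul_add, smul_smul, smul_smul, smul_smul]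
    have h3 : (2 / (1 + x₁))⁻¹ * (2 * x₁ / (1 + x₁)) = x₁ := by field_simp
    have h4 : (2 / (1 + x₁))⁻¹ * 2 * (1 + x₁)⁻¹ = 1 := by field_simp
    rw [h3, h4, one_smul, add_sub_cancel]

theorem siegel_eq {e x : F} (he : ‖e‖ = 1) (h1 : 1 + ⟪e, x⟫_ℂ ≠ 0) :
    1 - (2 * ⟪e, x⟫_ℂ / (1 + ⟪e, x⟫_ℂ)).re - ‖(1 + ⟪e, x⟫_ℂ)⁻¹ • (x - ⟪e, x⟫_ℂ • e)‖ ^ 2 =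
      (1 - ‖x‖ ^ 2) / ‖1 + ⟪e, x⟫_ℂ‖ ^ 2 := by
  set x₁ := ⟪e, x⟫_ℂ with hx
  obtain ⟨h2, h3⟩ := cayley_inv (e := e) (x := x) h1
  have h4 := one_sub_norm_cayley_sq (ω := (1 + x₁)⁻¹ • (x - x₁ • e)) he
    (by simp [inner_self_eq_norm_sq_to_K, he, hx]) h2
  rw [h3, show 2 - 2 * x₁ / (1 + x₁) = 2 / (1 + x₁) by field_simp; ring, norm_div,
    Complex.norm_ofNat] at h4
  have h5 : ‖1 + x₁‖ ≠ 0 := norm_ne_zero_iff.2 h1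
  rw [eq_div_iff (pow_ne_zero 2 h5)]
  rw [div_pow, div_mul_eq_mul_div, div_eq_iff (pow_ne_zero 2 h5)] at h4
  linarith

end Cayley

end Ball

section ScaleMaps

open scoped InnerProductSpace

variable {n : ℕ} {D V W : Set (CSpace n)} {ρ : CSpace n → ℝ}

/-- The rescaling map at a point `a` close to the boundary point `p`. -/
def scaleMap (ρ : CSpace n → ℝ) (p N : CSpace n) (M : CSpace n ≃L[ℂ] CSpace n)
    (a z : CSpace n) : CSpace n :=
  cayley (M N) ((cgrad ρ a (z - a) + bilinPart (fderiv ℝ (fderiv ℝ ρ) p)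
      (z - a - cgrad ρ p (z - a) • N) (z - a - cgrad ρ p (z - a) • N)) / (-ρ a : ℝ))
    ((√(-ρ a) : ℂ)⁻¹ • M (z - a - cgrad ρ p (z - a) • N))

/-- The inverse of the rescaling map `scaleMap`. -/
def scaleInv (ρ : CSpace n → ℝ) (p N : CSpace n) (M : CSpace n ≃L[ℂ] CSpace n)
    (a x : CSpace n) : CSpace n :=
  let x₁ := innerSL ℂ (M N) x
  let y := (√(-ρ a) : ℂ) • M.symm ((1 + x₁)⁻¹ • (x - x₁ • M N))
  a + (y + (((-ρ a : ℝ) * (2 * x₁ / (1 + x₁)) - bilinPart (fderiv ℝ (fderiv ℝ ρ) p) y y -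
    cgrad ρ a y) / cgrad ρ a N) • N)

theorem scaleMap_scaleInv {p N a : CSpace n} {M : CSpace n ≃L[ℂ] CSpace n} (hN : cgrad ρ p N = 1)
    (hM : ∀ v, ⟪M N, M v⟫_ℂ = cgrad ρ p v) (he : ‖M N‖ = 1) (haN : cgrad ρ a N ≠ 0)
    (ha : ρ a < 0) {x : CSpace n} (hx : 1 + ⟪M N, x⟫_ℂ ≠ 0) :
    let z := scaleInv ρ p N M a x
    let y := z - a - cgrad ρ p (z - a) • N
    y = (√(-ρ a) : ℂ) • M.symm ((1 + ⟪M N, x⟫_ℂ)⁻¹ • (x - ⟪M N, x⟫_ℂ • M N)) ∧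
    cgrad ρ a (z - a) + bilinPart (fderiv ℝ (fderiv ℝ ρ) p) y y =
      (-ρ a : ℝ) * (2 * ⟪M N, x⟫_ℂ / (1 + ⟪M N, x⟫_ℂ)) ∧ scaleMap ρ p N M a z = x := by
  intro z y
  set x₁ := ⟪M N, x⟫_ℂ with hx₁
  set y' := (√(-ρ a) : ℂ) • M.symm ((1 + x₁)⁻¹ • (x - x₁ • M N)) with hy'
  set v₁ := (((-ρ a : ℝ) * (2 * x₁ / (1 + x₁)) - bilinPart (fderiv ℝ (fderiv ℝ ρ) p) y' y' -
    cgrad ρ a y') / cgrad ρ a N) with hv₁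
  have hz : z - a = y' + v₁ • N := by
    show a + (y' + v₁ • N) - a = _
    abel
  have hδ : (√(-ρ a) : ℂ) ≠ 0 := by
    rw [Complex.ofReal_ne_zero]
    exact (Real.sqrt_pos.2 (neg_pos.2 ha)).ne'
  have hly : cgrad ρ p y' = 0 := by
    rw [← hM, hy', map_smul, M.apply_symm_apply]
    simp [inner_self_eq_norm_sq_to_K, he, hx₁]
  clear_value v₁ y'
  have hy : y = y' := by
    show z - a - cgrad ρ p (z - a) • N = y'
    rw [hz, map_add, map_smul, hly, hN]
    simp
  have hu : cgrad ρ a (z - a) + bilinPart (fderiv ℝ (fderiv ℝ ρ) p) y y =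
      (-ρ a : ℝ) * (2 * x₁ / (1 + x₁)) := by
    rw [hy, hz, map_add, map_smul, smul_eq_mul, hv₁, div_mul_cancel₀ _ haN]
    ring
  refine ⟨hy, hu, ?_⟩
  show cayley (M N) ((cgrad ρ a (z - a) + bilinPart (fderiv ℝ (fderiv ℝ ρ) p) y y) / (-ρ a : ℝ))
    ((√(-ρ a) : ℂ)⁻¹ • M y) = x
  rw [hu, hy, mul_div_cancel_left₀ _ (Complex.ofReal_ne_zero.2 (neg_pos.2 ha).ne'), hy', map_smul,
    M.apply_symm_apply, smul_smul, inv_mul_cancel₀ hδ, one_smul]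
  exact (cayley_inv hx).2

theorem scaleInv_scaleMap {p N a : CSpace n} {M : CSpace n ≃L[ℂ] CSpace n} (hN : cgrad ρ p N = 1)
    (hM : ∀ v, ⟪M N, M v⟫_ℂ = cgrad ρ p v) (he : ‖M N‖ = 1) (haN : cgrad ρ a N ≠ 0)
    (ha : ρ a < 0) {z : CSpace n} (hz : (cgrad ρ a (z - a) + bilinPart (fderiv ℝ (fderiv ℝ ρ) p)
      (z - a - cgrad ρ p (z - a) • N) (z - a - cgrad ρ p (z - a) • N)) / (-ρ a : ℝ) ≠ 2) :
    scaleInv ρ p N M a (scaleMap ρ p N M a z) = z := by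
  set y := z - a - cgrad ρ p (z - a) • N with hy
  set w := (cgrad ρ a (z - a) + bilinPart (fderiv ℝ (fderiv ℝ ρ) p) y y) / (-ρ a : ℝ) with hw
  have hδ0 : ((-ρ a : ℝ) : ℂ) ≠ 0 := Complex.ofReal_ne_zero.2 (neg_pos.2 ha).ne'
  have hδ : (√(-ρ a) : ℂ) ≠ 0 := by
    rw [Complex.ofReal_ne_zero]
    exact (Real.sqrt_pos.2 (neg_pos.2 ha)).ne'
  have hly : cgrad ρ p y = 0 := by rw [hy, map_sub, map_smul, hN]; simp
  have hω : ⟪M N, (√(-ρ a) : ℂ)⁻¹ • M y⟫_ℂ = 0 := by rw [inner_smul_right, hM, hly, mul_zero]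
  have h2w : (2 : ℂ) - w ≠ 0 := sub_ne_zero.2 (Ne.symm hz)
  have hx : scaleMap ρ p N M a z = cayley (M N) w ((√(-ρ a) : ℂ)⁻¹ • M y) := rfl
  have hx₁ : innerSL ℂ (M N) (scaleMap ρ p N M a z) = (2 - w)⁻¹ * w := by
    rw [hx, innerSL_apply_apply, inner_cayley he hω]
  have h1 : (1 + (2 - w)⁻¹ * w) = 2 / (2 - w) := by field_simp; ring
  have h3 : (1 + (2 - w)⁻¹ * w)⁻¹ • (scaleMap ρ p N M a z - ((2 - w)⁻¹ * w) • M N) =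
      (√(-ρ a) : ℂ)⁻¹ • M y := by
    rw [hx, cayley, smul_add, smul_smul, add_sub_cancel_left, h1, smul_smul, smul_smul]
    have : (2 / (2 - w))⁻¹ * (2 - w)⁻¹ * 2 = 1 := by field_simp
    rw [this, one_smul]
  have h4 : 2 * ((2 - w)⁻¹ * w) / (1 + (2 - w)⁻¹ * w) = w := by rw [h1]; field_simp
  have h5 : (√(-ρ a) : ℂ) • M.symm ((√(-ρ a) : ℂ)⁻¹ • M y) = y := by
    rw [map_smul, M.symm_apply_apply, smul_smul, mul_inv_cancel₀ hδ, one_smul]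
  have h6 : ((-ρ a : ℝ) : ℂ) * w = cgrad ρ a (z - a) + bilinPart (fderiv ℝ (fderiv ℝ ρ) p) y y := by
    rw [hw, mul_div_cancel₀ _ hδ0]
  have h7 : z - a = y + cgrad ρ p (z - a) • N := by rw [hy]; abel
  rw [scaleInv]
  simp only [hx₁, h3, h4, h5, h6]
  have h8 : cgrad ρ a (z - a) = cgrad ρ a y + cgrad ρ p (z - a) * cgrad ρ a N := by
    conv_lhs => rw [h7]
    rw [map_add, map_smul, smul_eq_mul]
  rw [h8, show cgrad ρ a y + cgrad ρ p (z - a) * cgrad ρ a N + bilinPart (fderiv ℝ (fderiv ℝ ρ) p) y y -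
    bilinPart (fderiv ℝ (fderiv ℝ ρ) p) y y - cgrad ρ a y = cgrad ρ p (z - a) * cgrad ρ a N by ring,
    mul_div_cancel_right₀ _ haN, ← h7]
  abel

end ScaleMaps

section Scaling

open scoped InnerProductSpace

variable {n : ℕ} {D V W : Set (CSpace n)} {ρ : CSpace n → ℝ}

theorem differentiableOn_scaleMap {p N a : CSpace n} {M : CSpace n ≃L[ℂ] CSpace n}
    {A : Set (CSpace n)} (hA : ∀ z ∈ A,
      (cgrad ρ a (z - a) + bilinPart (fderiv ℝ (fderiv ℝ ρ) p)
      (z - a - cgrad ρ p (z - a) • N) (z - a - cgrad ρ p (z - a) • N)) / (-ρ a : ℝ) ≠ 2) :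
    DifferentiableOn ℂ (scaleMap ρ p N M a) A := by
  simp only [div_eq_mul_inv] at hA
  have h1 : DifferentiableOn ℂ (fun z => (2 -
      (cgrad ρ a (z - a) + bilinPart (fderiv ℝ (fderiv ℝ ρ) p)
        (z - a - cgrad ρ p (z - a) • N) (z - a - cgrad ρ p (z - a) • N)) *
          ((-ρ a : ℝ) : ℂ)⁻¹)⁻¹) A :=
    DifferentiableOn.fun_inv (by fun_prop) fun z hz => sub_ne_zero.2 (hA z hz).symm
  unfold scaleMap cayley
  simp only [div_eq_mul_inv]
  fun_prop

theorem differentiableOn_scaleInv {p N a : CSpace n} {M : CSpace n ≃L[ℂ] CSpace n}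
    {A : Set (CSpace n)} (hA : ∀ x ∈ A, 1 + innerSL ℂ (M N) x ≠ 0) :
    DifferentiableOn ℂ (scaleInv ρ p N M a) A := by
  unfold scaleInv
  have h1 : DifferentiableOn ℂ (fun x => (1 + innerSL ℂ (M N) x)⁻¹) A :=
    DifferentiableOn.fun_inv (by fun_prop) hA
  simp only [div_eq_mul_inv]
  fun_prop

namespace PshDefining

set_option maxHeartbeats 1000000 in
/-- Rescaling of the domain near a boundary point to the unit ball. -/
theorem exists_scaling (h : PshDefining D V W ρ) {p : CSpace n} (hp : p ∈ frontier D) :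
    ∃ e : CSpace n, ‖e‖ = 1 ∧ ∃ T S : CSpace n → CSpace n → CSpace n, ∀ s < (1 : ℝ), ∀ ε > (0 : ℝ),
      ∃ r > 0, ∀ a ∈ D ∩ ball p r,
        DifferentiableOn ℂ (S a) (ball 0 s) ∧
        (∀ x ∈ ball 0 s, S a x ∈ D ∩ ball p ε ∧ T a (S a x) = x ∧
          |-ρ (S a x) / -ρ a - (1 - ‖x‖ ^ 2) / ‖1 + ⟪e, x⟫_ℂ‖ ^ 2| ≤ ε) ∧
        DifferentiableOn ℂ (T a) (D ∩ ball p r) ∧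
        (∀ z ∈ D ∩ ball p r, ‖T a z‖ ≤ 1 + ε ∧ S a (T a z) = z) ∧
        S a 0 = a ∧ T a a = 0 := by
  obtain ⟨N, M, hN, hMℓ, hML⟩ := h.exists_frame hp
  have hpV : p ∈ V := h.subset (h.frontier_subset hp)
  have he : ‖M N‖ = 1 := by
    have h1 := inner_self_eq_norm_sq (𝕜 := ℂ) (M N)
    rw [hMℓ, hN, RCLike.one_re] at h1
    nlinarith [norm_nonneg (M N)]
  refine ⟨M N, he, scaleMap ρ p N M, scaleInv ρ p N M, fun s hs ε hε => ?_⟩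
  set B := bilinPart (fderiv ℝ (fderiv ℝ ρ) p) with hB
  set q := 1 - s with hq
  have hq0 : 0 < q := by linarith
  set K := 2 / q + (2 / q) ^ 2 with hK
  have hK0 : 0 < K := by positivity
  obtain ⟨ε₀, hε₀, hε₀1, hε₀2, hε₀3, hε₀4⟩ : ∃ ε₀ > 0, ε₀ ≤ 1 / 8 ∧ 120 * ε₀ ≤ ε ∧ ε₀ * K ≤ ε ∧
      ε₀ * K ≤ q / 8 := by
    refine ⟨min (1 / 8) (min (ε / 120) (min (ε / K) (q / (8 * K)))), by positivity,
      min_le_left _ _, ?_, ?_, ?_⟩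
    · have : min (1 / 8) (min (ε / 120) (min (ε / K) (q / (8 * K)))) ≤ ε / 120 :=
        (min_le_right _ _).trans (min_le_left _ _)
      linarith
    · rw [← le_div_iff₀ hK0]
      exact (min_le_right _ _).trans ((min_le_right _ _).trans (min_le_left _ _))
    · rw [← le_div_iff₀ hK0, div_div]
      exact (min_le_right _ _).trans ((min_le_right _ _).trans (min_le_right _ _))
  obtain ⟨r₀, hr₀, hr₀V, hnf⟩ := h.exists_normal_form hp hN hML hε₀
  set τ := min ε r₀ with hτ
  have hτ0 : 0 < τ := lt_min hε hr₀
  set m := ‖(M.symm : CSpace n →L[ℂ] CSpace n)‖ with hm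
  set A := m * (2 / q) with hA
  set L := ‖cgrad ρ p‖ + 1 with hL
  set C := A + 2 * (2 / q + ‖B‖ * A ^ 2 + L * A) * ‖N‖ with hC
  have hA0 : 0 ≤ A := by positivity
  have hC0 : 0 ≤ C := by positivity
  have hρp : ρ p = 0 := (h.mem_frontier_iff p hpV).1 hp
  have hcg := h.contDiffOn.continuousAt_cgrad h.isOpen hpV
  have hρc : ContinuousAt ρ p := h.contDiffOn.continuousOn.continuousAt (h.isOpen.mem_nhds hpV)
  have hnear : ∀ᶠ a in 𝓝 p, (1 / 2 < ‖cgrad ρ a N‖ ∧ ‖cgrad ρ a‖ < L) ∧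
      (√(-ρ a) * C < τ / 2 ∧ -ρ a < 1) ∧ a ∈ ball p (τ / 2) := by
    refine (Eventually.and ?_ ?_).and ((Eventually.and ?_ ?_).and (ball_mem_nhds p (half_pos hτ0)))
    · refine (hcg.clm_apply continuousAt_const).norm.eventually (lt_mem_nhds ?_)
      show 1 / 2 < ‖cgrad ρ p N‖
      rw [hN]; norm_num
    · exact hcg.norm.eventually (gt_mem_nhds (lt_add_one _))
    · have h1 : ContinuousAt (fun a => √(-ρ a) * C) p := (hρc.neg.sqrt).mul_const C
      refine h1.eventually (gt_mem_nhds ?_)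
      show √(-ρ p) * C < τ / 2
      rw [hρp]; simpa using hτ0
    · refine hρc.neg.eventually (gt_mem_nhds ?_)
      show -ρ p < 1
      rw [hρp]; norm_num
  obtain ⟨r, hr, hr'⟩ := Metric.eventually_nhds_iff_ball.1 hnear
  refine ⟨min r r₀, by positivity, fun a ha => ?_⟩
  obtain ⟨⟨haN, haL⟩, ⟨haC, ha1⟩, haτ⟩ := hr' a (ball_subset_ball (min_le_left _ _) ha.2)
  have har₀ : a ∈ ball p r₀ := ball_subset_ball (min_le_right _ _) ha.2
  have hρa : ρ a < 0 := (h.mem_iff a (hr₀V har₀)).1 ha.1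
  have haN0 : cgrad ρ a N ≠ 0 := norm_pos_iff.1 (by linarith)
  set δ := -ρ a with hδ
  have hδ0 : 0 < δ := neg_pos.2 hρa
  have hδs : √δ ^ 2 = δ := Real.sq_sqrt hδ0.le
  have hδs0 : 0 < √δ := Real.sqrt_pos.2 hδ0
  have hδ1 : δ ≤ √δ := by
    have : √δ ≤ 1 := Real.sqrt_le_one.2 ha1.le
    nlinarith
  have hxe : ∀ x ∈ ball (0 : CSpace n) s, q ≤ ‖1 + ⟪M N, x⟫_ℂ‖ ∧ ‖x‖ < s ∧ ‖⟪M N, x⟫_ℂ‖ ≤ ‖x‖ := by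
    intro x hx
    rw [mem_ball_zero_iff] at hx
    have h1 : ‖⟪M N, x⟫_ℂ‖ ≤ ‖x‖ := by
      have := norm_inner_le_norm (𝕜 := ℂ) (M N) x
      rwa [he, one_mul] at this
    have h2 := norm_sub_norm_le (1 : ℂ) (-⟪M N, x⟫_ℂ)
    rw [norm_neg, norm_one, sub_neg_eq_add] at h2
    exact ⟨by linarith, hx, h1⟩
  have hxe0 : ∀ x ∈ ball (0 : CSpace n) s, 1 + ⟪M N, x⟫_ℂ ≠ 0 := fun x hx =>
    norm_pos_iff.1 (hq0.trans_le (hxe x hx).1)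
  have hTgood : ∀ z ∈ D ∩ ball p r₀, (cgrad ρ a (z - a) + B
      (z - a - cgrad ρ p (z - a) • N) (z - a - cgrad ρ p (z - a) • N)) / (δ : ℂ) ≠ 2 ∧
      ‖scaleMap ρ p N M a z‖ ^ 2 ≤ 1 + 120 * ε₀ := by
    intro z hz
    set y := z - a - cgrad ρ p (z - a) • N with hy
    have h1 := (abs_le.1 (hnf a har₀ z hz.2 y hy)).1
    have h2 : ρ z < 0 := (h.mem_iff z (hr₀V hz.2)).1 hz.1
    set u := cgrad ρ a (z - a) + B y y with hu
    have hly : cgrad ρ p y = 0 := by rw [hy, map_sub, map_smul, hN]; simp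
    refine norm_cayley_sq_le he (by rw [inner_smul_right, hMℓ, hly, mul_zero]) hε₀.le hε₀1 ?_
    rw [Complex.div_ofReal_re, norm_smul, norm_inv, norm_div, Complex.norm_real, Complex.norm_real,
      Real.norm_of_nonneg hδ0.le, Real.norm_of_nonneg hδs0.le, mul_pow, inv_pow, hδs]
    rw [← mul_le_mul_iff_right₀ hδ0]
    have h3 : δ * (u.re / δ + δ⁻¹ * ‖M y‖ ^ 2) = u.re + ‖M y‖ ^ 2 := by field_simp
    have h4 : δ * (1 + ε₀ * (‖u‖ / δ + δ⁻¹ * ‖M y‖ ^ 2)) = δ + ε₀ * (‖u‖ + ‖M y‖ ^ 2) := by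
      field_simp
    rw [h3, h4]
    linarith
  have hSgood : ∀ x ∈ ball (0 : CSpace n) s, scaleInv ρ p N M a x ∈ D ∩ ball p ε ∧
      |-ρ (scaleInv ρ p N M a x) / δ - (1 - ‖x‖ ^ 2) / ‖1 + ⟪M N, x⟫_ℂ‖ ^ 2| ≤ ε := by
    intro x hx
    obtain ⟨hx1, hxs, hx2⟩ := hxe x hx
    obtain ⟨hy, hu, -⟩ := scaleMap_scaleInv hN hMℓ he haN0 hρa (hxe0 x hx)
    set z := scaleInv ρ p N M a x with hz
    set y := z - a - cgrad ρ p (z - a) • N with hy'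
    set x₁ := ⟪M N, x⟫_ℂ with hx₁
    set w := 2 * x₁ / (1 + x₁) with hw
    set ω := (1 + x₁)⁻¹ • (x - x₁ • M N) with hω
    rw [← hB] at hu
    have hwn : ‖w‖ ≤ 2 / q := by
      rw [hw, norm_div, norm_mul, Complex.norm_ofNat]
      gcongr
      linarith
    have hωn : ‖ω‖ ≤ 2 / q := by
      rw [hω, norm_smul, norm_inv, inv_mul_eq_div]
      gcongr
      refine (norm_sub_le _ _).trans ?_
      rw [norm_smul, he]
      linarith
    have hyn : ‖y‖ ≤ √δ * A := by
      rw [hy, norm_smul, Complex.norm_real, Real.norm_of_nonneg hδs0.le]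
      have := (M.symm : CSpace n →L[ℂ] CSpace n).le_opNorm ω
      gcongr
      exact this.trans (mul_le_mul_of_nonneg_left hωn (norm_nonneg _))
    have hz1 : z - a = y + cgrad ρ p (z - a) • N := by rw [hy']; abel
    have hlz : ‖cgrad ρ p (z - a)‖ ≤ 2 * (√δ * (2 / q + ‖B‖ * A ^ 2 + L * A)) := by
      have h1 : cgrad ρ p (z - a) * cgrad ρ a N = δ * w - B y y - cgrad ρ a y := by
        rw [← hu]
        conv_rhs => rw [show cgrad ρ a (z - a) = cgrad ρ a y + cgrad ρ p (z - a) * cgrad ρ a N by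
          conv_lhs => rw [hz1]
          rw [map_add, map_smul, smul_eq_mul]]
        ring
      have h2 : ‖cgrad ρ p (z - a)‖ * (1 / 2) ≤ √δ * (2 / q) + ‖B‖ * (√δ * A ^ 2) + L * (√δ * A) := by
        calc ‖cgrad ρ p (z - a)‖ * (1 / 2) ≤ ‖cgrad ρ p (z - a)‖ * ‖cgrad ρ a N‖ := by gcongr
          _ = ‖δ * w - B y y - cgrad ρ a y‖ := by rw [← norm_mul, h1]
          _ ≤ ‖(δ : ℂ) * w‖ + ‖B y y‖ + ‖cgrad ρ a y‖ :=
            (norm_sub_le _ _).trans (by gcongr; exact norm_sub_le _ _)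
          _ ≤ δ * (2 / q) + ‖B‖ * (√δ * A) ^ 2 + L * (√δ * A) := by
            gcongr
            · rw [norm_mul, Complex.norm_real, Real.norm_of_nonneg hδ0.le]; gcongr
            · refine (B.le_opNorm₂ y y).trans ?_
              rw [mul_assoc, ← sq]; gcongr
            · exact ((cgrad ρ a).le_opNorm y).trans (by gcongr)
          _ = δ * (2 / q) + ‖B‖ * (δ * A ^ 2) + L * (√δ * A) := by rw [mul_pow, hδs]
          _ ≤ _ := by gcongr
      linarith
    have hzp : z ∈ ball p τ := by
      rw [mem_ball, dist_eq_norm] at haτ ⊢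
      have h1 : z - p = (z - a) + (a - p) := by abel
      have h2 : ‖z - a‖ ≤ √δ * C := by
        calc ‖z - a‖ = ‖y + cgrad ρ p (z - a) • N‖ := by rw [← hz1]
          _ ≤ ‖y‖ + ‖cgrad ρ p (z - a)‖ * ‖N‖ := by
            rw [← norm_smul]; exact norm_add_le _ _
          _ ≤ √δ * A + 2 * (√δ * (2 / q + ‖B‖ * A ^ 2 + L * A)) * ‖N‖ := by gcongr
          _ = _ := by rw [hC]; ring
      rw [h1]
      linarith [norm_add_le (z - a) (a - p)]
    have hzr₀ : z ∈ ball p r₀ := ball_subset_ball (min_le_right _ _) hzp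
    have hMy : ‖M y‖ ^ 2 = δ * ‖ω‖ ^ 2 := by
      rw [hy, map_smul, M.apply_symm_apply, norm_smul, Complex.norm_real,
        Real.norm_of_nonneg hδs0.le, mul_pow, hδs]
    have hkp := hnf a har₀ z hzr₀ y rfl
    rw [← hB, hu, hMy, norm_mul, Complex.norm_real, Real.norm_of_nonneg hδ0.le,
      Complex.re_ofReal_mul] at hkp
    have hsi := siegel_eq he (hxe0 x hx)
    rw [← hx₁, ← hw, ← hω] at hsi
    have hest : |-ρ z / δ - (1 - ‖x‖ ^ 2) / ‖1 + x₁‖ ^ 2| ≤ ε₀ * K := by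
      rw [← hsi, ← mul_le_mul_iff_right₀ hδ0]
      have h1 : δ * |-ρ z / δ - (1 - w.re - ‖ω‖ ^ 2)| =
          |ρ z - ρ a - δ * w.re - δ * ‖ω‖ ^ 2| := by
        conv_lhs => rw [← abs_of_pos hδ0, ← abs_mul, abs_of_pos hδ0]
        rw [← abs_neg]
        congr 1
        rw [mul_sub, mul_div_cancel₀ _ hδ0.ne', show ρ a = -δ by rw [hδ]; ring]
        ring
      rw [h1]
      refine hkp.trans ?_
      calc ε₀ * (δ * ‖w‖ + δ * ‖ω‖ ^ 2) = δ * (ε₀ * (‖w‖ + ‖ω‖ ^ 2)) := by ring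
        _ ≤ δ * (ε₀ * K) := by rw [hK]; gcongr
    refine ⟨⟨(h.mem_iff z (hr₀V hzr₀)).2 ?_, ball_subset_ball (min_le_left _ _) hzp⟩,
      hest.trans hε₀3⟩
    have h1 : q / 4 ≤ (1 - ‖x‖ ^ 2) / ‖1 + x₁‖ ^ 2 := by
      have h2 : ‖1 + x₁‖ ≤ 2 := by
        have := norm_add_le 1 x₁
        rw [norm_one] at this; linarith
      have h3 : q ≤ 1 - ‖x‖ ^ 2 := by nlinarith [norm_nonneg x]
      have h4 : ‖1 + x₁‖ ^ 2 ≤ 4 := by nlinarith [norm_nonneg (1 + x₁)]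
      have h5 : 0 < ‖1 + x₁‖ ^ 2 := by
        have := hq0.trans_le hx1
        positivity
      have h6 : 0 ≤ 1 - ‖x‖ ^ 2 := by linarith
      gcongr
    have h2 := (abs_le.1 hest).1
    have h3 : 0 < -ρ z / δ := by linarith
    rw [div_pos_iff_of_pos_right hδ0] at h3
    linarith
  have hsub : D ∩ ball p (min r r₀) ⊆ D ∩ ball p r₀ :=
    inter_subset_inter_right _ (ball_subset_ball (min_le_right _ _))
  refine ⟨differentiableOn_scaleInv fun x hx => hxe0 x hx, fun x hx => ⟨(hSgood x hx).1,
    (scaleMap_scaleInv hN hMℓ he haN0 hρa (hxe0 x hx)).2.2, (hSgood x hx).2⟩,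
    differentiableOn_scaleMap fun z hz => (hTgood z (hsub hz)).1, fun z hz => ⟨?_, ?_⟩, ?_, ?_⟩
  · have := (hTgood z (hsub hz)).2
    nlinarith [norm_nonneg (scaleMap ρ p N M a z)]
  · exact scaleInv_scaleMap hN hMℓ he haN0 hρa (hTgood z (hsub hz)).1
  · simp [scaleInv]
  · simp [scaleMap, cayley]

end PshDefining

end Scaling

section OrbitAtBoundary

open scoped InnerProductSpace

variable {n : ℕ} {D V W : Set (CSpace n)} {ρ : CSpace n → ℝ}

/-- A holomorphic self-map of the ball fixing the origin and preserving the norm of one other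
point is linear on the complex line through that point. -/
theorem apply_smul_of_norm_eq {F : CSpace n → CSpace n} (hd : DifferentiableOn ℂ F (ball 0 1))
    (hm : MapsTo F (ball 0 1) (ball 0 1)) (h0 : F 0 = 0) {y : CSpace n} (hy0 : y ≠ 0)
    (hy1 : ‖y‖ < 1) (hFy : ‖F y‖ = ‖y‖) {t : ℂ} (ht : ‖t • y‖ < 1) : F (t • y) = t • F y := by
  have hy : 0 < ‖y‖ := norm_pos_iff.2 hy0
  set u : CSpace n := ((‖y‖⁻¹ : ℝ) : ℂ) • y with hu
  have hu1 : ‖u‖ = 1 := by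
    rw [hu, norm_smul, Complex.norm_real, norm_inv, norm_norm, inv_mul_cancel₀ hy.ne']
  have hyu : ((‖y‖ : ℝ) : ℂ) • u = y := by
    rw [hu, smul_smul, ← Complex.ofReal_mul, mul_inv_cancel₀ hy.ne', Complex.ofReal_one, one_smul]
  have hline : MapsTo (fun ζ : ℂ => ζ • u) (ball 0 1) (ball 0 1) := fun ζ hζ => by
    rw [mem_ball_zero_iff] at hζ ⊢
    rwa [norm_smul, hu1, mul_one]
  have hφd : DifferentiableOn ℂ (fun ζ : ℂ => F (ζ • u)) (ball 0 1) :=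
    hd.comp (by fun_prop) hline
  have hφ0 : F ((0 : ℂ) • u) = 0 := by rw [zero_smul, h0]
  have hyball : ((‖y‖ : ℝ) : ℂ) ∈ ball (0 : ℂ) 1 := by simpa using hy1
  obtain ⟨C, -, hC⟩ := Complex.affine_of_mapsTo_ball_of_exists_norm_dslope_eq_div'
    (R₂ := 1) hφd (fun ζ hζ => by
      show F (ζ • u) ∈ closedBall (F ((0 : ℂ) • u)) 1
      rw [hφ0]; exact ball_subset_closedBall (hm (hline hζ)))
    ⟨((‖y‖ : ℝ) : ℂ), hyball, by
      rw [dslope_of_ne _ (by simpa using hy0), slope_def_module]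
      show ‖((‖y‖ : ℂ) - 0)⁻¹ • (F ((‖y‖ : ℂ) • u) - F ((0 : ℂ) • u))‖ = 1 / 1
      rw [hφ0, hyu, sub_zero, sub_zero, norm_smul, norm_inv, Complex.norm_real, norm_norm, hFy,
        inv_mul_cancel₀ hy.ne', div_one]⟩
  have hC' : ∀ ζ ∈ ball (0 : ℂ) 1, F (ζ • u) = ζ • C := fun ζ hζ => by
    have := hC hζ
    simpa [hφ0, h0] using this
  have h1 := hC' _ hyball
  rw [hyu] at h1
  rw [h1, smul_smul, ← hC' (t * ‖y‖) (by
    rw [norm_smul] at ht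
    simpa using ht), ← smul_smul, hyu]

/-- The maps `φ k` are, locally and eventually along `𝒰`, holomorphic with values in `D`. -/
def EventuallyHol {ι : Type*} (𝒰 : Ultrafilter ι) (φ : ι → CSpace n → CSpace n)
    (Ω D : Set (CSpace n)) : Prop :=
  ∀ x ∈ Ω, ∃ r > 0, ∀ᶠ k in (𝒰 : Filter ι), DifferentiableOn ℂ (φ k) (ball x r) ∧
    MapsTo (φ k) (ball x r) D

/-- The maps `T a` and `S a` rescale `D` near `p` to the unit ball, with inverse `S a`. -/
def IsScaling (D : Set (CSpace n)) (ρ : CSpace n → ℝ) (p e : CSpace n)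
    (T S : CSpace n → CSpace n → CSpace n) : Prop :=
  ∀ s < (1 : ℝ), ∀ ε > (0 : ℝ), ∃ r > 0, ∀ a ∈ D ∩ ball p r,
    DifferentiableOn ℂ (S a) (ball 0 s) ∧
    (∀ x ∈ ball 0 s, S a x ∈ D ∩ ball p ε ∧ T a (S a x) = x ∧
      |-ρ (S a x) / -ρ a - (1 - ‖x‖ ^ 2) / ‖1 + ⟪e, x⟫_ℂ‖ ^ 2| ≤ ε) ∧
    DifferentiableOn ℂ (T a) (D ∩ ball p r) ∧
    (∀ z ∈ D ∩ ball p r, ‖T a z‖ ≤ 1 + ε ∧ S a (T a z) = z) ∧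
    S a 0 = a ∧ T a a = 0

variable {ι : Type*} {𝒰 : Ultrafilter ι} {φ : ι → CSpace n → CSpace n} {Ω : Set (CSpace n)}
  {p e x₀ : CSpace n} {T S : CSpace n → CSpace n → CSpace n} {a : ι → CSpace n}

theorem EventuallyHol.exists_limit (hφ : EventuallyHol 𝒰 φ Ω D) (hDb : Bornology.IsBounded D) :
    ∃ G : CSpace n → CSpace n, DifferentiableOn ℂ G Ω ∧
      (∀ z ∈ Ω, ∀ x : ι → CSpace n, Tendsto x 𝒰 (𝓝 z) →
        Tendsto (fun k => φ k (x k)) 𝒰 (𝓝 (G z))) ∧ ∀ z ∈ Ω, G z ∈ closure D := by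
  obtain ⟨R, hR⟩ := hDb.subset_closedBall 0
  obtain ⟨G, hG, hGl, -⟩ := 𝒰.exists_holomorphic_limit φ Ω fun z hz => by
    obtain ⟨r, hr, h⟩ := hφ z hz
    exact ⟨r, hr, R, h.mono fun k hk => ⟨hk.1, fun x hx => by simpa using hR (hk.2 hx)⟩⟩
  refine ⟨G, hG, hGl, fun z hz => ?_⟩
  obtain ⟨r, hr, h⟩ := hφ z hz
  exact mem_closure_of_tendsto (hGl z hz _ tendsto_const_nhds)
    (h.mono fun k hk => hk.2 (mem_ball_self hr))

/-- If the `φ k` send one point to a sequence converging to a boundary point `p`, then they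
converge to `p` locally uniformly. -/
theorem EventuallyHol.exists_mapsTo (hφ : EventuallyHol 𝒰 φ Ω D) (h : PshDefining D V W ρ)
    (hDb : Bornology.IsBounded D) (hΩ : IsOpen Ω) (hΩc : IsPreconnected Ω) (hx₀ : x₀ ∈ Ω)
    (hp : p ∈ frontier D) (hlim : Tendsto (fun k => φ k x₀) 𝒰 (𝓝 p)) {x : CSpace n} (hx : x ∈ Ω)
    {ε : ℝ} (hε : 0 < ε) : ∃ r > 0, ∀ᶠ k in (𝒰 : Filter ι), DifferentiableOn ℂ (φ k) (ball x r) ∧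
      MapsTo (φ k) (ball x r) (D ∩ ball p ε) := by
  obtain ⟨G, hG, hGl, hGD⟩ := hφ.exists_limit hDb
  have hG0 : G x₀ = p := tendsto_nhds_unique (hGl x₀ hx₀ _ tendsto_const_nhds) hlim
  have hGp := h.eqOn_of_mem_frontier hΩ hΩc hG hGD hx₀ (hG0 ▸ hp)
  obtain ⟨r₁, hr₁, h1⟩ := hφ x hx
  obtain ⟨r₂, hr₂, hr₂Ω⟩ := Metric.isOpen_iff.1 hΩ x hx
  have hsub : closedBall x (r₂ / 2) ⊆ Ω :=
    (closedBall_subset_ball (half_lt_self hr₂)).trans hr₂Ω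
  have h2 := 𝒰.eventually_mapsTo_of_isCompact (isCompact_closedBall x (r₂ / 2))
    (fun z hz => hGl z (hsub hz)) (O := ball p ε) isOpen_ball fun z hz => by
      rw [hGp z (hsub hz), hG0]; exact mem_ball_self hε
  refine ⟨min r₁ (r₂ / 2), by positivity, (h1.and h2).mono fun k hk => ⟨hk.1.1.mono
    (ball_subset_ball (min_le_left _ _)), fun z hz => ⟨hk.1.2 (ball_subset_ball
      (min_le_left _ _) hz), hk.2 (ball_subset_closedBall (ball_subset_ball
        (min_le_right _ _) hz))⟩⟩⟩

theorem EventuallyHol.exists_scaling_limit (hφ : EventuallyHol 𝒰 φ Ω D) (h : PshDefining D V W ρ)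
    (hDb : Bornology.IsBounded D) (hΩ : IsOpen Ω) (hΩc : IsPreconnected Ω) (hx₀ : x₀ ∈ Ω)
    (hp : p ∈ frontier D) (hTS : IsScaling D ρ p e T S) (ha : Tendsto a 𝒰 (𝓝 p))
    (haD : ∀ k, a k ∈ D) (hφa : ∀ᶠ k in (𝒰 : Filter ι), φ k x₀ = a k) :
    ∃ F : CSpace n → CSpace n, DifferentiableOn ℂ F Ω ∧ MapsTo F Ω (ball 0 1) ∧ F x₀ = 0 ∧
      (∀ z ∈ Ω, ∀ x : ι → CSpace n, Tendsto x 𝒰 (𝓝 z) →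
        Tendsto (fun k => T (a k) (φ k (x k))) 𝒰 (𝓝 (F z)) ∧
        ∀ᶠ k in (𝒰 : Filter ι), S (a k) (T (a k) (φ k (x k))) = φ k (x k)) ∧
      ∀ z ∈ Ω, Tendsto (fun k => fderiv ℂ (T (a k) ∘ φ k) z) 𝒰 (𝓝 (fderiv ℂ F z)) := by
  have hlim : Tendsto (fun k => φ k x₀) 𝒰 (𝓝 p) :=
    ha.congr' (hφa.mono fun k hk => hk.symm)
  have key : ∀ x ∈ Ω, ∀ ε > 0, ∃ r > 0, ∀ᶠ k in (𝒰 : Filter ι),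
      DifferentiableOn ℂ (T (a k) ∘ φ k) (ball x r) ∧ ∀ z ∈ ball x r,
        ‖(T (a k) ∘ φ k) z‖ ≤ 1 + ε ∧ S (a k) (T (a k) (φ k z)) = φ k z := by
    intro x hx ε hε
    obtain ⟨r, hr, hr'⟩ := hTS 0 one_pos ε hε
    obtain ⟨r', hr'0, h1⟩ := hφ.exists_mapsTo h hDb hΩ hΩc hx₀ hp hlim hx hr
    refine ⟨r', hr'0, (h1.and (ha.eventually (ball_mem_nhds p hr))).mono fun k hk => ?_⟩
    obtain ⟨-, -, hT, hT', -⟩ := hr' (a k) ⟨haD k, hk.2⟩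
    exact ⟨hT.comp hk.1.1 hk.1.2, fun z hz => hT' _ (hk.1.2 hz)⟩
  obtain ⟨F, hF, hFl, hFd⟩ := 𝒰.exists_holomorphic_limit (fun k => T (a k) ∘ φ k) Ω fun z hz => by
    obtain ⟨r, hr, h1⟩ := key z hz 1 one_pos
    exact ⟨r, hr, 1 + 1, h1.mono fun k hk => ⟨hk.1, fun x hx => (hk.2 x hx).1⟩⟩
  have hF1 : ∀ z ∈ Ω, ‖F z‖ ≤ 1 := fun z hz => le_of_forall_pos_le_add fun ε hε => by
    obtain ⟨r, hr, h1⟩ := key z hz ε hε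
    exact le_of_tendsto (hFl z hz _ tendsto_const_nhds).norm
      (h1.mono fun k hk => (hk.2 z (mem_ball_self hr)).1)
  have hF0 : F x₀ = 0 := by
    refine tendsto_nhds_unique (hFl x₀ hx₀ _ tendsto_const_nhds) (tendsto_const_nhds.congr' ?_)
    obtain ⟨r, hr, hr'⟩ := hTS 0 one_pos 1 one_pos
    filter_upwards [hφa, ha.eventually (ball_mem_nhds p hr)] with k hk hk'
    show 0 = T (a k) (φ k x₀)
    rw [hk, (hr' (a k) ⟨haD k, hk'⟩).2.2.2.2.2]
  refine ⟨F, hF, fun z hz => ?_, hF0, fun z hz x hx => ⟨hFl z hz x hx, ?_⟩, hFd⟩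
  · rw [mem_ball_zero_iff]
    refine (hF1 z hz).lt_of_ne fun hz1 => ?_
    have := Complex.norm_eqOn_of_isPreconnected_of_isMaxOn hΩc hΩ hF hz
      (fun w hw => (hF1 w hw).trans_eq hz1.symm) hx₀
    simp [hF0, hz1] at this
  · obtain ⟨r, hr, h1⟩ := key z hz 1 one_pos
    exact (h1.and (hx.eventually (ball_mem_nhds z hr))).mono fun k hk => (hk.1.2 _ hk.2).2

theorem AutOn.eventuallyHol {g : ι → CSpace n → CSpace n} (hg : ∀ k, AutOn D (g k))
    (hDo : IsOpen D) : EventuallyHol 𝒰 g D D := fun x hx => by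
  obtain ⟨r, hr, hrD⟩ := Metric.isOpen_iff.1 hDo x hx
  exact ⟨r, hr, Eventually.of_forall fun k =>
    ⟨(hg k).1.mono hrD, (hg k).mapsTo.mono_left hrD⟩⟩

theorem IsScaling.eventuallyHol_comp (hTS : IsScaling D ρ p e T S) {g : ι → CSpace n → CSpace n}
    (hg : ∀ k, AutOn D (g k)) (ha : Tendsto a 𝒰 (𝓝 p)) (haD : ∀ k, a k ∈ D) :
    EventuallyHol 𝒰 (fun k => g k ∘ S (a k)) (ball 0 1) D := fun x hx => by
  rw [mem_ball_zero_iff] at hx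
  obtain ⟨r, hr, hr'⟩ := hTS ((1 + ‖x‖) / 2) (by linarith) 1 one_pos
  have hsub : ball x ((1 - ‖x‖) / 2) ⊆ ball 0 ((1 + ‖x‖) / 2) := by
    refine ball_subset_ball' ?_
    rw [dist_zero_right]; linarith
  refine ⟨(1 - ‖x‖) / 2, by linarith, (ha.eventually (ball_mem_nhds p hr)).mono fun k hk => ?_⟩
  obtain ⟨hS, hS', -⟩ := hr' (a k) ⟨haD k, hk⟩
  have hmap : MapsTo (S (a k)) (ball x ((1 - ‖x‖) / 2)) D := fun z hz => (hS' z (hsub hz)).1.1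
  exact ⟨(hg k).1.comp (hS.mono hsub) hmap, (hg k).mapsTo.comp hmap⟩

theorem IsScaling.eventually_apply_zero (hTS : IsScaling D ρ p e T S) (ha : Tendsto a 𝒰 (𝓝 p))
    (haD : ∀ k, a k ∈ D) : ∀ᶠ k in (𝒰 : Filter ι), S (a k) 0 = a k := by
  obtain ⟨r, hr, hr'⟩ := hTS 0 one_pos 1 one_pos
  exact (ha.eventually (ball_mem_nhds p hr)).mono fun k hk => (hr' (a k) ⟨haD k, hk⟩).2.2.2.2.1

/-- If an orbit of the automorphism group accumulates at the boundary, an automorphism with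
isolated fixed points has at most one of them. -/
theorem AutOn.subsingleton_fixOn_of_tendsto_frontier (h : PshDefining D V W ρ) (hDo : IsOpen D)
    (hDc : IsPreconnected D) (hDb : Bornology.IsBounded D) {g : ι → CSpace n → CSpace n}
    (hg : ∀ k, AutOn D (g k)) (hx₀ : x₀ ∈ D) (hp : p ∈ frontier D)
    (hlim : Tendsto (fun k => g k x₀) 𝒰 (𝓝 p)) {f : CSpace n → CSpace n} (hf : AutOn D f)
    (hfix : DiscreteIn (FixOn D f)) : (FixOn D f).Subsingleton := by
  intro q₀ hq₀ p₀ hp₀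
  by_contra hne
  obtain ⟨e, -, T, S, hTS⟩ := h.exists_scaling hp
  replace hTS : IsScaling D ρ p e T S := hTS
  have hgD := AutOn.eventuallyHol (𝒰 := 𝒰) hg hDo
  set a : ι → CSpace n := fun k => g k p₀ with ha'
  have haD : ∀ k, a k ∈ D := fun k => (hg k).mapsTo hp₀.1
  have ha : Tendsto a 𝒰 (𝓝 p) := by
    obtain ⟨G, hG, hGl, hGD⟩ := hgD.exists_limit hDb
    have hG0 : G x₀ = p := tendsto_nhds_unique (hGl x₀ hx₀ _ tendsto_const_nhds) hlim
    have := h.eqOn_of_mem_frontier hDo hDc hG hGD hx₀ (hG0 ▸ hp) p₀ hp₀.1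
    rw [← hG0, ← this]
    exact hGl p₀ hp₀.1 _ tendsto_const_nhds
  obtain ⟨F, hF, hFm, hF0, hFl, -⟩ := hgD.exists_scaling_limit h hDb hDo hDc hp₀.1 hp hTS ha haD
    (Eventually.of_forall fun k => rfl)
  choose g' hg' hg'g hgg' using fun k => (hg k).exists_inverse
  have hψ := hTS.eventuallyHol_comp hg' ha haD
  obtain ⟨G, hG, hGl, hGD⟩ := hψ.exists_limit hDb
  have h0 : (0 : CSpace n) ∈ ball (0 : CSpace n) 1 := mem_ball_self one_pos
  have hG0 : G 0 = p₀ := by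
    refine tendsto_nhds_unique (hGl 0 h0 _ tendsto_const_nhds) (tendsto_const_nhds.congr' ?_)
    filter_upwards [hTS.eventually_apply_zero ha haD] with k hk
    show p₀ = g' k (S (a k) 0)
    rw [hk, hg'g k p₀ hp₀.1]
  have hGm : MapsTo G (ball 0 1) D := fun x hx => by
    by_contra hxD
    have h1 : G x ∈ frontier D := ⟨hGD x hx, fun hi => hxD (interior_subset hi)⟩
    have h2 := h.eqOn_of_mem_frontier isOpen_ball (convex_ball _ _).isPreconnected hG hGD hx h1
    rw [← h2 0 h0, hG0, hDo.frontier_eq] at h1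
    exact h1.2 hp₀.1
  have hGF : ∀ x ∈ D, G (F x) = x := fun x hx => by
    obtain ⟨h1, h2⟩ := hFl x hx (fun _ => x) tendsto_const_nhds
    refine tendsto_nhds_unique (hGl (F x) (hFm hx) _ h1) (tendsto_const_nhds.congr' ?_)
    filter_upwards [h2] with k hk
    show x = g' k (S (a k) (T (a k) (g k x)))
    rw [hk, hg'g k x hx]
  set y := F q₀ with hy
  have hGy : G y = q₀ := hGF q₀ hq₀.1
  have hy0 : y ≠ 0 := fun hy0 => hne (by rw [← hGy, hy0, hG0])
  have hy1 : ‖y‖ < 1 := by simpa using hFm hq₀.1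
  have hmain : ∀ t ∈ Icc (0 : ℝ) 1, G ((t : ℂ) • y) ∈ FixOn D f := fun t ht => by
    have hty : ‖(t : ℂ) • y‖ < 1 := by
      rw [norm_smul, Complex.norm_real, Real.norm_of_nonneg ht.1]
      nlinarith [norm_nonneg y, ht.2]
    have htb : (t : ℂ) • y ∈ ball (0 : CSpace n) 1 := by simpa using hty
    have h1 := apply_smul_of_norm_eq (F := F ∘ f ∘ G)
      (hF.comp (hf.1.comp hG hGm) (hf.mapsTo.comp hGm)) (hFm.comp (hf.mapsTo.comp hGm))
      (by simp [hG0, hp₀.2, hF0]) hy0 hy1 (by simp [hGy, hq₀.2, ← hy]) hty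
    simp only [Function.comp_apply, hGy, hq₀.2, ← hy] at h1
    refine ⟨hGm htb, ?_⟩
    rw [← hGF _ (hf.mapsTo (hGm htb)), h1]
  obtain ⟨ε, hε, hε'⟩ := hfix p₀ hp₀
  have hcont : ContinuousOn (fun t : ℝ => dist (G ((t : ℂ) • y)) p₀) (Icc 0 1) := by
    refine continuous_dist.comp_continuousOn
      ((hG.continuousOn.comp (by fun_prop) fun t ht => ?_).prodMk continuousOn_const)
    rw [mem_ball_zero_iff, norm_smul, Complex.norm_real, Real.norm_of_nonneg ht.1]
    nlinarith [norm_nonneg y, ht.2]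
  have hqε : ε ≤ dist q₀ p₀ := hε' q₀ hq₀ hne
  obtain ⟨t, ht, htε⟩ := intermediate_value_Icc zero_le_one hcont (show ε / 2 ∈ Icc _ _ by
    constructor
    · simpa [hG0] using (half_pos hε).le
    · simp only [Complex.ofReal_one, one_smul, hGy]; linarith)
  have htε' : dist (G ((t : ℂ) • y)) p₀ = ε / 2 := htε
  have := hε' _ (hmain t ht) fun heq => by
    rw [heq, dist_self] at htε'; linarith
  linarith

end OrbitAtBoundary

section CompactOrbits

open scoped InnerProductSpace

variable {n : ℕ} {D V W : Set (CSpace n)} {ρ : CSpace n → ℝ}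
variable {ι : Type*} {𝒰 : Ultrafilter ι} {Ω : Set (CSpace n)}
  {p e x₀ : CSpace n} {T S : CSpace n → CSpace n → CSpace n} {a : ι → CSpace n}

/-- If no orbit accumulates at the boundary, orbits of compact sets stay uniformly away
from it. -/
theorem PshDefining.exists_le_neg_of_isCompact (h : PshDefining D V W ρ) (hDo : IsOpen D)
    (hDb : Bornology.IsBounded D)
    (hA : ∀ g : ℕ → CSpace n → CSpace n, (∀ k, AutOn D (g k)) → ∀ x ∈ D, ∀ b ∈ frontier D,
      ¬ Tendsto (fun k => g k x) (hyperfilter ℕ : Ultrafilter ℕ) (𝓝 b)) {K : Set (CSpace n)}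
    (hKD : K ⊆ D) (hK : IsCompact K) :
    ∃ η > 0, ∀ g, AutOn D g → ∀ z ∈ K, ρ (g z) ≤ -η := by
  by_contra! hcon
  choose g hg z hz hgz using fun k : ℕ => hcon (1 / ((k : ℝ) + 1)) (by positivity)
  obtain ⟨z₀, hz₀, hzl⟩ := hK.ultrafilter_le_nhds ((hyperfilter ℕ).map z)
    (by
      rw [le_principal_iff]
      exact Eventually.of_forall (p := fun k => z k ∈ K) hz)
  replace hzl : Tendsto z (hyperfilter ℕ : Ultrafilter ℕ) (𝓝 z₀) := hzl
  obtain ⟨G, -, hGl, hGD⟩ := (AutOn.eventuallyHol (𝒰 := hyperfilter ℕ) hg hDo).exists_limit hDb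
  have hG0 : G z₀ ∈ D := by
    by_contra hGz
    exact hA g hg z₀ (hKD hz₀) (G z₀) ⟨hGD z₀ (hKD hz₀), fun hi => hGz (interior_subset hi)⟩
      (hGl z₀ (hKD hz₀) _ tendsto_const_nhds)
  have hGV : G z₀ ∈ V := h.closure_subset (subset_closure hG0)
  have h1 : Tendsto (fun k => ρ (g k (z k))) (hyperfilter ℕ : Ultrafilter ℕ) (𝓝 (ρ (G z₀))) :=
    (h.contDiffOn.continuousOn.continuousAt (h.isOpen.mem_nhds hGV)).tendsto.comp
      (hGl z₀ (hKD hz₀) z hzl)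
  have h2 : Tendsto (fun k : ℕ => -(1 / ((k : ℝ) + 1))) (hyperfilter ℕ : Ultrafilter ℕ) (𝓝 0) := by
    have := (tendsto_one_div_add_atTop_nhds_zero_nat (𝕜 := ℝ)).neg
    rw [neg_zero] at this
    exact this.mono_left Nat.hyperfilter_le_atTop
  have h3 : 0 ≤ ρ (G z₀) := le_of_tendsto_of_tendsto h2 h1 (Eventually.of_forall fun k => (hgz k).le)
  exact h3.not_gt ((h.mem_iff _ hGV).1 hG0)

/-- The limit of rescaled automorphisms satisfies a boundary height estimate. -/
theorem le_height_of_tendsto (h : PshDefining D V W ρ) (hTS : IsScaling D ρ p e T S)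
    {g : ι → CSpace n → CSpace n} {r c : ℝ} (hr : 0 < r) (hc : 0 < c)
    (hg : ∀ k, ∀ z ∈ D ∩ ball p r, c * -ρ z ≤ -ρ (g k z))
    (ha : Tendsto a 𝒰 (𝓝 p)) (haD : ∀ k, a k ∈ D) (he : ‖e‖ = 1) {x y : CSpace n} (hx : ‖x‖ < 1)
    (hy : ‖y‖ < 1) (hxy : Tendsto (fun k => T (a k) (g k (S (a k) x))) 𝒰 (𝓝 y))
    (hS : ∀ᶠ k in (𝒰 : Filter ι), S (a k) (T (a k) (g k (S (a k) x))) = g k (S (a k) x)) :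
    c * ((1 - ‖x‖ ^ 2) / ‖1 + ⟪e, x⟫_ℂ‖ ^ 2) ≤ (1 - ‖y‖ ^ 2) / ‖1 + ⟪e, y⟫_ℂ‖ ^ 2 := by
  obtain ⟨s, hs, hs1⟩ := exists_between (max_lt hx hy)
  have hy0 : 1 + ⟪e, y⟫_ℂ ≠ 0 := fun h0 => by
    have h1 := norm_inner_le_norm (𝕜 := ℂ) e y
    rw [← neg_eq_of_add_eq_zero_right h0, norm_neg, norm_one, he] at h1
    linarith
  have hcont : ContinuousAt (fun y : CSpace n => (1 - ‖y‖ ^ 2) / ‖1 + ⟪e, y⟫_ℂ‖ ^ 2) y := by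
    refine ContinuousAt.div (by fun_prop) ?_ (by simpa using hy0)
    exact ((continuousAt_const.add (innerSL ℂ e).continuous.continuousAt).norm).pow 2
  have hlim := hcont.tendsto.comp hxy
  have key : ∀ ε > 0, ε ≤ r → c * ((1 - ‖x‖ ^ 2) / ‖1 + ⟪e, x⟫_ℂ‖ ^ 2 - ε) ≤
      (1 - ‖y‖ ^ 2) / ‖1 + ⟪e, y⟫_ℂ‖ ^ 2 + ε := fun ε hε hεr => by
    obtain ⟨r', hr', hr''⟩ := hTS s hs1 ε hε
    refine ge_of_tendsto (hlim.add_const ε) ?_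
    have hyb : ball (0 : CSpace n) s ∈ 𝓝 y :=
      isOpen_ball.mem_nhds (by simpa using (le_max_right _ _).trans_lt hs)
    filter_upwards [ha.eventually (ball_mem_nhds p hr'), hxy.eventually hyb, hS] with k hk hk' hk''
    obtain ⟨-, h1, -⟩ := hr'' (a k) ⟨haD k, hk⟩
    obtain ⟨h2, -, h3⟩ := h1 x (by simpa using (le_max_left _ _).trans_lt hs)
    obtain ⟨-, -, h4⟩ := h1 _ hk'
    rw [hk''] at h4
    have h5 := hg k _ ⟨h2.1, ball_subset_ball hεr h2.2⟩
    have h6 : 0 < -ρ (a k) :=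
      neg_pos.2 ((h.mem_iff _ (h.closure_subset (subset_closure (haD k)))).1 (haD k))
    have h7 : c * (-ρ (S (a k) x) / -ρ (a k)) ≤ -ρ (g k (S (a k) x)) / -ρ (a k) := by
      rw [← mul_div_assoc]; gcongr
    have h8 : (1 - ‖x‖ ^ 2) / ‖1 + ⟪e, x⟫_ℂ‖ ^ 2 - ε ≤ -ρ (S (a k) x) / -ρ (a k) := by
      linarith [(abs_le.1 h3).1]
    have h9 := (abs_le.1 h4).2
    show c * _ ≤ (1 - ‖T (a k) (g k (S (a k) x))‖ ^ 2) /
      ‖1 + ⟪e, T (a k) (g k (S (a k) x))⟫_ℂ‖ ^ 2 + ε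
    linarith [mul_le_mul_of_nonneg_left h8 hc.le]
  have hl1 : Tendsto (fun ε : ℝ => c * ((1 - ‖x‖ ^ 2) / ‖1 + ⟪e, x⟫_ℂ‖ ^ 2 - ε)) (𝓝[>] 0)
      (𝓝 (c * ((1 - ‖x‖ ^ 2) / ‖1 + ⟪e, x⟫_ℂ‖ ^ 2 - 0))) :=
    Tendsto.mono_left (Continuous.tendsto (by fun_prop) 0) nhdsWithin_le_nhds
  have hl2 : Tendsto (fun ε : ℝ => (1 - ‖y‖ ^ 2) / ‖1 + ⟪e, y⟫_ℂ‖ ^ 2 + ε) (𝓝[>] 0)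
      (𝓝 ((1 - ‖y‖ ^ 2) / ‖1 + ⟪e, y⟫_ℂ‖ ^ 2 + 0)) :=
    Tendsto.mono_left (Continuous.tendsto (by fun_prop) 0) nhdsWithin_le_nhds
  rw [sub_zero] at hl1
  rw [add_zero] at hl2
  refine le_of_tendsto_of_tendsto hl1 hl2 ?_
  filter_upwards [Ioc_mem_nhdsGT hr] with ε hε using key ε hε.1 hε.2

theorem eq_of_height_le {e v : CSpace n} (he : ‖e‖ = 1) (hv : ‖v‖ = 1) {c : ℝ} (hc : 0 < c)
    (hle : ∀ t ∈ Ioo (0 : ℝ) 1, c * ((1 - ‖-(t : ℂ) • e‖ ^ 2) / ‖1 + ⟪e, -(t : ℂ) • e⟫_ℂ‖ ^ 2) ≤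
      (1 - ‖-(t : ℂ) • v‖ ^ 2) / ‖1 + ⟪e, -(t : ℂ) • v⟫_ℂ‖ ^ 2) : v = e := by
  have h1 : ∀ t ∈ Ioo (0 : ℝ) 1, c * ‖1 + -(t : ℂ) * ⟪e, v⟫_ℂ‖ ^ 2 ≤ (1 - t) ^ 2 := by
    intro t ht
    have h2 := hle t ht
    rw [inner_smul_right, inner_smul_right, inner_self_eq_norm_sq_to_K, norm_smul, norm_smul, he,
      hv, norm_neg, Complex.norm_real, Real.norm_of_nonneg ht.1.le] at h2
    have h3 : ‖(1 : ℂ) + -(t : ℂ) * ((1 : ℝ) : ℂ) ^ 2‖ = 1 - t := by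
      rw [show (1 : ℂ) + -(t : ℂ) * ((1 : ℝ) : ℂ) ^ 2 = ((1 - t : ℝ) : ℂ) by push_cast; ring,
        Complex.norm_real, Real.norm_of_nonneg (by linarith [ht.2])]
    have h4 : 0 < 1 - t := by linarith [ht.2]
    have h5 : 0 < 1 - (t * 1) ^ 2 := by nlinarith [ht.1]
    erw [h3] at h2
    rcases eq_or_ne ‖1 + -(t : ℂ) * ⟪e, v⟫_ℂ‖ 0 with h6 | h6
    · rw [h6]; nlinarith
    · have h7 : 0 < ‖1 + -(t : ℂ) * ⟪e, v⟫_ℂ‖ ^ 2 := by positivity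
      rw [← mul_div_assoc, div_le_div_iff₀ (by positivity) h7] at h2
      nlinarith
  have h2 : c * ‖1 + -((1 : ℝ) : ℂ) * ⟪e, v⟫_ℂ‖ ^ 2 ≤ (1 - 1) ^ 2 := by
    have hl1 : Tendsto (fun t : ℝ => c * ‖1 + -(t : ℂ) * ⟪e, v⟫_ℂ‖ ^ 2) (𝓝[<] 1)
        (𝓝 (c * ‖1 + -((1 : ℝ) : ℂ) * ⟪e, v⟫_ℂ‖ ^ 2)) :=
      Tendsto.mono_left (Continuous.tendsto (by fun_prop) 1) nhdsWithin_le_nhds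
    have hl2 : Tendsto (fun t : ℝ => (1 - t) ^ 2) (𝓝[<] 1) (𝓝 ((1 - 1) ^ 2)) :=
      Tendsto.mono_left (Continuous.tendsto (by fun_prop) 1) nhdsWithin_le_nhds
    refine le_of_tendsto_of_tendsto hl1 hl2 ?_
    filter_upwards [Ioo_mem_nhdsLT one_pos] with t ht using h1 t ht
  have h3 : ‖1 + -((1 : ℝ) : ℂ) * ⟪e, v⟫_ℂ‖ ^ 2 = 0 := by
    refine le_antisymm ?_ (by positivity)
    rw [sub_self] at h2
    nlinarith
  have h4 : ⟪e, v⟫_ℂ = 1 := by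
    have := pow_eq_zero_iff (two_ne_zero) |>.1 h3
    rw [norm_eq_zero] at this
    push_cast at this
    linear_combination -this
  exact ((inner_eq_one_iff_of_norm_eq_one he hv).1 h4).symm

/-- Rescaled automorphisms fixing points that tend to the boundary asymptotically fix the
complex normal direction. -/
theorem tendsto_fderiv_scaling (h : PshDefining D V W ρ)
    (hDb : Bornology.IsBounded D) (hp : p ∈ frontier D) (hTS : IsScaling D ρ p e T S)
    (he : ‖e‖ = 1) {g : ι → CSpace n → CSpace n} (hg : ∀ k, AutOn D (g k)) {r c : ℝ} (hr : 0 < r)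
    (hc : 0 < c) (hgc : ∀ k, ∀ z ∈ D ∩ ball p r, c * -ρ z ≤ -ρ (g k z))
    (ha : Tendsto a 𝒰 (𝓝 p)) (haD : ∀ k, a k ∈ D) (hga : ∀ k, g k (a k) = a k) :
    Tendsto (fun k => fderiv ℂ (T (a k) ∘ g k ∘ S (a k)) 0 e) 𝒰 (𝓝 e) := by
  choose g' hg' hg'g hgg' using fun k => (hg k).exists_inverse
  have h0 : (0 : CSpace n) ∈ ball (0 : CSpace n) 1 := mem_ball_self one_pos
  have hpc := (convex_ball (0 : CSpace n) 1).isPreconnected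
  have hS0 := hTS.eventually_apply_zero ha haD
  obtain ⟨F, hF, hFm, hF0, hFl, hFd⟩ := (hTS.eventuallyHol_comp hg ha haD).exists_scaling_limit h
    hDb isOpen_ball hpc h0 hp hTS ha haD (hS0.mono fun k hk => by
      show g k (S (a k) 0) = a k
      rw [hk, hga])
  obtain ⟨F', hF', hFm', hF0', hFl', -⟩ := (hTS.eventuallyHol_comp hg' ha haD).exists_scaling_limit
    h hDb isOpen_ball hpc h0 hp hTS ha haD (hS0.mono fun k hk => by
      show g' k (S (a k) 0) = a k
      nth_rw 1 [hk, ← hga k]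
      exact hg'g k _ (haD k))
  have hSx : ∀ x ∈ ball (0 : CSpace n) 1, ∀ᶠ k in (𝒰 : Filter ι),
      S (a k) x ∈ D ∧ T (a k) (S (a k) x) = x := fun x hx => by
    rw [mem_ball_zero_iff] at hx
    obtain ⟨s, hs, hs1⟩ := exists_between hx
    obtain ⟨r', hr', hr''⟩ := hTS s hs1 1 one_pos
    refine (ha.eventually (ball_mem_nhds p hr')).mono fun k hk => ?_
    obtain ⟨-, h1, -⟩ := hr'' (a k) ⟨haD k, hk⟩
    exact ⟨(h1 x (by simpa using hs)).1.1, (h1 x (by simpa using hs)).2.1⟩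
  have hFF : ∀ x ∈ ball (0 : CSpace n) 1, F' (F x) = x := fun x hx => by
    obtain ⟨h1, h2⟩ := hFl x hx (fun _ => x) tendsto_const_nhds
    obtain ⟨h3, -⟩ := hFl' (F x) (hFm hx) _ h1
    refine tendsto_nhds_unique h3 (tendsto_const_nhds.congr' ?_)
    filter_upwards [h2, hSx x hx] with k hk hk'
    show x = T (a k) (g' k (S (a k) (T (a k) ((g k ∘ S (a k)) x))))
    rw [hk]
    show x = T (a k) (g' k (g k (S (a k) x)))
    rw [hg'g k _ hk'.1, hk'.2]
  have hn : ∀ x ∈ ball (0 : CSpace n) 1, ‖F x‖ = ‖x‖ := fun x hx => by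
    refine le_antisymm (Complex.norm_le_norm_of_mapsTo_ball hF
      (hFm.mono_right ball_subset_closedBall) hF0 (by simpa using hx)) ?_
    have := Complex.norm_le_norm_of_mapsTo_ball hF' (hFm'.mono_right ball_subset_closedBall) hF0'
      (by simpa using hFm hx)
    rwa [hFF x hx] at this
  have hy : ‖(2⁻¹ : ℂ) • e‖ = 2⁻¹ := by rw [norm_smul, he]; norm_num
  have hyb : (2⁻¹ : ℂ) • e ∈ ball (0 : CSpace n) 1 := by
    rw [mem_ball_zero_iff, hy]; norm_num
  set v := (2 : ℂ) • F ((2⁻¹ : ℂ) • e) with hv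
  have hv1 : ‖v‖ = 1 := by rw [hv, norm_smul, hn _ hyb, hy]; norm_num
  have hline : ∀ t : ℂ, ‖t‖ < 1 → F (t • e) = t • v := fun t ht => by
    have h1 : t • e = (t * 2) • (2⁻¹ : ℂ) • e := by
      rw [smul_smul]; congr 1; ring
    rw [h1, apply_smul_of_norm_eq hF hFm hF0 (norm_pos_iff.1 (by rw [hy]; norm_num))
      (by simpa using hyb) (hn _ hyb) (by rwa [← h1, norm_smul, he, mul_one]), hv, smul_smul]
  have hve : v = e := by
    refine eq_of_height_le he hv1 hc fun t ht => ?_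
    have h1 : ‖-(t : ℂ)‖ < 1 := by
      rw [norm_neg, Complex.norm_real, Real.norm_of_nonneg ht.1.le]; exact ht.2
    have h2 : ‖-(t : ℂ) • e‖ < 1 := by rwa [norm_smul, he, mul_one]
    have h3 : -(t : ℂ) • e ∈ ball (0 : CSpace n) 1 := by simpa using h2
    rw [← hline _ h1]
    obtain ⟨h4, h5⟩ := hFl _ h3 (fun _ => -(t : ℂ) • e) tendsto_const_nhds
    exact le_height_of_tendsto h hTS hr hc hgc ha haD he h2 (by simpa using hFm h3) h4 h5
  have hder : fderiv ℂ F 0 e = e := by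
    have h1 : HasFDerivAt F (fderiv ℂ F 0) ((0 : ℂ) • e) := by
      rw [zero_smul]
      exact (hF.differentiableAt (isOpen_ball.mem_nhds h0)).hasFDerivAt
    have h2 : HasDerivAt (fun t : ℂ => F (t • e)) (fderiv ℂ F 0 ((1 : ℂ) • e)) 0 :=
      h1.comp_hasDerivAt (0 : ℂ) ((hasDerivAt_id (0 : ℂ)).smul_const e)
    have h3 : HasDerivAt (fun t : ℂ => F (t • e)) ((1 : ℂ) • e) 0 := by
      refine ((hasDerivAt_id (0 : ℂ)).smul_const e).congr_of_eventuallyEq ?_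
      filter_upwards [ball_mem_nhds (0 : ℂ) one_pos] with t ht
      rw [hline t (by simpa using ht), hve]; rfl
    have := h2.unique h3
    rwa [one_smul] at this
  have := ((ContinuousLinearMap.apply ℂ (CSpace n) e).continuous.tendsto _).comp (hFd 0 h0)
  simp only [ContinuousLinearMap.apply_apply, hder] at this
  exact this

end CompactOrbits

section FixedPoints

variable {n : ℕ} {D V W : Set (CSpace n)} {ρ : CSpace n → ℝ}

/-- A power-bounded operator having an orbit whose image under `L` stays near a unit vector has a
nonzero fixed vector. -/
theorem exists_ne_zero_apply_eq {A L : CSpace n →L[ℂ] CSpace n} {u e : CSpace n} {C : ℝ}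
    (hA : ∀ j : ℕ, ‖A ^ j‖ ≤ C) (he : ‖e‖ = 1) (hL : ∀ j : ℕ, ‖L ((A ^ j) u) - e‖ ≤ 1 / 2) :
    ∃ v, v ≠ 0 ∧ A v = v := by
  have hb : ∀ j : ℕ, ‖(A ^ j) u‖ ≤ C * ‖u‖ := fun j => (A ^ j).le_of_opNorm_le (hA j) u
  set m : ℕ → CSpace n := fun N =>
    ((N + 1 : ℕ) : ℂ)⁻¹ • ∑ k ∈ Finset.range (N + 1), (A ^ k) u with hm
  obtain ⟨v, hv⟩ := (hyperfilter ℕ).exists_tendsto_of_norm_le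
    (Eventually.of_forall (norm_average_le hb))
  replace hv : Tendsto m (hyperfilter ℕ : Ultrafilter ℕ) (𝓝 v) := hv
  have hdiff : ∀ N, A (m N) - m N =
      ((N + 1 : ℕ) : ℂ)⁻¹ • ((A ^ (N + 1)) u - u) := fun N => by
    have h1 : ∀ k, A ((A ^ k) u) = (A ^ (k + 1)) u := fun k => by rw [pow_succ']; rfl
    rw [hm]
    show A (_ • _) - _ • _ = _
    rw [map_smul, ← smul_sub, map_sum]
    simp only [h1]
    rw [Finset.sum_range_succ, Finset.sum_range_succ' (fun k => (A ^ k) u), pow_zero,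
      one_apply_eq_self]
    congr 1
    abel
  have h0 : Tendsto (fun N => A (m N) - m N) (hyperfilter ℕ : Ultrafilter ℕ) (𝓝 0) := by
    simp only [hdiff]
    refine (tendsto_inv_smul_of_norm_le (C := C * ‖u‖ + ‖u‖) fun N => ?_).mono_left
      Nat.hyperfilter_le_atTop
    exact (norm_sub_le _ _).trans (by gcongr; exact hb _)
  refine ⟨v, fun hv0 => ?_, ?_⟩
  · have h1 : ∀ N, ‖L (m N) - e‖ ≤ 1 / 2 := fun N => by
      have h2 := norm_average_le hL N
      rw [Finset.sum_sub_distrib, Finset.sum_const, Finset.card_range, smul_sub,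
        ← Nat.cast_smul_eq_nsmul ℂ, inv_smul_smul₀ (Nat.cast_ne_zero.2 N.succ_ne_zero), ← map_sum, ← map_smul] at h2
      exact h2
    have h2 : Tendsto (fun N => ‖L (m N) - e‖) (hyperfilter ℕ : Ultrafilter ℕ) (𝓝 ‖L v - e‖) :=
      (((L.continuous.tendsto v).comp hv).sub_const e).norm
    have h3 := le_of_tendsto h2 (Eventually.of_forall h1)
    rw [hv0, map_zero, zero_sub, norm_neg, he] at h3
    norm_num at h3
  · exact sub_eq_zero.1 (tendsto_nhds_unique (((A.continuous.tendsto v).comp hv).sub hv) h0)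

/-- If no orbit accumulates at the boundary, isolated fixed points stay away from it. -/
theorem PshDefining.not_tendsto_fixed_points (h : PshDefining D V W ρ) (hDo : IsOpen D)
    (hDb : Bornology.IsBounded D)
    (hA : ∀ g : ℕ → CSpace n → CSpace n, (∀ k, AutOn D (g k)) → ∀ x ∈ D, ∀ b ∈ frontier D,
      ¬ Tendsto (fun k => g k x) (hyperfilter ℕ : Ultrafilter ℕ) (𝓝 b))
    {f : ℕ → CSpace n → CSpace n} (hf : ∀ k, AutOn D (f k))
    (hfix : ∀ k, DiscreteIn (FixOn D (f k))) {a : ℕ → CSpace n} (ha : ∀ k, a k ∈ FixOn D (f k))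
    {p : CSpace n} (hp : p ∈ frontier D) :
    ¬ Tendsto a (hyperfilter ℕ : Ultrafilter ℕ) (𝓝 p) := fun hap => by
  obtain ⟨e, he, T, S, hTS⟩ := h.exists_scaling hp
  replace hTS : IsScaling D ρ p e T S := hTS
  obtain ⟨r, hr, c, hc, hrc⟩ := h.exists_hopf hDo hDb
    (fun K hKD hK => h.exists_le_neg_of_isCompact hDo hDb hA hKD hK) hp
  have haD : ∀ k, a k ∈ D := fun k => (ha k).1
  have hiter : ∀ k j, (f k)^[j] (a k) = a k := fun k j => Function.iterate_fixed (ha k).2 j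
  have hclose : ∀ᶠ k in (hyperfilter ℕ : Filter ℕ), ∀ j : ℕ,
      ‖fderiv ℂ (T (a k) ∘ (f k)^[j] ∘ S (a k)) 0 e - e‖ ≤ 1 / 2 := by
    by_contra hcon
    have hch : ∀ k, ∃ j : ℕ, (¬ ∀ j : ℕ,
        ‖fderiv ℂ (T (a k) ∘ (f k)^[j] ∘ S (a k)) 0 e - e‖ ≤ 1 / 2) →
        ¬ ‖fderiv ℂ (T (a k) ∘ (f k)^[j] ∘ S (a k)) 0 e - e‖ ≤ 1 / 2 := fun k => by
      by_cases hk : ∀ j : ℕ, ‖fderiv ℂ (T (a k) ∘ (f k)^[j] ∘ S (a k)) 0 e - e‖ ≤ 1 / 2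
      · exact ⟨0, fun hk' => absurd hk hk'⟩
      · obtain ⟨j, hj⟩ := not_forall.1 hk
        exact ⟨j, fun _ => hj⟩
    choose j hj using hch
    have hlim := tendsto_fderiv_scaling h hDb hp hTS he (fun k => (hf k).iterate (j k)) hr hc
      (fun k => hrc _ ((hf k).iterate (j k))) hap haD fun k => hiter k (j k)
    have hlim' := (hlim.sub_const e).norm
    rw [sub_self, norm_zero] at hlim'
    refine hcon ?_
    filter_upwards [hlim'.eventually (gt_mem_nhds (one_half_pos (α := ℝ)))] with k hk
    by_contra hk'
    exact hj k hk' hk.le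
  obtain ⟨r', hr', hr''⟩ := hTS (1 / 2) (by norm_num) 1 one_pos
  obtain ⟨k, hk, hkr⟩ := (hclose.and (hap.eventually (ball_mem_nhds p hr'))).exists
  obtain ⟨hSd, -, hTd, -, hS0, -⟩ := hr'' (a k) ⟨haD k, hkr⟩
  obtain ⟨R, hR⟩ := hDb.subset_closedBall 0
  obtain ⟨d, hd, hdD⟩ := Metric.isOpen_iff.1 hDo (a k) (haD k)
  have hT1 : HasFDerivAt (T (a k)) (fderiv ℂ (T (a k)) (a k)) (a k) :=
    (hTd.differentiableAt ((hDo.inter isOpen_ball).mem_nhds ⟨haD k, hkr⟩)).hasFDerivAt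
  have hf1 : HasFDerivAt (f k) (fderiv ℂ (f k) (a k)) (a k) :=
    ((hf k).1.differentiableAt (hDo.mem_nhds (haD k))).hasFDerivAt
  have hS1 : HasFDerivAt (S (a k)) (fderiv ℂ (S (a k)) 0) 0 :=
    (hSd.differentiableAt (ball_mem_nhds 0 (by norm_num))).hasFDerivAt
  obtain ⟨v, hv0, hv⟩ := exists_ne_zero_apply_eq (A := fderiv ℂ (f k) (a k))
    (L := fderiv ℂ (T (a k)) (a k)) (u := fderiv ℂ (S (a k)) 0 e) (e := e)
    (fun j => (hf k).norm_fderiv_pow_le hDo hR hd hdD (ha k).2 j) he fun j => by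
      have h2 : HasFDerivAt (f k)^[j] (fderiv ℂ (f k) (a k) ^ j) (S (a k) 0) := by
        rw [hS0]; exact hf1.iterate (ha k).2 j
      have h3 : HasFDerivAt (T (a k)) (fderiv ℂ (T (a k)) (a k)) (((f k)^[j] ∘ S (a k)) 0) := by
        rw [Function.comp_apply, hS0, hiter]; exact hT1
      have h4 := (h3.comp 0 (h2.comp 0 hS1)).fderiv
      have h5 := hk j
      rw [h4] at h5
      exact h5
  exact hv0 ((hf k).eq_zero_of_fderiv_apply_eq hDo hDb (hfix k) (ha k) hv)

/-- The fixed points of automorphisms having at least two of them, all isolated, stay uniformly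
away from the boundary. -/
theorem PshDefining.exists_ball_subset (h : PshDefining D V W ρ) (hDo : IsOpen D)
    (hDc : IsPreconnected D) (hDb : Bornology.IsBounded D) :
    ∃ d > 0, ∀ f, AutOn D f → DiscreteIn (FixOn D f) → ¬ (FixOn D f).Subsingleton →
      ∀ p ∈ FixOn D f, ball p d ⊆ D := by
  by_contra! hcon
  choose f hf hfix hns a ha had using fun k : ℕ => hcon (1 / ((k : ℝ) + 1)) (by positivity)
  choose z hz hzD using fun k => not_subset.1 (had k)
  obtain ⟨p, hpc, hap⟩ := hDb.isCompact_closure.ultrafilter_le_nhds ((hyperfilter ℕ).map a) (by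
    rw [le_principal_iff]
    exact Eventually.of_forall (p := fun k => a k ∈ closure D) fun k => subset_closure (ha k).1)
  replace hap : Tendsto a (hyperfilter ℕ : Ultrafilter ℕ) (𝓝 p) := hap
  have hza : Tendsto (fun k => dist (z k) (a k)) (hyperfilter ℕ : Ultrafilter ℕ) (𝓝 0) :=
    squeeze_zero (fun k => dist_nonneg) (fun k => (hz k).le)
      ((tendsto_one_div_add_atTop_nhds_zero_nat (𝕜 := ℝ)).mono_left Nat.hyperfilter_le_atTop)
  have hzp : Tendsto z (hyperfilter ℕ : Ultrafilter ℕ) (𝓝 p) :=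
    (tendsto_iff_of_dist (by simpa only [dist_comm] using hza)).1 hap
  have hpD : p ∉ D := hDo.isClosed_compl.mem_of_tendsto hzp (Eventually.of_forall hzD)
  have hp : p ∈ frontier D := ⟨hpc, fun hi => hpD (interior_subset hi)⟩
  by_cases hA : ∀ g : ℕ → CSpace n → CSpace n, (∀ k, AutOn D (g k)) → ∀ x ∈ D, ∀ b ∈ frontier D,
      ¬ Tendsto (fun k => g k x) (hyperfilter ℕ : Ultrafilter ℕ) (𝓝 b)
  · exact h.not_tendsto_fixed_points hDo hDb hA hf hfix ha hp hap
  · push Not at hA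
    obtain ⟨g, hg, x, hx, b, hb, hlim⟩ := hA
    exact (hns 0).not_subsingleton (AutOn.subsingleton_fixOn_of_tendsto_frontier h hDo hDc hDb hg hx
      hb hlim (hf 0) (hfix 0))

end FixedPoints

theorem uniform_bound_strongly_pseudoconvex {n : ℕ}
    (D V : Set (CSpace n)) (ρ : CSpace n → ℝ)
    (hDopen : IsOpen D) (hDconn : IsConnected D) (hDbdd : Bornology.IsBounded D)
    (hspc : StronglyPseudoconvexDefiningFn D V ρ) :
    ∃ m : ℕ, 0 < m ∧ ∀ f : CSpace n → CSpace n, AutOn D f → DiscreteIn (FixOn D f) →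
      (FixOn D f).Finite ∧ (FixOn D f).ncard ≤ m := by
  obtain ⟨W, σ, h⟩ := hspc.exists_pshDefining hDbdd
  obtain ⟨d, hd, hball⟩ := h.exists_ball_subset hDopen hDconn.isPreconnected hDbdd
  obtain ⟨t, ht, hsep⟩ := AutOn.exists_separation hDopen hDbdd hd
  obtain ⟨F, hF, hDF⟩ := Metric.totallyBounded_iff.1 (hDbdd.isCompact_closure.totallyBounded.subset subset_closure)
    (t / 2) (half_pos ht)
  refine ⟨F.ncard + 1, by positivity, fun f hf hfix => ?_⟩
  by_cases hs : (FixOn D f).Subsingleton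
  · exact ⟨hs.finite, ((ncard_le_one hs.finite).2 fun a ha b hb => hs ha hb).trans (by omega)⟩
  have hch : ∀ z ∈ FixOn D f, ∃ c ∈ F, dist z c < t / 2 := fun z hz => by
    simpa using hDF hz.1
  choose! c hcF hc using hch
  have hinj : InjOn c (FixOn D f) := fun z hz w hw hzw => by
    refine hsep f hf hfix w hw (hball f hf hfix hs w hw) z hz ?_
    have h1 := hc z hz
    rw [hzw] at h1
    linarith [dist_triangle_right z w (c w), hc w hw]
  exact ⟨Set.Finite.of_injOn hcF hinj hF,
    (ncard_le_ncard_of_injOn c hcF hinj hF).trans (Nat.le_succ _)⟩
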